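/- Let μ be a uniformly distributed measure on ℝ^d with dim₀ μ = n and dim_∞ μ = p, let K ⊂ ℝ^d be compact and let η > 0. Then there exists a constant c > 0, depending only on n, d, K, μ and η, with the following property: every ball B centered at a point of Σ∩K and contained in K contains a ball B′ centered at a point of Σ with radius r(B′) ≥ c·r(B) such that bβ^n_μ(2^{−k} B′) ≤ η for every integer k ≥ 0, where 2^{−k}B′ denotes the ball concentric with B′ of radius 2^{−k} r(B′). -/

import Mathlib

open MeasureTheory Metric Filter Set

noncomputable section

abbrev Euc (d : ℕ) : Type := EuclideanSpace ℝ (Fin d)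

/-- The support of a measure: points all of whose closed balls have positive measure. -/
def msupport {d : ℕ} (μ : Measure (Euc d)) : Set (Euc d) :=
  {x | ∀ r : ℝ, 0 < r → 0 < μ (Metric.closedBall x r)}

/-- `φ` is a distribution function of the uniformly distributed measure `μ`. -/
def IsDistributionFunction {d : ℕ} (μ : Measure (Euc d)) (φ : ℝ → ENNReal) : Prop :=
  (msupport μ).Nonempty ∧
  (∀ r : ℝ, 0 < r → 0 < φ r ∧ φ r < ⊤) ∧
  (∀ x ∈ msupport μ, ∀ r : ℝ, 0 < r → μ (Metric.closedBall x r) = φ r)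

/-- `μ` is uniformly distributed. -/
def UniformlyDistributed {d : ℕ} (μ : Measure (Euc d)) : Prop :=
  ∃ φ : ℝ → ENNReal, IsDistributionFunction μ φ

/-- `dim₀ μ = n` : the limit of `φ(r)/rⁿ` as `r → 0⁺` exists, is finite and positive. -/
def HasDim0 (φ : ℝ → ENNReal) (n : ℕ) : Prop :=
  ∃ c : ℝ, 0 < c ∧
    Filter.Tendsto (fun r : ℝ => (φ r).toReal / r ^ n) (nhdsWithin 0 (Set.Ioi 0)) (nhds c)

/-- `dim_∞ μ = p` : the limit of `φ(r)/r^p` as `r → ∞` exists, is finite and positive. -/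
def HasDimInfty (φ : ℝ → ENNReal) (p : ℕ) : Prop :=
  ∃ c : ℝ, 0 < c ∧
    Filter.Tendsto (fun r : ℝ => (φ r).toReal / r ^ p) Filter.atTop (nhds c)

/-- The affine `n`-planes of `ℝ^d`. -/
def nPlanes (d n : ℕ) : Set (AffineSubspace ℝ (Euc d)) :=
  {L | (L : Set (Euc d)).Nonempty ∧ Module.finrank ℝ L.direction = n}

/-- Jones' beta number `β^n_μ(B(x,r))`. -/
def jonesBeta {d : ℕ} (n : ℕ) (μ : Measure (Euc d)) (x : Euc d) (r : ℝ) : ℝ :=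
  ⨅ L : nPlanes d n,
    ⨆ y : (msupport μ ∩ Metric.closedBall x r : Set (Euc d)),
      Metric.infDist y.1 (L.1 : Set (Euc d)) / r

/-- The bilateral beta number `bβ^n_μ(B(x,r))`. -/
def bilateralBeta {d : ℕ} (n : ℕ) (μ : Measure (Euc d)) (x : Euc d) (r : ℝ) : ℝ :=
  ⨅ L : nPlanes d n,
    ((⨆ y : (msupport μ ∩ Metric.closedBall x r : Set (Euc d)),
        Metric.infDist y.1 (L.1 : Set (Euc d)) / r) +
     (⨆ p : ((L.1 : Set (Euc d)) ∩ Metric.closedBall x r : Set (Euc d)),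
        Metric.infDist p.1 (msupport μ) / r))

/-- `μ` is doubling with constant `C`. -/
def DoublingWith {d : ℕ} (μ : Measure (Euc d)) (C : ℝ) : Prop :=
  ∀ x ∈ msupport μ, ∀ r : ℝ, 0 < r →
    μ (Metric.closedBall x (2 * r)) ≤ ENNReal.ofReal C * μ (Metric.closedBall x r)

/-- `μ` is doubling. -/
def Doubling {d : ℕ} (μ : Measure (Euc d)) : Prop :=
  ∃ C : ℝ, 0 < C ∧ DoublingWith μ C

/-- Weak convergence of a sequence of Radon measures. -/
def WeakConv {d : ℕ} (μs : ℕ → Measure (Euc d)) (μ : Measure (Euc d)) : Prop :=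
  ∀ f : Euc d → ℝ, Continuous f → HasCompactSupport f →
    Filter.Tendsto (fun j => ∫ x, f x ∂(μs j)) Filter.atTop (nhds (∫ x, f x ∂μ))

/-- `μ` is `n`-asymptotically optimally doubling. -/
def AsympOptDoubling {d : ℕ} (n : ℕ) (μ : Measure (Euc d)) : Prop :=
  ∀ K : Set (Euc d), IsCompact K → K ⊆ msupport μ →
    ∀ t : ℝ, t ∈ Set.Icc (1/2 : ℝ) 1 →
      Filter.Tendsto
        (fun r : ℝ => ⨆ x : K,
          |(μ (Metric.closedBall x.1 (t * r)) / μ (Metric.closedBall x.1 r)).toReal - t ^ n|)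
        (nhdsWithin 0 (Set.Ioi 0)) (nhds 0)

/-- Truncated `n`-Riesz transform `R_{r,s}μ(z)`. -/
def rieszT {d : ℕ} (n : ℕ) (μ : Measure (Euc d)) (z : Euc d) (r s : ℝ) : Euc d :=
  ∫ y in {y : Euc d | r ≤ dist y z ∧ dist y z ≤ s}, (‖y - z‖ ^ (n + 1))⁻¹ • (y - z) ∂μ

/-- `μ` is locally Ahlfors `n`-regular. -/
def LocallyAhlforsRegular {d : ℕ} (n : ℕ) (μ : Measure (Euc d)) : Prop :=
  ∀ K : Set (Euc d), IsCompact K → ∃ c : ℝ, 0 < c ∧ ∃ rK : ℝ, 0 < rK ∧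
    ∀ x ∈ msupport μ ∩ K, ∀ r : ℝ, 0 < r → r ≤ rK →
      ENNReal.ofReal (c⁻¹ * r ^ n) ≤ μ (Metric.closedBall x r) ∧
      μ (Metric.closedBall x r) ≤ ENNReal.ofReal (c * r ^ n)

/-- `μ` is locally uniformly `n`-rectifiable. -/
def LocUnifRectifiable {d : ℕ} (n : ℕ) (μ : Measure (Euc d)) : Prop :=
  LocallyAhlforsRegular n μ ∧
  ∀ K : Set (Euc d), IsCompact K →
    ∃ RK θK MK : ℝ, 0 < RK ∧ 0 < θK ∧ 0 < MK ∧
      ∀ x ∈ msupport μ ∩ K, ∀ R : ℝ, 0 < R → R ≤ RK →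
        ∃ g : EuclideanSpace ℝ (Fin n) → Euc d,
          LipschitzWith (Real.toNNReal MK) g ∧
          ENNReal.ofReal (θK * R ^ n) ≤ μ (Metric.closedBall x R ∩ Set.range g)

section

open scoped Topology RealInnerProductSpace

/-- A uniformly distributed measure with real-valued distribution function `f`. -/
def UD {d : ℕ} (ν : Measure (Euc d)) (f : ℝ → ℝ) : Prop :=
  (∀ t : ℝ, 0 < t → 0 < f t) ∧
    ∀ x ∈ msupport ν, ∀ t : ℝ, 0 < t → ν (closedBall x t) = ENNReal.ofReal (f t)

/-- The ultrafilter along which all limits are taken. -/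
abbrev ul : Filter ℕ := (hyperfilter ℕ : Filter ℕ)

theorem ul_le_atTop : ul ≤ atTop := Nat.hyperfilter_le_atTop

theorem exists_ul_lim {E : Type*} [PseudoMetricSpace E] [ProperSpace E] {x : ℕ → E} {x0 : E} {C : ℝ}
    (h : ∀ᶠ j in ul, dist (x j) x0 ≤ C) :
    ∃ y : E, Tendsto x ul (𝓝 y) := by
  have hc : IsCompact (closedBall x0 C) := isCompact_closedBall x0 C
  obtain ⟨y, -, hy⟩ := hc.ultrafilter_le_nhds' ((hyperfilter ℕ).map x) (by
    have h' : ∀ᶠ j in ul, x j ∈ closedBall x0 C := h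
    exact h')
  exact ⟨y, hy⟩

theorem msupport_eq_support {d : ℕ} (ν : Measure (Euc d)) : msupport ν = ν.support := by
  ext x
  rw [Measure.mem_support_iff_forall]
  constructor
  · intro h U hU
    obtain ⟨r, hr, hrU⟩ := Metric.nhds_basis_closedBall.mem_iff.1 hU
    exact (h r hr).trans_le (measure_mono hrU)
  · intro h r hr
    exact h _ (closedBall_mem_nhds x hr)

theorem isClosed_msupport {d : ℕ} (ν : Measure (Euc d)) : IsClosed (msupport ν) := by
  rw [msupport_eq_support]; exact Measure.isClosed_support

theorem ae_mem_msupport {d : ℕ} (ν : Measure (Euc d)) : ∀ᵐ x ∂ν, x ∈ msupport ν := by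
  rw [msupport_eq_support]; exact Measure.support_mem_ae

namespace UD

variable {d : ℕ} {ν : Measure (Euc d)} {f : ℝ → ℝ}

theorem measure_closedBall_lt_top (h : UD ν f) {x : Euc d} (hx : x ∈ msupport ν)
    (y : Euc d) (t : ℝ) : ν (closedBall y t) < ⊤ := by
  have h1 : closedBall y t ⊆ closedBall x (max t 0 + dist y x + 1) := by
    apply closedBall_subset_closedBall'
    linarith [le_max_left t 0]
  refine (measure_mono h1).trans_lt ?_
  rw [h.2 x hx _ (by positivity)]
  exact ENNReal.ofReal_lt_top

theorem isLocallyFinite (h : UD ν f) {x : Euc d} (hx : x ∈ msupport ν) :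
    IsLocallyFiniteMeasure ν :=
  ⟨fun y => ⟨closedBall y 1, closedBall_mem_nhds y one_pos, h.measure_closedBall_lt_top hx y 1⟩⟩

theorem measureReal_closedBall (h : UD ν f) {x : Euc d} (hx : x ∈ msupport ν) {t : ℝ}
    (ht : 0 < t) : ν.real (closedBall x t) = f t := by
  rw [measureReal_def, h.2 x hx t ht, ENNReal.toReal_ofReal (h.1 t ht).le]

end UD

/-- Rescaling of a measure sending the ball `B(x,r)` to the unit ball. -/
def resc {d : ℕ} (n : ℕ) (x : Euc d) (r : ℝ) (ν : Measure (Euc d)) : Measure (Euc d) :=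
  ENNReal.ofReal ((r ^ n)⁻¹) • ν.map (fun z => r⁻¹ • (z - x))

section resc

variable {d n : ℕ} {ν : Measure (Euc d)} {x : Euc d} {r : ℝ}

theorem measurableEmbedding_resc (x : Euc d) (hr : 0 < r) :
    MeasurableEmbedding (fun z : Euc d => r⁻¹ • (z - x)) :=
  ((Homeomorph.subRight x).trans (Homeomorph.smulOfNeZero r⁻¹ (inv_pos.2 hr).ne')).measurableEmbedding

theorem resc_closedBall (hr : 0 < r) (y : Euc d) (t : ℝ) :
    resc n x r ν (closedBall y t) =
      ENNReal.ofReal ((r ^ n)⁻¹) * ν (closedBall (x + r • y) (r * t)) := by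
  rw [resc, Measure.smul_apply, (measurableEmbedding_resc x hr).map_apply, smul_eq_mul]
  congr 2
  ext z
  have : z - (x + r • y) = r • (r⁻¹ • (z - x) - y) := by
    rw [smul_sub, smul_inv_smul₀ hr.ne', sub_sub]
  simp only [mem_preimage, mem_closedBall, dist_eq_norm]
  rw [this, norm_smul, Real.norm_of_nonneg hr.le]
  exact (mul_le_mul_iff_right₀ hr).symm

theorem mem_msupport_resc (hr : 0 < r) {y : Euc d} :
    y ∈ msupport (resc n x r ν) ↔ x + r • y ∈ msupport ν := by
  have hp : 0 < ENNReal.ofReal ((r ^ n)⁻¹) := ENNReal.ofReal_pos.2 (by positivity)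
  constructor
  · intro h t ht
    have := h (r⁻¹ * t) (by positivity)
    rw [resc_closedBall hr, mul_inv_cancel_left₀ hr.ne'] at this
    exact pos_iff_ne_zero.2 (right_ne_zero_of_mul this.ne')
  · intro h t ht
    rw [resc_closedBall hr]
    exact pos_iff_ne_zero.2 (mul_ne_zero hp.ne' (h _ (by positivity)).ne')

theorem sub_mem_msupport_resc (hr : 0 < r) {z : Euc d} :
    r⁻¹ • (z - x) ∈ msupport (resc n x r ν) ↔ z ∈ msupport ν := by
  rw [mem_msupport_resc hr, smul_inv_smul₀ hr.ne', add_sub_cancel]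

theorem zero_mem_msupport_resc (hr : 0 < r) :
    (0 : Euc d) ∈ msupport (resc n x r ν) ↔ x ∈ msupport ν := by
  rw [mem_msupport_resc hr, smul_zero, add_zero]

theorem UD.resc {f : ℝ → ℝ} (h : UD ν f) (hr : 0 < r) :
    UD (resc n x r ν) (fun t => (r ^ n)⁻¹ * f (r * t)) := by
  refine ⟨fun t ht => mul_pos (by positivity) (h.1 _ (by positivity)), fun y hy t ht => ?_⟩
  rw [mem_msupport_resc hr] at hy
  rw [resc_closedBall hr, h.2 _ hy _ (by positivity), ENNReal.ofReal_mul (by positivity)]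

theorem UD.resc_unif {c : ℝ} (h : UD ν (fun t => c * t ^ n)) (hr : 0 < r) :
    UD (_root_.resc n x r ν) (fun t => c * t ^ n) := by
  have := h.resc (n := n) (x := x) hr
  convert this using 2 with t
  have : r ^ n ≠ 0 := by positivity
  rw [mul_pow]
  field_simp

theorem integral_resc {E : Type*} [NormedAddCommGroup E] [NormedSpace ℝ E] (hr : 0 < r)
    (F : Euc d → E) :
    ∫ z, F z ∂(resc n x r ν) = (r ^ n)⁻¹ • ∫ z, F (r⁻¹ • (z - x)) ∂ν := by
  rw [resc, integral_smul_measure, (measurableEmbedding_resc x hr).integral_map,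
    ENNReal.toReal_ofReal (by positivity)]

theorem resc_resc {x' : Euc d} {r' : ℝ} (hr : 0 < r) (hr' : 0 < r') :
    resc n x' r' (resc n x r ν) = resc n (x + r • x') (r * r') ν := by
  simp only [resc]
  rw [Measure.map_smul, Measure.map_map (measurableEmbedding_resc x' hr').measurable
    (measurableEmbedding_resc x hr).measurable, smul_smul,
    ← ENNReal.ofReal_mul (by positivity)]
  congr 2
  · rw [mul_pow, mul_inv, mul_comm]
  · funext z
    simp only [Function.comp]
    rw [mul_inv, mul_comm r⁻¹, ← smul_smul, ← sub_sub, smul_sub r⁻¹ (z - x),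
      inv_smul_smul₀ hr.ne']

end resc

theorem measure_closedBall_zero_eq {d d' : ℕ} {ν : Measure (Euc d)} {ν' : Measure (Euc d')}
    {x : Euc d} {x' : Euc d'} (hfin : ∀ t, ν (closedBall x t) < ⊤)
    (h : ∀ t, 0 < t → ν (closedBall x t) = ν' (closedBall x' t)) (t : ℝ) :
    ν (closedBall x t) = ν' (closedBall x' t) := by
  rcases lt_trichotomy t 0 with ht | rfl | ht
  · simp [closedBall_eq_empty.2 ht]
  · have key : ∀ {k : ℕ} (ρ : Measure (Euc k)) (y : Euc k), ρ (closedBall y 1) ≠ ⊤ →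
        Tendsto (fun s => ρ (closedBall y s)) (𝓝[>] 0) (𝓝 (ρ (closedBall y 0))) := by
      intro k ρ y hy
      have := tendsto_measure_biInter_gt (μ := ρ) (s := fun s => closedBall y s) (a := (0:ℝ))
        (fun r _ => isClosed_closedBall.measurableSet.nullMeasurableSet)
        (fun i j _ hij => closedBall_subset_closedBall hij) ⟨1, one_pos, hy⟩
      have h2 : (⋂ r > (0:ℝ), closedBall y r) = closedBall y 0 := by
        ext z
        simp only [mem_iInter, mem_closedBall]
        exact ⟨fun hz => le_of_forall_gt_imp_ge_of_dense hz, fun hz r hr => hz.trans (le_of_lt hr)⟩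
      rw [h2] at this
      exact this
    have h1 := key ν x (hfin 1).ne
    have h2 := key ν' x' (by rw [← h 1 one_pos]; exact (hfin 1).ne)
    refine tendsto_nhds_unique h1 (h2.congr' ?_)
    filter_upwards [self_mem_nhdsWithin] with s hs using (h s hs).symm
  · exact h t ht

/-- Integrals of radial functions depend only on the measures of balls. -/
theorem integral_radial_eq {d d' : ℕ} {ν : Measure (Euc d)} {ν' : Measure (Euc d')}
    {x : Euc d} {x' : Euc d'} (hfin : ∀ t, ν (closedBall x t) < ⊤)
    (h : ∀ t, 0 < t → ν (closedBall x t) = ν' (closedBall x' t)) {g : ℝ → ℝ} (hg : Continuous g) :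
    ∫ z, g (dist z x) ∂ν = ∫ z, g (dist z x') ∂ν' := by
  have h' := measure_closedBall_zero_eq hfin h
  have hm : Measurable (fun z : Euc d => dist z x) := by fun_prop
  have hm' : Measurable (fun z : Euc d' => dist z x') := by fun_prop
  have pre : ∀ a b : ℝ, (fun z : Euc d => dist z x) ⁻¹' Ioc a b =
      closedBall x b \ closedBall x a := by
    intro a b; ext z
    simp [and_comm]
  have pre' : ∀ a b : ℝ, (fun z : Euc d' => dist z x') ⁻¹' Ioc a b =
      closedBall x' b \ closedBall x' a := by
    intro a b; ext z
    simp [and_comm]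
  have hmap : ν.map (fun z => dist z x) = ν'.map (fun z => dist z x') := by
    refine Measure.ext_of_Ioc' _ _ (fun a b hab => ?_) (fun a b hab => ?_)
    · rw [Measure.map_apply hm measurableSet_Ioc, pre]
      exact ((measure_mono sdiff_subset).trans_lt (hfin b)).ne
    · rw [Measure.map_apply hm measurableSet_Ioc, Measure.map_apply hm' measurableSet_Ioc, pre, pre',
        measure_sdiff (closedBall_subset_closedBall hab.le)
          isClosed_closedBall.measurableSet.nullMeasurableSet (hfin a).ne,
        measure_sdiff (closedBall_subset_closedBall hab.le)
          isClosed_closedBall.measurableSet.nullMeasurableSet (by rw [← h' a]; exact (hfin a).ne),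
        h' a, h' b]
  have e1 := integral_map (μ := ν) hm.aemeasurable
    (hg.aestronglyMeasurable (μ := ν.map (fun z => dist z x)))
  have e2 := integral_map (μ := ν') hm'.aemeasurable
    (hg.aestronglyMeasurable (μ := ν'.map (fun z => dist z x')))
  rw [← e1, ← e2, hmap]

/-- A continuous cut-off function, equal to `1` on `B(x,a)` and to `0` outside `B(x,a+ε)`. -/
def tent {d : ℕ} (x : Euc d) (a ε : ℝ) (z : Euc d) : ℝ :=
  max 0 (min 1 ((a + ε - dist z x) / ε))

section tent

variable {d : ℕ} (x : Euc d) {a ε : ℝ}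

theorem continuous_tent : Continuous (tent x a ε) := by
  unfold tent; fun_prop

theorem tent_nonneg (z : Euc d) : 0 ≤ tent x a ε z := le_max_left _ _

theorem tent_le_one (z : Euc d) : tent x a ε z ≤ 1 :=
  max_le zero_le_one (min_le_left _ _)

theorem tent_eq_one (hε : 0 < ε) {z : Euc d} (hz : dist z x ≤ a) : tent x a ε z = 1 := by
  have : 1 ≤ (a + ε - dist z x) / ε := by rw [le_div_iff₀ hε]; linarith
  rw [tent, min_eq_left this, max_eq_right zero_le_one]

theorem tent_eq_zero (hε : 0 < ε) {z : Euc d} (hz : a + ε ≤ dist z x) : tent x a ε z = 0 := by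
  have : (a + ε - dist z x) / ε ≤ 0 := div_nonpos_of_nonpos_of_nonneg (by linarith) hε.le
  rw [tent, max_eq_left ((min_le_right _ _).trans this)]

theorem hasCompactSupport_tent (hε : 0 < ε) : HasCompactSupport (tent x a ε) := by
  refine HasCompactSupport.intro (isCompact_closedBall x (a + ε)) fun z hz => ?_
  exact tent_eq_zero x hε (not_le.1 hz).le

variable (ν : Measure (Euc d)) [IsLocallyFiniteMeasure ν]

theorem le_integral_tent (hε : 0 < ε) : ν.real (closedBall x a) ≤ ∫ z, tent x a ε z ∂ν := by
  rw [← integral_indicator_one isClosed_closedBall.measurableSet]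
  refine integral_mono ((integrable_indicator_iff isClosed_closedBall.measurableSet).2 ?_)
    ((continuous_tent x).integrable_of_hasCompactSupport (hasCompactSupport_tent x hε)) ?_
  · exact (continuous_const (y := (1:ℝ))).continuousOn.integrableOn_compact (isCompact_closedBall x a)
  · intro z
    by_cases hz : z ∈ closedBall x a
    · simp [hz, tent_eq_one x hε (mem_closedBall.1 hz)]
    · simp [hz, tent_nonneg]

theorem integral_tent_le (hε : 0 < ε) :
    ∫ z, tent x a ε z ∂ν ≤ ν.real (closedBall x (a + ε)) := by
  rw [← integral_indicator_one isClosed_closedBall.measurableSet]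
  refine integral_mono
    ((continuous_tent x).integrable_of_hasCompactSupport (hasCompactSupport_tent x hε))
    ((integrable_indicator_iff isClosed_closedBall.measurableSet).2 ?_) ?_
  · exact (continuous_const (y := (1:ℝ))).continuousOn.integrableOn_compact (isCompact_closedBall x _)
  · intro z
    by_cases hz : z ∈ closedBall x (a + ε)
    · simp [hz, tent_le_one]
    · simp [hz, tent_eq_zero x hε (not_le.1 hz).le]

end tent

/-- Convergence of measures, and of their supports, along the ultrafilter `ul`. -/
structure LimitOf {d : ℕ} (νs : ℕ → Measure (Euc d)) (ν : Measure (Euc d)) : Prop where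
  int : ∀ f : Euc d → ℝ, Continuous f → HasCompactSupport f →
    Tendsto (fun j => ∫ z, f z ∂(νs j)) ul (𝓝 (∫ z, f z ∂ν))
  mem : ∀ (x : ℕ → Euc d) (x0 : Euc d), (∀ᶠ j in ul, x j ∈ msupport (νs j)) →
    Tendsto x ul (𝓝 x0) → x0 ∈ msupport ν
  approx : ∀ x0 ∈ msupport ν, ∃ x : ℕ → Euc d, (∀ᶠ j in ul, x j ∈ msupport (νs j)) ∧
    Tendsto x ul (𝓝 x0)

open CompactlySupported in
/-- Compactness of uniformly distributed measures whose distribution functions converge. -/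
theorem exists_limit {d n : ℕ} {νs : ℕ → Measure (Euc d)} {f : ℕ → ℝ → ℝ} {c : ℝ} (hc : 0 < c)
    (h : ∀ j, UD (νs j) (f j)) (h0 : ∀ j, 0 ∈ msupport (νs j))
    (hf : ∀ t, 0 < t → Tendsto (fun j => f j t) ul (𝓝 (c * t ^ n))) :
    ∃ ν : Measure (Euc d), UD ν (fun t => c * t ^ n) ∧ 0 ∈ msupport ν ∧ LimitOf νs ν := by
  have : ∀ j, IsLocallyFiniteMeasure (νs j) := fun j => (h j).isLocallyFinite (h0 j)
  have hlim : ∀ F : Euc d → ℝ, Continuous F → HasCompactSupport F →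
      ∃ y, Tendsto (fun j => ∫ z, F z ∂(νs j)) ul (𝓝 y) := by
    intro F hF hFc
    obtain ⟨M, hM⟩ := hF.bounded_above_of_compact_support hFc
    obtain ⟨R, hR0, hR⟩ := (hFc.isCompact.isBounded.subset_closedBall_lt 0 (0 : Euc d))
    have hM0 : 0 ≤ M := (norm_nonneg _).trans (hM 0)
    have hb : ∀ᶠ j in ul, f j R ≤ c * R ^ n + 1 :=
      (hf R hR0).eventually_le_const (by linarith)
    refine exists_ul_lim (x0 := 0) (C := M * (c * R ^ n + 1)) ?_
    filter_upwards [hb] with j hj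
    rw [dist_zero_right]
    have e : ∫ z, F z ∂(νs j) = ∫ z in closedBall 0 R, F z ∂(νs j) := by
      refine (setIntegral_eq_integral_of_forall_compl_eq_zero fun z hz => ?_).symm
      by_contra hne
      exact hz (hR (subset_tsupport _ hne))
    rw [e]
    refine (norm_setIntegral_le_of_norm_le_const ((h j).measure_closedBall_lt_top (h0 j) _ _)
      (fun z _ => hM z)).trans ?_
    rw [(h j).measureReal_closedBall (h0 j) hR0]
    exact mul_le_mul_of_nonneg_left hj hM0
  have hint : ∀ j, ∀ F : C_c(Euc d, ℝ), Integrable F (νs j) := fun j F =>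
    F.continuous.integrable_of_hasCompactSupport F.hasCompactSupport
  let L : C_c(Euc d, ℝ) → ℝ := fun F => limUnder ul (fun j => ∫ z, F z ∂(νs j))
  have hL : ∀ F : C_c(Euc d, ℝ), Tendsto (fun j => ∫ z, F z ∂(νs j)) ul (𝓝 (L F)) := fun F =>
    tendsto_nhds_limUnder (hlim F F.continuous F.hasCompactSupport)
  let Λ₀ : C_c(Euc d, ℝ) →ₗ[ℝ] ℝ :=
    { toFun := L
      map_add' := by
        intro F G
        refine tendsto_nhds_unique (hL (F + G)) (((hL F).add (hL G)).congr fun j => ?_)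
        rw [← integral_add (hint j F) (hint j G)]; rfl
      map_smul' := by
        intro a F
        refine tendsto_nhds_unique (hL (a • F)) (((hL F).const_mul a).congr fun j => ?_)
        rw [← integral_const_mul]; rfl }
  let Λ : C_c(Euc d, ℝ) →ₚ[ℝ] ℝ := PositiveLinearMap.mk₀ Λ₀ (by
    intro F hF
    refine ge_of_tendsto (hL F) (Eventually.of_forall fun j => integral_nonneg fun z => ?_)
    exact hF z)
  set ν := RealRMK.rieszMeasure Λ with hν
  have hreg : ν.Regular := inferInstance
  have hνint : ∀ F : Euc d → ℝ, Continuous F → HasCompactSupport F →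
      Tendsto (fun j => ∫ z, F z ∂(νs j)) ul (𝓝 (∫ z, F z ∂ν)) := by
    intro F hF hFc
    let F' : C_c(Euc d, ℝ) := ⟨⟨F, hF⟩, hFc⟩
    have := RealRMK.integral_rieszMeasure Λ F'
    have e : ∫ z, F z ∂ν = L F' := this
    rw [e]; exact hL F'
  have hball : ∀ (x : ℕ → Euc d) (x0 : Euc d), (∀ᶠ j in ul, x j ∈ msupport (νs j)) →
      Tendsto x ul (𝓝 x0) → ∀ t, 0 < t → ν.real (closedBall x0 t) = c * t ^ n := by
    intro x x0 hx hxl t ht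
    have hnear : ∀ ε, 0 < ε → ∀ᶠ j in ul, dist (x j) x0 < ε := fun ε hε =>
      (Metric.tendsto_nhds.1 hxl) ε hε
    apply le_antisymm
    · have up : ∀ ε, 0 < ε → ν.real (closedBall x0 t) ≤ c * (t + ε + ε) ^ n := by
        intro ε hε
        refine (le_integral_tent x0 ν hε).trans ?_
        refine le_of_tendsto_of_tendsto (hνint _ (continuous_tent x0) (hasCompactSupport_tent x0 hε))
          (hf (t + ε + ε) (by positivity)) ?_
        filter_upwards [hx, hnear ε hε] with j hj hj2
        refine (integral_tent_le x0 (νs j) hε).trans ?_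
        rw [← (h j).measureReal_closedBall hj (by positivity)]
        refine measureReal_mono (closedBall_subset_closedBall' ?_)
          ((h j).measure_closedBall_lt_top (h0 j) _ _).ne
        rw [dist_comm]; linarith
      have hcont : Tendsto (fun ε : ℝ => c * (t + ε + ε) ^ n) (𝓝[>] 0) (𝓝 (c * (t + 0 + 0) ^ n)) :=
        ((by fun_prop : Continuous fun ε : ℝ => c * (t + ε + ε) ^ n).tendsto 0).mono_left
          nhdsWithin_le_nhds
      rw [add_zero, add_zero] at hcont
      refine ge_of_tendsto hcont ?_
      filter_upwards [self_mem_nhdsWithin] with ε hε using up ε hε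
    · have low : ∀ ε, 0 < ε → 0 < t - ε - ε → c * (t - ε - ε) ^ n ≤ ν.real (closedBall x0 t) := by
        intro ε hε hε2
        have e : t = (t - ε) + ε := by ring
        rw [e]
        refine le_trans ?_ (integral_tent_le x0 ν hε)
        rw [← e]
        refine le_of_tendsto_of_tendsto (hf (t - ε - ε) hε2)
          (hνint _ (continuous_tent x0) (hasCompactSupport_tent x0 hε)) ?_
        filter_upwards [hx, hnear ε hε] with j hj hj2
        refine le_trans ?_ (le_integral_tent x0 (νs j) hε)
        rw [← (h j).measureReal_closedBall hj (by positivity)]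
        refine measureReal_mono (closedBall_subset_closedBall' ?_)
          ((h j).measure_closedBall_lt_top (h0 j) _ _).ne
        linarith
      have hcont : Tendsto (fun ε : ℝ => c * (t - ε - ε) ^ n) (𝓝[>] 0) (𝓝 (c * (t - 0 - 0) ^ n)) :=
        ((by fun_prop : Continuous fun ε : ℝ => c * (t - ε - ε) ^ n).tendsto 0).mono_left
          nhdsWithin_le_nhds
      rw [sub_zero, sub_zero] at hcont
      refine le_of_tendsto hcont ?_
      filter_upwards [Ioo_mem_nhdsGT (show (0:ℝ) < t / 2 by positivity)] with ε hε
      exact low ε hε.1 (by linarith [hε.2])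
  have hball' : ∀ (x : ℕ → Euc d) (x0 : Euc d), (∀ᶠ j in ul, x j ∈ msupport (νs j)) →
      Tendsto x ul (𝓝 x0) → ∀ t, 0 < t → ν (closedBall x0 t) = ENNReal.ofReal (c * t ^ n) := by
    intro x x0 hx hxl t ht
    rw [← hball x x0 hx hxl t ht, measureReal_def, ENNReal.ofReal_toReal]
    exact (isCompact_closedBall x0 t).measure_lt_top.ne
  have hmem : ∀ (x : ℕ → Euc d) (x0 : Euc d), (∀ᶠ j in ul, x j ∈ msupport (νs j)) →
      Tendsto x ul (𝓝 x0) → x0 ∈ msupport ν := by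
    intro x x0 hx hxl t ht
    rw [hball' x x0 hx hxl t ht]
    exact ENNReal.ofReal_pos.2 (by positivity)
  have happ : ∀ x0 ∈ msupport ν, ∃ x : ℕ → Euc d, (∀ᶠ j in ul, x j ∈ msupport (νs j)) ∧
      Tendsto x ul (𝓝 x0) := by
    intro x0 hx0
    have hproj : ∀ j, ∃ y ∈ msupport (νs j), infDist x0 (msupport (νs j)) = dist x0 y := fun j =>
      (isClosed_msupport _).exists_infDist_eq_dist ⟨0, h0 j⟩ x0
    choose y hy hyd using hproj
    refine ⟨y, Eventually.of_forall hy, Metric.tendsto_nhds.2 fun ε hε => ?_⟩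
    by_contra hcon
    have hcon : ∀ᶠ j in ul, ¬ dist (y j) x0 < ε := Ultrafilter.eventually_not.2 hcon
    have hε2 : 0 < ε / 4 := by positivity
    have hz : ∀ᶠ j in ul, ∫ z, tent x0 (ε / 4) (ε / 4) z ∂(νs j) = 0 := by
      filter_upwards [hcon] with j hj
      rw [integral_eq_zero_of_ae]
      filter_upwards [ae_mem_msupport (νs j)] with z hz
      apply tent_eq_zero x0 hε2
      have := infDist_le_dist_of_mem (x := x0) hz
      rw [hyd j, dist_comm x0 z, dist_comm] at this
      linarith
    have h1 : ∫ z, tent x0 (ε / 4) (ε / 4) z ∂ν = 0 :=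
      tendsto_nhds_unique (hνint _ (continuous_tent x0) (hasCompactSupport_tent x0 hε2))
        (tendsto_const_nhds.congr' (hz.mono fun j hj => hj.symm))
    have h2 := le_integral_tent x0 ν (a := ε / 4) hε2
    rw [h1] at h2
    have h3 := hx0 (ε / 4) hε2
    have : 0 < ν.real (closedBall x0 (ε / 4)) :=
      ENNReal.toReal_pos h3.ne' (isCompact_closedBall x0 _).measure_lt_top.ne
    linarith
  refine ⟨ν, ⟨fun t ht => by positivity, ?_⟩, ?_, ⟨hνint, hmem, happ⟩⟩
  · intro x0 hx0 t ht
    obtain ⟨x, hx, hxl⟩ := happ x0 hx0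
    exact hball' x x0 hx hxl t ht
  · exact hmem (fun _ => 0) 0 (Eventually.of_forall h0) tendsto_const_nhds

section Frames

variable {d n : ℕ}

/-- Coordinates with respect to a frame `u`. -/
def cf (u : Fin n → Euc d) : Euc d →ₗ[ℝ] Euc n where
  toFun y := WithLp.toLp 2 (fun k => ⟪u k, y⟫)
  map_add' y z := by ext k; simp [inner_add_right]
  map_smul' a y := by ext k; simp [inner_smul_right]

/-- The linear combination of the frame `u` with given coordinates. -/
def emb (u : Fin n → Euc d) : Euc n →ₗ[ℝ] Euc d where
  toFun v := ∑ k, v k • u k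
  map_add' v w := by simp [add_smul, Finset.sum_add_distrib]
  map_smul' a v := by simp [mul_smul, Finset.smul_sum]

/-- The component orthogonal to the frame `u`. -/
def res (u : Fin n → Euc d) : Euc d →ₗ[ℝ] Euc d := LinearMap.id - emb u ∘ₗ cf u

variable {u : Fin n → Euc d}

@[simp] theorem cf_apply (y : Euc d) (k : Fin n) : cf u y k = ⟪u k, y⟫ := rfl

theorem emb_apply (v : Euc n) : emb u v = ∑ k, v k • u k := rfl

theorem res_apply (y : Euc d) : res u y = y - emb u (cf u y) := rfl

theorem emb_cf_add_res (y : Euc d) : emb u (cf u y) + res u y = y := by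
  rw [res_apply]; abel

theorem inner_emb (v : Euc n) (y : Euc d) : ⟪emb u v, y⟫ = ⟪v, cf u y⟫ := by
  rw [emb_apply, sum_inner, PiLp.inner_apply]
  refine Finset.sum_congr rfl fun k _ => ?_
  rw [real_inner_smul_left]; simp [mul_comm]

theorem cf_emb (hu : Orthonormal ℝ u) (v : Euc n) : cf u (emb u v) = v := by
  ext k
  rw [cf_apply, emb_apply, hu.inner_right_fintype]

theorem inner_emb_emb (hu : Orthonormal ℝ u) (v w : Euc n) : ⟪emb u v, emb u w⟫ = ⟪v, w⟫ := by
  rw [inner_emb, cf_emb hu]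

theorem norm_emb (hu : Orthonormal ℝ u) (v : Euc n) : ‖emb u v‖ = ‖v‖ := by
  rw [← sq_eq_sq₀ (norm_nonneg _) (norm_nonneg _), ← real_inner_self_eq_norm_sq,
    ← real_inner_self_eq_norm_sq, inner_emb_emb hu]

theorem res_emb (hu : Orthonormal ℝ u) (v : Euc n) : res u (emb u v) = 0 := by
  rw [res_apply, cf_emb hu, sub_self]

theorem cf_res (hu : Orthonormal ℝ u) (y : Euc d) : cf u (res u y) = 0 := by
  rw [res_apply, map_sub, cf_emb hu, sub_self]

theorem inner_emb_res (hu : Orthonormal ℝ u) (v : Euc n) (y : Euc d) :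
    ⟪emb u v, res u y⟫ = 0 := by
  rw [inner_emb, cf_res hu, inner_zero_right]

theorem norm_sq_eq_cf_res (hu : Orthonormal ℝ u) (y : Euc d) :
    ‖y‖ ^ 2 = ‖cf u y‖ ^ 2 + ‖res u y‖ ^ 2 := by
  conv_lhs => rw [← emb_cf_add_res (u := u) y]
  rw [norm_add_sq_real, inner_emb_res hu, norm_emb hu]; ring

theorem norm_cf_le (hu : Orthonormal ℝ u) (y : Euc d) : ‖cf u y‖ ≤ ‖y‖ := by
  have := norm_sq_eq_cf_res hu y
  exact abs_le_of_sq_le_sq' (by nlinarith [sq_nonneg ‖res u y‖]) (norm_nonneg _) |>.2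

theorem norm_res_le (hu : Orthonormal ℝ u) (y : Euc d) : ‖res u y‖ ≤ ‖y‖ := by
  have := norm_sq_eq_cf_res hu y
  exact abs_le_of_sq_le_sq' (by nlinarith [sq_nonneg ‖cf u y‖]) (norm_nonneg _) |>.2

theorem norm_le_cf_add_res (hu : Orthonormal ℝ u) (y : Euc d) :
    ‖y‖ ≤ ‖cf u y‖ + ‖res u y‖ := by
  conv_lhs => rw [← emb_cf_add_res (u := u) y]
  exact (norm_add_le _ _).trans_eq (by rw [norm_emb hu])

theorem continuous_cf : Continuous (cf u) := LinearMap.continuous_of_finiteDimensional _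
theorem continuous_emb : Continuous (emb u) := LinearMap.continuous_of_finiteDimensional _
theorem continuous_res : Continuous (res u) := LinearMap.continuous_of_finiteDimensional _

theorem emb_mem_span (v : Euc n) : emb u v ∈ Submodule.span ℝ (range u) := by
  rw [emb_apply]
  exact Submodule.sum_mem _ fun k _ => Submodule.smul_mem _ _ (Submodule.subset_span ⟨k, rfl⟩)

theorem res_eq_zero_iff (hu : Orthonormal ℝ u) {y : Euc d} :
    res u y = 0 ↔ y ∈ Submodule.span ℝ (range u) := by
  constructor
  · intro h
    rw [← emb_cf_add_res (u := u) y, h, add_zero]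
    exact emb_mem_span _
  · intro h
    have : Submodule.span ℝ (range u) ≤ LinearMap.ker (res u) := by
      rw [Submodule.span_le]
      rintro _ ⟨k, rfl⟩
      have : u k = emb u (EuclideanSpace.single k 1) := by
        rw [emb_apply, Finset.sum_eq_single k]
        · simp
        · intro b _ hb; simp [hb]
        · simp
      rw [SetLike.mem_coe, LinearMap.mem_ker, this, res_emb hu]
    exact this h

theorem tendsto_res {l : Filter ℕ} {us : ℕ → Fin n → Euc d} {ys : ℕ → Euc d} {y : Euc d}
    (h : Tendsto us l (𝓝 u)) (hy : Tendsto ys l (𝓝 y)) :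
    Tendsto (fun j => res (us j) (ys j)) l (𝓝 (res u y)) := by
  have hc : Continuous fun p : (Fin n → Euc d) × Euc d => p.2 - ∑ k, ⟪p.1 k, p.2⟫ • p.1 k := by
    fun_prop
  exact (hc.tendsto (u, y)).comp (h.prodMk_nhds hy)

theorem exists_frame_lim {us : ℕ → Fin n → Euc d} (h : ∀ᶠ j in ul, Orthonormal ℝ (us j)) :
    ∃ u : Fin n → Euc d, Orthonormal ℝ u ∧ Tendsto us ul (𝓝 u) := by
  have h1 : ∀ k, ∃ y, Tendsto (fun j => us j k) ul (𝓝 y) := fun k =>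
    exists_ul_lim (x0 := 0) (C := 1) (h.mono fun j hj => by rw [dist_zero_right, hj.1 k])
  choose u hu using h1
  have hl : Tendsto us ul (𝓝 u) := tendsto_pi_nhds.2 hu
  refine ⟨u, ?_, hl⟩
  rw [orthonormal_iff_ite]
  intro i k
  refine tendsto_nhds_unique ((hu i).inner (hu k)) (tendsto_const_nhds.congr' ?_)
  filter_upwards [h] with j hj
  exact ((orthonormal_iff_ite.1 hj) i k).symm

end Frames

/-- Near `x`, at distances less than `t`, the set `S` is `a`-close to some `n`-plane through `x`. -/
def FlatA {d : ℕ} (n : ℕ) (S : Set (Euc d)) (x : Euc d) (t a : ℝ) : Prop :=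
  ∃ u : Fin n → Euc d, Orthonormal ℝ u ∧ ∀ y ∈ S, dist y x < t → ‖res u (y - x)‖ ≤ a

section FlatA

variable {d n : ℕ} {S : Set (Euc d)} {x x' : Euc d} {t t' a a' : ℝ}

theorem FlatA.mono (h : FlatA n S x t a) (ht : t' ≤ t) (ha : a ≤ a') : FlatA n S x t' a' := by
  obtain ⟨u, hu, h⟩ := h
  exact ⟨u, hu, fun y hy hyt => (h y hy (hyt.trans_le ht)).trans ha⟩

theorem FlatA.recenter {D : ℝ} (h : FlatA n S x t a) (hx : dist x' x ≤ D) :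
    FlatA n S x' (t - D) (a + D) := by
  obtain ⟨u, hu, h⟩ := h
  refine ⟨u, hu, fun y hy hyt => ?_⟩
  have e : y - x' = (y - x) - (x' - x) := by abel
  rw [e, map_sub]
  refine (norm_sub_le _ _).trans (add_le_add (h y hy ?_) ?_)
  · linarith [dist_triangle y x' x]
  · exact (norm_res_le hu _).trans (by rwa [← dist_eq_norm])

theorem FlatA.recenter_mem {D : ℝ} (h : FlatA n S x t a) (hx' : x' ∈ S) (hx : dist x' x ≤ D)
    (hD : D < t) : FlatA n S x' (t - D) (2 * a) := by
  obtain ⟨u, hu, h⟩ := h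
  refine ⟨u, hu, fun y hy hyt => ?_⟩
  have e : y - x' = (y - x) - (x' - x) := by abel
  rw [e, map_sub, two_mul]
  refine (norm_sub_le _ _).trans (add_le_add (h y hy ?_) (h x' hx' (hx.trans_lt hD)))
  linarith [dist_triangle y x' x]

theorem flatA_resc_iff {m : ℕ} {ν : Measure (Euc d)} {x y : Euc d} {r : ℝ} (hr : 0 < r) :
    FlatA n (msupport (resc m x r ν)) y t a ↔
      FlatA n (msupport ν) (x + r • y) (r * t) (r * a) := by
  have hd : ∀ z : Euc d, x + r • z - (x + r • y) = r • (z - y) := fun z => by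
    rw [smul_sub]; abel
  constructor
  · rintro ⟨u, hu, h⟩
    refine ⟨u, hu, fun z hz hzt => ?_⟩
    obtain ⟨w, rfl⟩ : ∃ w, z = x + r • w := ⟨r⁻¹ • (z - x), by simp [hr.ne']⟩
    rw [dist_eq_norm, hd, norm_smul, Real.norm_of_nonneg hr.le, mul_lt_mul_iff_right₀ hr,
      ← dist_eq_norm] at hzt
    rw [hd, map_smul, norm_smul, Real.norm_of_nonneg hr.le, mul_le_mul_iff_right₀ hr]
    exact h w ((mem_msupport_resc hr).2 hz) hzt
  · rintro ⟨u, hu, h⟩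
    refine ⟨u, hu, fun w hw hwt => ?_⟩
    have := h (x + r • w) ((mem_msupport_resc hr).1 hw) (by
      rw [dist_eq_norm, hd, norm_smul, Real.norm_of_nonneg hr.le, mul_lt_mul_iff_right₀ hr,
        ← dist_eq_norm]
      exact hwt)
    rwa [hd, map_smul, norm_smul, Real.norm_of_nonneg hr.le, mul_le_mul_iff_right₀ hr] at this

variable {νs : ℕ → Measure (Euc d)} {ν : Measure (Euc d)}

/-- Flatness passes to limits. -/
theorem LimitOf.flatA (h : LimitOf νs ν) {xs : ℕ → Euc d} {as : ℕ → ℝ}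
    (hx : Tendsto xs ul (𝓝 x)) (ha : Tendsto as ul (𝓝 a))
    (hF : ∀ᶠ j in ul, FlatA n (msupport (νs j)) (xs j) t (as j)) :
    FlatA n (msupport ν) x t a := by
  obtain ⟨us, hus⟩ := Filter.Eventually.choice hF
  obtain ⟨u, hu, hul⟩ := exists_frame_lim (hus.mono fun j hj => hj.1)
  refine ⟨u, hu, fun y hy hyt => ?_⟩
  obtain ⟨ys, hys, hyl⟩ := h.approx y hy
  refine le_of_tendsto_of_tendsto (tendsto_res hul (hyl.sub hx)).norm ha ?_
  have hd : ∀ᶠ j in ul, dist (ys j) (xs j) < t := (hyl.dist hx).eventually_lt_const hyt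
  filter_upwards [hus, hys, hd] with j h1 h2 h3 using h1.2 _ h2 h3

/-- Flatness of the limit implies flatness of the approximating measures. -/
theorem LimitOf.flatA_of_limit (h : LimitOf νs ν) {xs : ℕ → Euc d} {ts : ℕ → ℝ}
    (hx : Tendsto xs ul (𝓝 x)) (ht : Tendsto ts ul (𝓝 t')) (htt : t' < t) (haa : a < a')
    (hF : FlatA n (msupport ν) x t a) :
    ∀ᶠ j in ul, FlatA n (msupport (νs j)) (xs j) (ts j) a' := by
  obtain ⟨u, hu, hF⟩ := hF
  by_contra hcon
  have hcon : ∀ᶠ j in ul, ¬ FlatA n (msupport (νs j)) (xs j) (ts j) a' :=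
    Ultrafilter.eventually_not.2 hcon
  have hc2 : ∀ᶠ j in ul, ∃ y : Euc d, y ∈ msupport (νs j) ∧ dist y (xs j) < ts j ∧
      a' < ‖res u (y - xs j)‖ := by
    filter_upwards [hcon] with j hj
    by_contra h2
    push Not at h2
    exact hj ⟨u, hu, h2⟩
  obtain ⟨ys, hys⟩ := Filter.Eventually.choice hc2
  have hb : ∀ᶠ j in ul, dist (ys j) x ≤ t + 1 := by
    filter_upwards [hys, ht.eventually_lt_const htt, (Metric.tendsto_nhds.1 hx) 1 one_pos]
      with j h1 h2 h3
    linarith [dist_triangle (ys j) (xs j) x]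
  obtain ⟨y, hy⟩ := exists_ul_lim hb
  have hyS : y ∈ msupport ν := h.mem ys y (hys.mono fun j hj => hj.1) hy
  have hd : dist y x ≤ t' := le_of_tendsto_of_tendsto (hy.dist hx) ht
    (hys.mono fun j hj => hj.2.1.le)
  have h1 := hF y hyS (hd.trans_lt htt)
  have h2 : a' ≤ ‖res u (y - x)‖ := ge_of_tendsto
    ((continuous_res.tendsto _).comp (hy.sub hx)).norm (hys.mono fun j hj => hj.2.2.le)
  linarith

end FlatA

/-- The cut-off profile `(1 - u)₊³`. -/
def prof (u : ℝ) : ℝ := max (1 - u) 0 ^ 3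
/-- Minus the derivative of `prof`. -/
def prof1 (u : ℝ) : ℝ := 3 * max (1 - u) 0 ^ 2
/-- The second derivative of `prof`. -/
def prof2 (u : ℝ) : ℝ := 6 * max (1 - u) 0

theorem continuous_prof : Continuous prof := by unfold prof; fun_prop
theorem continuous_prof1 : Continuous prof1 := by unfold prof1; fun_prop
theorem continuous_prof2 : Continuous prof2 := by unfold prof2; fun_prop

theorem prof_nonneg (u : ℝ) : 0 ≤ prof u := by unfold prof; positivity
theorem prof1_nonneg (u : ℝ) : 0 ≤ prof1 u := by unfold prof1; positivity
theorem prof2_nonneg (u : ℝ) : 0 ≤ prof2 u := by unfold prof2; positivity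

theorem max_one_sub_le {u : ℝ} (hu : 0 ≤ u) : max (1 - u) 0 ≤ 1 := max_le (by linarith) zero_le_one

theorem prof1_le {u : ℝ} (hu : 0 ≤ u) : prof1 u ≤ 3 := by
  have := pow_le_one₀ (n := 2) (le_max_right (1 - u) 0) (max_one_sub_le hu)
  unfold prof1; linarith

theorem prof2_le {u : ℝ} (hu : 0 ≤ u) : prof2 u ≤ 6 := by
  have := max_one_sub_le hu
  unfold prof2; linarith

theorem prof_eq_zero {u : ℝ} (hu : 1 ≤ u) : prof u = 0 := by
  unfold prof; rw [max_eq_right (by linarith)]; norm_num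

theorem prof1_eq_zero {u : ℝ} (hu : 1 ≤ u) : prof1 u = 0 := by
  unfold prof1; rw [max_eq_right (by linarith)]; norm_num

theorem prof2_eq_zero {u : ℝ} (hu : 1 ≤ u) : prof2 u = 0 := by
  unfold prof2; rw [max_eq_right (by linarith)]; norm_num

theorem prof_taylor (u h : ℝ) :
    |prof (u + h) - prof u + prof1 u * h - prof2 u * h ^ 2 / 2| ≤ |h| ^ 3 := by
  unfold prof prof1 prof2
  obtain ⟨s, rfl⟩ : ∃ s, u = 1 - s := ⟨1 - u, by ring⟩
  have e1 : 1 - (1 - s) = s := by ring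
  have e2 : 1 - (1 - s + h) = s - h := by ring
  rw [e1, e2]
  rcases le_total 0 s with hs | hs <;> rcases le_total h s with hh | hh
  · rw [max_eq_left hs, max_eq_left (by linarith), ← abs_pow]
    have : (s - h) ^ 3 - s ^ 3 + 3 * s ^ 2 * h - 6 * s * h ^ 2 / 2 = -h ^ 3 := by ring
    rw [this, abs_neg]
  · rw [max_eq_left hs, max_eq_right (by linarith)]
    have h0 : 0 ≤ h := hs.trans hh
    rw [abs_of_nonneg h0, abs_le]
    have h1 : 0 ≤ (h - s) ^ 3 := by have := sub_nonneg.2 hh; positivity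
    have h2 : (h - s) ^ 3 ≤ h ^ 3 := pow_le_pow_left₀ (by linarith) (by linarith) 3
    have h3 : 0 ≤ h ^ 3 := by positivity
    constructor <;> nlinarith
  · rw [max_eq_right hs, max_eq_left (by linarith)]
    have h0 : h ≤ 0 := hh.trans hs
    rw [abs_of_nonpos h0]
    have h1 : 0 ≤ (s - h) ^ 3 := by have := sub_nonneg.2 hh; positivity
    have h2 : (s - h) ^ 3 ≤ (-h) ^ 3 := pow_le_pow_left₀ (by linarith) (by linarith) 3
    norm_num
    rw [abs_of_nonneg (sub_nonneg.2 hh)]; exact h2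
  · rw [max_eq_right hs, max_eq_right (by linarith)]
    norm_num

theorem prof_convex (u h : ℝ) : prof u + prof1 u * h ≤ prof (u - h) := by
  unfold prof prof1
  obtain ⟨s, rfl⟩ : ∃ s, u = 1 - s := ⟨1 - u, by ring⟩
  have e1 : 1 - (1 - s) = s := by ring
  have e2 : 1 - (1 - s - h) = s + h := by ring
  rw [e1, e2]
  rcases le_total 0 s with hs | hs
  · rw [max_eq_left hs]
    rcases le_total 0 (s + h) with hh | hh
    · rw [max_eq_left hh]
      nlinarith [mul_nonneg (sq_nonneg h) (by linarith : 0 ≤ 3 * s + h)]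
    · rw [max_eq_right hh]
      nlinarith [mul_nonneg (sq_nonneg s) (by linarith : 0 ≤ -(s + 3 * h))]
  · rw [max_eq_right hs]
    have : (0:ℝ) ≤ max (s + h) 0 ^ 3 := by positivity
    linarith

theorem Continuous.integrable_of_eq_zero {d : ℕ} {E : Type*} [NormedAddCommGroup E]
    {ν : Measure (Euc d)} [IsLocallyFiniteMeasure ν] {F : Euc d → E} (hF : Continuous F) (R : ℝ)
    (h : ∀ z, R < ‖z‖ → F z = 0) : Integrable F ν :=
  hF.integrable_of_hasCompactSupport (HasCompactSupport.intro (isCompact_closedBall 0 R)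
    fun z hz => h z (by simpa using hz))

theorem hasCompactSupport_of_eq_zero {d : ℕ} {E : Type*} [NormedAddCommGroup E]
    {F : Euc d → E} (R : ℝ) (h : ∀ z, R < ‖z‖ → F z = 0) : HasCompactSupport F :=
  HasCompactSupport.intro (isCompact_closedBall 0 R) fun z hz => h z (by simpa using hz)

theorem abs_integral_le_of_eq_zero {d : ℕ} {E : Type*} [NormedAddCommGroup E] [NormedSpace ℝ E]
    {ν : Measure (Euc d)} [IsLocallyFiniteMeasure ν]
    {F : Euc d → E} (R M : ℝ) (h : ∀ z, R < ‖z‖ → F z = 0) (hM : ∀ z, ‖z‖ ≤ R → ‖F z‖ ≤ M) :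
    ‖∫ z, F z ∂ν‖ ≤ M * ν.real (closedBall 0 R) := by
  rw [← setIntegral_eq_integral_of_forall_compl_eq_zero (s := closedBall 0 R)
    fun z hz => h z (by simpa using hz)]
  exact norm_setIntegral_le_of_norm_le_const (isCompact_closedBall 0 R).measure_lt_top
    fun z hz => hM z (by simpa using hz)

theorem one_le_sq_of_lt {a : ℝ} (ha : 1 < a) : 1 ≤ a ^ 2 := by nlinarith

theorem integral_lin {α : Type*} [MeasurableSpace α] {ν : Measure α} {a b c d e : α → ℝ}
    (ha : Integrable a ν) (hb : Integrable b ν) (hc : Integrable c ν) (hd : Integrable d ν)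
    (he : Integrable e ν) :
    ∫ z, (a z - b z + (c z - d z) - e z) ∂ν =
      ∫ z, a z ∂ν - ∫ z, b z ∂ν + (∫ z, c z ∂ν - ∫ z, d z ∂ν) - ∫ z, e z ∂ν := by
  have h1 : ∫ z, (a z - b z + (c z - d z) - e z) ∂ν = _ :=
    integral_sub (f := fun z => a z - b z + (c z - d z)) (g := e) ((ha.sub hb).add (hc.sub hd)) he
  have h2 : ∫ z, (a z - b z + (c z - d z)) ∂ν = _ :=
    integral_add (f := fun z => a z - b z) (g := fun z => c z - d z) (ha.sub hb) (hc.sub hd)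
  rw [h1, h2, integral_sub ha hb, integral_sub hc hd]

section Moments

variable {d : ℕ}

/-- The radial moment `∫ prof1 |z|²`. -/
def mG (ν : Measure (Euc d)) : ℝ := ∫ z, prof1 (‖z‖ ^ 2) ∂ν
/-- The first moment. -/
def mB (ν : Measure (Euc d)) : Euc d := ∫ z, prof1 (‖z‖ ^ 2) • z ∂ν
/-- The second moment, a quadratic form. -/
def mQ (ν : Measure (Euc d)) (y : Euc d) : ℝ := ∫ z, prof2 (‖z‖ ^ 2) * ⟪z, y⟫ ^ 2 ∂ν

variable {ν : Measure (Euc d)}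

theorem mQ_nonneg (y : Euc d) : 0 ≤ mQ ν y :=
  integral_nonneg fun _ => mul_nonneg (prof2_nonneg _) (sq_nonneg _)

theorem mQ_smul (a : ℝ) (y : Euc d) : mQ ν (a • y) = a ^ 2 * mQ ν y := by
  rw [mQ, mQ, ← integral_const_mul]
  refine integral_congr_ae (Eventually.of_forall fun z => ?_)
  simp only [inner_smul_right]; ring

variable [IsLocallyFiniteMeasure ν]

theorem integrable_prof1 : Integrable (fun z : Euc d => prof1 (‖z‖ ^ 2)) ν :=
  Continuous.integrable_of_eq_zero (by have := continuous_prof1; fun_prop) 1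
    fun z hz => prof1_eq_zero (one_le_sq_of_lt hz)

theorem integrable_prof : Integrable (fun z : Euc d => prof (‖z‖ ^ 2)) ν :=
  Continuous.integrable_of_eq_zero (by have := continuous_prof; fun_prop) 1
    fun z hz => prof_eq_zero (one_le_sq_of_lt hz)

theorem integrable_prof1_smul : Integrable (fun z : Euc d => prof1 (‖z‖ ^ 2) • z) ν :=
  Continuous.integrable_of_eq_zero (by have := continuous_prof1; fun_prop) 1
    fun z hz => by rw [prof1_eq_zero (one_le_sq_of_lt hz), zero_smul]

theorem integrable_prof2_inner (y w : Euc d) :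
    Integrable (fun z : Euc d => prof2 (‖z‖ ^ 2) * (⟪z, y⟫ * ⟪z, w⟫)) ν :=
  Continuous.integrable_of_eq_zero (by have := continuous_prof2; fun_prop) 1
    fun z hz => by rw [prof2_eq_zero (one_le_sq_of_lt hz), zero_mul]

theorem integrable_prof2_sq (y : Euc d) :
    Integrable (fun z : Euc d => prof2 (‖z‖ ^ 2) * ⟪z, y⟫ ^ 2) ν := by
  simpa only [sq] using integrable_prof2_inner (ν := ν) y y

theorem inner_mB (y : Euc d) : ⟪mB ν, y⟫ = ∫ z, prof1 (‖z‖ ^ 2) * ⟪z, y⟫ ∂ν := by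
  rw [mB, real_inner_comm, ← integral_inner integrable_prof1_smul]
  refine integral_congr_ae (Eventually.of_forall fun z => ?_)
  simp only [inner_smul_right]; rw [real_inner_comm]

theorem abs_mQ_sub_le (y w : Euc d) :
    |mQ ν y - mQ ν w| ≤ 6 * ((‖y‖ + ‖w‖) * ‖y - w‖) * ν.real (closedBall 0 1) := by
  rw [mQ, mQ, ← integral_sub (integrable_prof2_sq y) (integrable_prof2_sq w), ← Real.norm_eq_abs]
  refine abs_integral_le_of_eq_zero 1 _
    (fun z hz => by rw [prof2_eq_zero (one_le_sq_of_lt hz)]; ring) fun z hz => ?_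
  have e : prof2 (‖z‖ ^ 2) * ⟪z, y⟫ ^ 2 - prof2 (‖z‖ ^ 2) * ⟪z, w⟫ ^ 2 =
      prof2 (‖z‖ ^ 2) * (⟪z, y + w⟫ * ⟪z, y - w⟫) := by
    rw [inner_add_right, inner_sub_right]; ring
  rw [e, norm_mul, Real.norm_of_nonneg (prof2_nonneg _), norm_mul]
  have h1 : ‖⟪z, y + w⟫‖ ≤ ‖y‖ + ‖w‖ := (norm_inner_le_norm _ _).trans (by
    nlinarith [norm_add_le y w, norm_nonneg z, norm_nonneg (y + w), norm_nonneg y, norm_nonneg w])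
  have h2 : ‖⟪z, y - w⟫‖ ≤ ‖y - w‖ := (norm_inner_le_norm _ _).trans (by
    nlinarith [norm_nonneg z, norm_nonneg (y - w)])
  exact mul_le_mul (prof2_le (sq_nonneg _)) (mul_le_mul h1 h2 (norm_nonneg _) (by positivity))
    (by positivity) (by norm_num)

theorem mG_pos (h : ∀ t, 0 < t → 0 < ν (closedBall 0 t)) : 0 < mG ν := by
  have h1 : ν.real (closedBall 0 (1/2)) ≤ mG ν := by
    rw [← integral_indicator_one isClosed_closedBall.measurableSet]
    refine integral_mono ((integrable_indicator_iff isClosed_closedBall.measurableSet).2 ?_)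
      integrable_prof1 ?_
    · exact (continuous_const (y := (1:ℝ))).continuousOn.integrableOn_compact
        (isCompact_closedBall 0 _)
    · intro z
      by_cases hz : z ∈ closedBall (0 : Euc d) (1/2)
      · simp only [hz, indicator_of_mem, Pi.one_apply]
        have hz' : ‖z‖ ≤ 1/2 := by simpa using hz
        have : 3/4 ≤ max (1 - ‖z‖ ^ 2) 0 := le_max_of_le_left (by nlinarith [norm_nonneg z])
        unfold prof1; nlinarith
      · simp only [hz, not_false_eq_true, indicator_of_notMem]; exact prof1_nonneg _
  exact (ENNReal.toReal_pos (h _ (by norm_num)).ne'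
    (isCompact_closedBall (0 : Euc d) (1/2)).measure_lt_top.ne).trans_le h1

/-- Second order expansion of the smoothed mass of a ball in its centre. -/
theorem moment_expansion {y : Euc d} (hy1 : ‖y‖ ≤ 1) :
    |∫ z, prof (‖z - y‖ ^ 2) ∂ν - ∫ z, prof (‖z‖ ^ 2) ∂ν
        + (‖y‖ ^ 2 * mG ν - 2 * ⟪mB ν, y⟫) - 2 * mQ ν y| ≤
      140 * ‖y‖ ^ 3 * ν.real (closedBall 0 2) := by
  have hi1 : Integrable (fun z : Euc d => prof (‖z - y‖ ^ 2)) ν :=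
    Continuous.integrable_of_eq_zero (by have := continuous_prof; fun_prop) (1 + ‖y‖)
      fun z hz => prof_eq_zero (one_le_sq_of_lt (by linarith [norm_sub_norm_le z y]))
  have hi2 : Integrable (fun z : Euc d => prof1 (‖z‖ ^ 2) * ⟪z, y⟫) ν :=
    Continuous.integrable_of_eq_zero (by have := continuous_prof1; fun_prop) 1
      fun z hz => by rw [prof1_eq_zero (one_le_sq_of_lt hz), zero_mul]
  have hi3 := integrable_prof2_sq (ν := ν) y
  have key : ∫ z, prof (‖z - y‖ ^ 2) ∂ν - ∫ z, prof (‖z‖ ^ 2) ∂ν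
        + (‖y‖ ^ 2 * mG ν - 2 * ⟪mB ν, y⟫) - 2 * mQ ν y =
      ∫ z, (prof (‖z - y‖ ^ 2) - prof (‖z‖ ^ 2) + (‖y‖ ^ 2 * prof1 (‖z‖ ^ 2)
        - 2 * (prof1 (‖z‖ ^ 2) * ⟪z, y⟫)) - 2 * (prof2 (‖z‖ ^ 2) * ⟪z, y⟫ ^ 2)) ∂ν := by
    rw [integral_lin hi1 integrable_prof (integrable_prof1.const_mul _) (hi2.const_mul _)
      (hi3.const_mul _), integral_const_mul, integral_const_mul, integral_const_mul,
      ← inner_mB]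
    rfl
  rw [key, ← Real.norm_eq_abs]
  refine abs_integral_le_of_eq_zero 2 _ (fun z hz => ?_) fun z hz => ?_
  · rw [prof_eq_zero (one_le_sq_of_lt (by linarith [norm_sub_norm_le z y])),
      prof_eq_zero (one_le_sq_of_lt (by linarith)), prof1_eq_zero (one_le_sq_of_lt (by linarith)),
      prof2_eq_zero (one_le_sq_of_lt (by linarith))]
    ring
  · set i := ⟪z, y⟫ with hi
    have hib : |i| ≤ 2 * ‖y‖ := (abs_real_inner_le_norm z y).trans (by
      nlinarith [norm_nonneg y])
    have hy0 := norm_nonneg y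
    have e : ‖z - y‖ ^ 2 = ‖z‖ ^ 2 + (‖y‖ ^ 2 - 2 * i) := by rw [norm_sub_sq_real]; ring
    have ht := prof_taylor (‖z‖ ^ 2) (‖y‖ ^ 2 - 2 * i)
    rw [← e] at ht
    have hh : |‖y‖ ^ 2 - 2 * i| ≤ 5 * ‖y‖ := by
      rw [abs_le] at hib ⊢
      constructor <;> nlinarith
    have hh3 : |‖y‖ ^ 2 - 2 * i| ^ 3 ≤ (5 * ‖y‖) ^ 3 := pow_le_pow_left₀ (abs_nonneg _) hh 3
    by_cases hz1 : 1 < ‖z‖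
    · have h2 := prof2_eq_zero (one_le_sq_of_lt hz1)
      rw [h2] at ht ⊢
      rw [Real.norm_eq_abs]
      have : prof (‖z - y‖ ^ 2) - prof (‖z‖ ^ 2) + (‖y‖ ^ 2 * prof1 (‖z‖ ^ 2) -
          2 * (prof1 (‖z‖ ^ 2) * i)) - 2 * (0 * i ^ 2) =
          prof (‖z - y‖ ^ 2) - prof (‖z‖ ^ 2) + prof1 (‖z‖ ^ 2) * (‖y‖ ^ 2 - 2 * i) -
          0 * (‖y‖ ^ 2 - 2 * i) ^ 2 / 2 := by ring
      rw [this]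
      refine ht.trans (hh3.trans ?_)
      nlinarith [pow_nonneg hy0 3]
    · have hib' : |i| ≤ ‖y‖ := (abs_real_inner_le_norm z y).trans (by nlinarith)
      have hP := prof2_le (sq_nonneg ‖z‖)
      have hP0 := prof2_nonneg (‖z‖ ^ 2)
      set P := prof2 (‖z‖ ^ 2)
      have h4 : |(‖y‖ ^ 4 - 4 * ‖y‖ ^ 2 * i) / 2| ≤ 5/2 * ‖y‖ ^ 3 := by
        have h5 : ‖y‖ ^ 4 ≤ ‖y‖ ^ 3 := pow_le_pow_of_le_one hy0 hy1 (by norm_num)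
        have h6 : 0 ≤ ‖y‖ ^ 4 := by positivity
        rw [abs_le] at hib' ⊢
        have h7 := mul_nonneg (sq_nonneg ‖y‖) (by linarith [hib'.1] : 0 ≤ ‖y‖ + i)
        have h8 := mul_nonneg (sq_nonneg ‖y‖) (by linarith [hib'.2] : 0 ≤ ‖y‖ - i)
        constructor <;> nlinarith
      have h9 : |P * ((‖y‖ ^ 4 - 4 * ‖y‖ ^ 2 * i) / 2)| ≤ 15 * ‖y‖ ^ 3 := by
        rw [abs_mul, abs_of_nonneg hP0]
        nlinarith [abs_nonneg ((‖y‖ ^ 4 - 4 * ‖y‖ ^ 2 * i) / 2), pow_nonneg hy0 3]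
      rw [Real.norm_eq_abs]
      have : prof (‖z - y‖ ^ 2) - prof (‖z‖ ^ 2) + (‖y‖ ^ 2 * prof1 (‖z‖ ^ 2) -
          2 * (prof1 (‖z‖ ^ 2) * i)) - 2 * (P * i ^ 2) =
          (prof (‖z - y‖ ^ 2) - prof (‖z‖ ^ 2) + prof1 (‖z‖ ^ 2) * (‖y‖ ^ 2 - 2 * i) -
          P * (‖y‖ ^ 2 - 2 * i) ^ 2 / 2) + P * ((‖y‖ ^ 4 - 4 * ‖y‖ ^ 2 * i) / 2) := by ring
      rw [this]
      refine (abs_add_le _ _).trans ?_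
      nlinarith

/-- The moment identity for points of the support of a uniformly distributed measure. -/
theorem moment_identity {f : ℝ → ℝ} (h : UD ν f) (h0 : 0 ∈ msupport ν) {y : Euc d}
    (hy : y ∈ msupport ν) (hy1 : ‖y‖ ≤ 1) :
    |‖y‖ ^ 2 * mG ν - 2 * ⟪mB ν, y⟫ - 2 * mQ ν y| ≤
      140 * ‖y‖ ^ 3 * ν.real (closedBall 0 2) := by
  have hrad : ∫ z, prof (‖z - y‖ ^ 2) ∂ν = ∫ z, prof (‖z‖ ^ 2) ∂ν := by
    have := integral_radial_eq (ν := ν) (ν' := ν) (x := y) (x' := 0)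
      (h.measure_closedBall_lt_top h0 y)
      (fun t ht => by rw [h.2 y hy t ht, h.2 0 h0 t ht]) (g := fun s => prof (s ^ 2))
      (by have := continuous_prof; fun_prop)
    simpa [dist_eq_norm] using this
  have key := moment_expansion (ν := ν) hy1
  rwa [hrad, sub_self, zero_add] at key

end Moments

/-- An `n`-uniform measure. -/
abbrev Unif {d : ℕ} (c : ℝ) (n : ℕ) (ν : Measure (Euc d)) : Prop := UD ν (fun t => c * t ^ n)

section

variable {d n : ℕ} {ν : Measure (Euc d)} {c : ℝ}

theorem Unif.measureReal (h : Unif c n ν) {x : Euc d} (hx : x ∈ msupport ν) {t : ℝ} (ht : 0 < t) :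
    ν.real (closedBall x t) = c * t ^ n :=
  h.measureReal_closedBall hx ht

theorem Unif.pos (h : Unif c n ν) : 0 < c := by simpa using h.1 1 one_pos

theorem Unif.radial {d' : ℕ} {ν' : Measure (Euc d')} (h : Unif c n ν) (h0 : 0 ∈ msupport ν)
    (h' : Unif c n ν') (h0' : 0 ∈ msupport ν') {g : ℝ → ℝ} (hg : Continuous g) :
    ∫ z, g ‖z‖ ∂ν = ∫ z, g ‖z‖ ∂ν' := by
  have := integral_radial_eq (ν := ν) (ν' := ν') (x := 0) (x' := 0)
    (h.measure_closedBall_lt_top h0 0) (fun t ht => by rw [h.2 0 h0 t ht, h'.2 0 h0' t ht]) hg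
  simpa [dist_eq_norm] using this

theorem Unif.mG_eq {d' : ℕ} {ν' : Measure (Euc d')} (h : Unif c n ν) (h0 : 0 ∈ msupport ν)
    (h' : Unif c n ν') (h0' : 0 ∈ msupport ν') : mG ν = mG ν' :=
  h.radial h0 h' h0' (g := fun s => prof1 (s ^ 2)) (by have := continuous_prof1; fun_prop)

theorem Unif.mG_pos (h : Unif c n ν) (h0 : 0 ∈ msupport ν) : 0 < mG ν := by
  have := h.isLocallyFinite h0
  exact _root_.mG_pos h0

/-- The rescaled moment identity. -/
theorem Unif.moment (h : Unif c n ν) (h0 : 0 ∈ msupport ν) {T : ℝ} (hT : 0 < T) {y : Euc d}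
    (hy : y ∈ msupport ν) (hyT : ‖y‖ ≤ T) :
    |‖y‖ ^ 2 * mG ν - 2 * (T * ⟪mB (resc n 0 T ν), y⟫) - 2 * mQ (resc n 0 T ν) y| ≤
      140 * (c * 2 ^ n) * (‖y‖ ^ 3 / T) := by
  have h' : Unif c n (resc n 0 T ν) := h.resc_unif hT
  have h0' : (0 : Euc d) ∈ msupport (resc n 0 T ν) := (zero_mem_msupport_resc hT).2 h0
  have hy' : T⁻¹ • y ∈ msupport (resc n 0 T ν) := by
    have := (sub_mem_msupport_resc (n := n) (x := 0) hT).2 hy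
    simpa using this
  have := h'.isLocallyFinite h0'
  have hn : ‖T⁻¹ • y‖ = ‖y‖ / T := by
    rw [norm_smul, norm_inv, Real.norm_of_nonneg hT.le]; field_simp
  have key := moment_identity h' h0' hy' (by rw [hn]; exact (div_le_one hT).2 hyT)
  rw [h'.measureReal h0' two_pos, h'.mG_eq h0' h h0, hn, mQ_smul, inner_smul_right] at key
  set B := ⟪mB (resc n 0 T ν), y⟫
  set Q := mQ (resc n 0 T ν) y
  have e : ‖y‖ ^ 2 * mG ν - 2 * (T * B) - 2 * Q =
      T ^ 2 * ((‖y‖ / T) ^ 2 * mG ν - 2 * (T⁻¹ * B) - 2 * (T⁻¹ ^ 2 * Q)) := by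
    field_simp
  rw [e, abs_mul, abs_of_pos (by positivity : 0 < T ^ 2)]
  refine (mul_le_mul_of_nonneg_left key (by positivity)).trans_eq ?_
  field_simp

/-- The second moment of a uniformly distributed measure whose support is a linear subspace. -/
theorem mQ_eq_of_submodule {f : ℝ → ℝ} (h : UD ν f) {W : Submodule ℝ (Euc d)}
    (hW : msupport ν = W) {y : Euc d} (hy : y ∈ W) : mQ ν y = mG ν / 2 * ‖y‖ ^ 2 := by
  have h0 : (0 : Euc d) ∈ msupport ν := by rw [hW]; exact W.zero_mem
  have := h.isLocallyFinite h0
  set M := 140 * ν.real (closedBall (0 : Euc d) 2)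
  have hM : 0 ≤ M := by positivity
  have key : ∀ s : ℝ, 0 < s → s * ‖y‖ ≤ 1 → |‖y‖ ^ 2 * mG ν - 2 * mQ ν y| ≤ s * (‖y‖ ^ 3 * M) := by
    intro s hs hsy
    have hn : ‖s • y‖ = s * ‖y‖ := by rw [norm_smul, Real.norm_of_nonneg hs.le]
    have m1 : s • y ∈ msupport ν := by rw [hW]; exact W.smul_mem s hy
    have m2 : -(s • y) ∈ msupport ν := by rw [hW]; exact W.neg_mem (W.smul_mem s hy)
    have k1 := moment_identity h h0 m1 (by rwa [hn])
    have k2 := moment_identity h h0 m2 (by rwa [norm_neg, hn])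
    have hneg : mQ ν (-(s • y)) = mQ ν (s • y) := by
      have := mQ_smul (ν := ν) (-1) (s • y)
      simpa using this
    rw [norm_neg, hneg, inner_neg_right] at k2
    rw [hn, mQ_smul] at k1 k2
    have h3 : |s ^ 2 * (‖y‖ ^ 2 * mG ν - 2 * mQ ν y)| ≤ s ^ 2 * (s * (‖y‖ ^ 3 * M)) := by
      have : M = 140 * ν.real (closedBall (0 : Euc d) 2) := rfl
      rw [abs_le] at k1 k2 ⊢
      constructor <;> nlinarith
    rw [abs_mul, abs_of_pos (by positivity : 0 < s ^ 2)] at h3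
    exact le_of_mul_le_mul_left h3 (by positivity)
  have hz : |‖y‖ ^ 2 * mG ν - 2 * mQ ν y| ≤ 0 := by
    have ht : Tendsto (fun s : ℝ => s * (‖y‖ ^ 3 * M)) (𝓝[>] 0) (𝓝 (0 * (‖y‖ ^ 3 * M))) :=
      ((by fun_prop : Continuous fun s : ℝ => s * (‖y‖ ^ 3 * M)).tendsto 0).mono_left
        nhdsWithin_le_nhds
    rw [zero_mul] at ht
    refine ge_of_tendsto ht ?_
    have hev : ∀ᶠ s : ℝ in 𝓝[>] 0, s * ‖y‖ < 1 := by
      have : Tendsto (fun s : ℝ => s * ‖y‖) (𝓝[>] 0) (𝓝 (0 * ‖y‖)) :=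
        ((by fun_prop : Continuous fun s : ℝ => s * ‖y‖).tendsto 0).mono_left nhdsWithin_le_nhds
      rw [zero_mul] at this
      exact this.eventually_lt_const one_pos
    filter_upwards [self_mem_nhdsWithin, hev] with s hs hs2 using key s hs hs2.le
  have := abs_nonpos_iff.1 hz
  linarith

/-- Lebesgue measure of the unit ball. -/
def volBall (n : ℕ) : ℝ := (volume : Measure (Euc n)).real (closedBall 0 1)

theorem volBall_pos (n : ℕ) : 0 < volBall n :=
  ENNReal.toReal_pos (measure_closedBall_pos _ _ one_pos).ne' measure_closedBall_lt_top.ne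

theorem volume_closedBall_eq (x : Euc n) {t : ℝ} (ht : 0 ≤ t) :
    volume (closedBall x t) = ENNReal.ofReal (volBall n * t ^ n) := by
  rw [Measure.addHaar_closedBall' _ _ ht, mul_comm, ENNReal.ofReal_mul (volBall_pos n).le, volBall,
    ofReal_measureReal measure_closedBall_lt_top.ne]
  simp

/-- Lebesgue measure normalised so that it is `n`-uniform with constant `c`. -/
def stdv (c : ℝ) (n : ℕ) : Measure (Euc n) := ENNReal.ofReal (c / volBall n) • volume

theorem stdv_closedBall (hc : 0 < c) (x : Euc n) {t : ℝ} (ht : 0 ≤ t) :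
    stdv c n (closedBall x t) = ENNReal.ofReal (c * t ^ n) := by
  have := volBall_pos n
  rw [stdv, Measure.smul_apply, volume_closedBall_eq x ht, smul_eq_mul,
    ← ENNReal.ofReal_mul (by positivity)]
  congr 1
  field_simp

theorem msupport_stdv (hc : 0 < c) : msupport (stdv c n) = univ := by
  refine eq_univ_of_forall fun x t ht => ?_
  rw [stdv_closedBall hc x ht.le]
  exact ENNReal.ofReal_pos.2 (by positivity)

theorem unif_stdv (hc : 0 < c) : Unif c n (stdv c n) :=
  ⟨fun _ _ => by positivity, fun x _ _ ht => stdv_closedBall hc x ht.le⟩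

theorem sum_mQ {ι : Type*} [Fintype ι] [IsLocallyFiniteMeasure ν] (b : OrthonormalBasis ι ℝ (Euc d)) :
    ∑ i, mQ ν (b i) = ∫ z, prof2 (‖z‖ ^ 2) * ‖z‖ ^ 2 ∂ν := by
  simp only [mQ]
  rw [← integral_finsetSum _ fun i _ => integrable_prof2_sq (b i)]
  refine integral_congr_ae (Eventually.of_forall fun z => ?_)
  simp only
  rw [← Finset.mul_sum, b.sum_sq_inner_left]

theorem Unif.trace {ι : Type*} [Fintype ι] (h : Unif c n ν) (h0 : 0 ∈ msupport ν)
    (b : OrthonormalBasis ι ℝ (Euc d)) : ∑ i, mQ ν (b i) = n * (mG ν / 2) := by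
  have hs := unif_stdv (n := n) h.pos
  have hs0 : (0 : Euc n) ∈ msupport (stdv c n) := by rw [msupport_stdv h.pos]; trivial
  have := h.isLocallyFinite h0
  have := hs.isLocallyFinite hs0
  rw [sum_mQ, h.radial h0 hs hs0 (g := fun s => prof2 (s ^ 2) * s ^ 2)
    (by have := continuous_prof2; fun_prop), h.mG_eq h0 hs hs0,
    ← sum_mQ (EuclideanSpace.basisFun (Fin n) ℝ)]
  have : ∀ y : Euc n, mQ (stdv c n) y = mG (stdv c n) / 2 * ‖y‖ ^ 2 := fun y =>
    mQ_eq_of_submodule hs (W := ⊤) (by rw [msupport_stdv h.pos]; rfl) trivial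
  simp [this]

end

section Limits

variable {d n : ℕ} {νs : ℕ → Measure (Euc d)} {ν : Measure (Euc d)} {c : ℝ}

theorem LimitOf.mQ_tendsto_const (h : LimitOf νs ν) (y : Euc d) :
    Tendsto (fun j => mQ (νs j) y) ul (𝓝 (mQ ν y)) :=
  h.int _ (by have := continuous_prof2; fun_prop) (hasCompactSupport_of_eq_zero 1 fun z hz => by
    rw [prof2_eq_zero (one_le_sq_of_lt hz), zero_mul])

theorem LimitOf.mQ_tendsto (h : LimitOf νs ν) (hu : ∀ j, Unif c n (νs j))
    (h0 : ∀ j, 0 ∈ msupport (νs j)) {ys : ℕ → Euc d} {y : Euc d} (hy : Tendsto ys ul (𝓝 y)) :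
    Tendsto (fun j => mQ (νs j) (ys j)) ul (𝓝 (mQ ν y)) := by
  have h1 : Tendsto (fun j => mQ (νs j) (ys j) - mQ (νs j) y) ul (𝓝 0) := by
    have h2 : Tendsto (fun j => 6 * ((‖ys j‖ + ‖y‖) * ‖ys j - y‖) * (c * 1 ^ n)) ul
        (𝓝 (6 * ((‖y‖ + ‖y‖) * ‖y - y‖) * (c * 1 ^ n))) :=
      ((((hy.norm.add_const _).mul (hy.sub_const y).norm).const_mul 6).mul_const _)
    rw [sub_self, norm_zero, mul_zero, mul_zero, zero_mul] at h2
    refine squeeze_zero_norm (fun j => ?_) h2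
    have := (hu j).isLocallyFinite (h0 j)
    rw [← (hu j).measureReal (h0 j) one_pos, Real.norm_eq_abs]
    exact abs_mQ_sub_le _ _
  simpa using h1.add (h.mQ_tendsto_const y)

theorem LimitOf.inner_mB_tendsto (h : LimitOf νs ν) (hf : ∀ j, IsLocallyFiniteMeasure (νs j))
    (hf' : IsLocallyFiniteMeasure ν) (y : Euc d) :
    Tendsto (fun j => ⟪mB (νs j), y⟫) ul (𝓝 ⟪mB ν, y⟫) := by
  simp only [inner_mB]
  exact h.int _ (by have := continuous_prof1; fun_prop) (hasCompactSupport_of_eq_zero 1 fun z hz => by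
    rw [prof1_eq_zero (one_le_sq_of_lt hz), zero_mul])

end Limits

/-- A tangent or asymptotic measure along any sequence of scales. -/
theorem Unif.exists_resc_limit {d n : ℕ} {ν : Measure (Euc d)} {c : ℝ} (h : Unif c n ν)
    {x : ℕ → Euc d} (hx : ∀ j, x j ∈ msupport ν) {r : ℕ → ℝ} (hr : ∀ j, 0 < r j) :
    ∃ ρ : Measure (Euc d), Unif c n ρ ∧ 0 ∈ msupport ρ ∧
      LimitOf (fun j => resc n (x j) (r j) ν) ρ :=
  exists_limit h.pos (f := fun _ t => c * t ^ n) (fun j => h.resc_unif (hr j))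
    (fun j => (zero_mem_msupport_resc (hr j)).2 (hx j)) fun _ _ => tendsto_const_nhds

theorem not_tendsto_ratio {a b : ℝ} (ha : 0 < a) (hb : 0 < b) {n m : ℕ} (hnm : n < m)
    {L : ENNReal} (hL : L ≠ ⊤) :
    ¬ Tendsto (fun t : ℝ => ENNReal.ofReal (a * t ^ n) / ENNReal.ofReal (b * t ^ m))
      (𝓝[>] 0) (𝓝 L) := by
  intro h
  have h1 : ∀ᶠ t : ℝ in 𝓝[>] 0,
      ENNReal.ofReal (a * t ^ n) / ENNReal.ofReal (b * t ^ m) < L + 1 :=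
    h.eventually_lt_const (ENNReal.lt_add_right hL one_ne_zero)
  have hL1 : L + 1 ≠ ⊤ := ENNReal.add_ne_top.2 ⟨hL, ENNReal.one_ne_top⟩
  have h2 : ∀ᶠ t : ℝ in 𝓝[>] 0, a ≤ (L + 1).toReal * b * t ^ (m - n) := by
    filter_upwards [h1, self_mem_nhdsWithin] with t ht ht0
    have ht0 : 0 < t := ht0
    rw [← ENNReal.ofReal_div_of_pos (by positivity)] at ht
    have h3 := (ENNReal.ofReal_lt_iff_lt_toReal (by positivity) hL1).1 ht
    rw [div_lt_iff₀ (by positivity)] at h3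
    have e : t ^ m = t ^ (m - n) * t ^ n := by rw [← pow_add]; congr 1; omega
    rw [e] at h3
    have : 0 < t ^ n := by positivity
    nlinarith
  have h4 : Tendsto (fun t : ℝ => (L + 1).toReal * b * t ^ (m - n)) (𝓝[>] 0)
      (𝓝 ((L + 1).toReal * b * 0 ^ (m - n))) :=
    ((by fun_prop : Continuous fun t : ℝ => (L + 1).toReal * b * t ^ (m - n)).tendsto 0).mono_left
      nhdsWithin_le_nhds
  rw [zero_pow (by omega), mul_zero] at h4
  have := ge_of_tendsto h4 h2
  linarith

section

variable {d n m : ℕ} {ν : Measure (Euc d)} {c : ℝ}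

theorem Unif.dim_le (h : Unif c n ν) (h0 : 0 ∈ msupport ν) : n ≤ d := by
  by_contra hnd
  push Not at hnd
  have := h.isLocallyFinite h0
  have hB := Besicovitch.ae_tendsto_rnDeriv (volume : Measure (Euc d)) ν
  have hfin : ∀ᵐ x ∂ν, (volume : Measure (Euc d)).rnDeriv ν x < ⊤ :=
    Measure.rnDeriv_lt_top (volume : Measure (Euc d)) ν
  have hne : ν ≠ 0 := by
    intro h00
    have := h0 1 one_pos
    simp [h00] at this
  have : NeBot (ae ν) := ae_neBot.2 hne
  obtain ⟨x, hx, hx2, hxS⟩ := (hB.and (hfin.and (ae_mem_msupport ν))).exists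
  refine not_tendsto_ratio (volBall_pos d) h.pos hnd hx2.ne (hx.congr' ?_)
  filter_upwards [self_mem_nhdsWithin] with t ht
  have ht : 0 < t := ht
  rw [volume_closedBall_eq x ht.le, h.2 x hxS t ht]

/-- If, near the origin, `S` lies in the span of a frame, then the measure can be transported
to the coordinate space. -/
theorem map_cf_closedBall {f : ℝ → ℝ} (h : UD ν f) {u : Fin m → Euc d} (hu : Orthonormal ℝ u)
    {R : ℝ} (hS : ∀ y ∈ msupport ν, ‖y‖ < R → res u y = 0) {v : Euc m}
    (hv : emb u v ∈ msupport ν) {t : ℝ} (ht : 0 < t) (hvt : ‖v‖ + t < R) :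
    (ν.restrict (ball 0 R)).map (cf u) (closedBall v t) = ENNReal.ofReal (f t) := by
  rw [Measure.map_apply continuous_cf.measurable isClosed_closedBall.measurableSet,
    Measure.restrict_apply (continuous_cf.measurable isClosed_closedBall.measurableSet),
    ← h.2 _ hv t ht]
  refine measure_congr ?_
  filter_upwards [ae_mem_msupport ν] with z hz
  have key : ‖z‖ < R → dist (cf u z) v = dist z (emb u v) := fun hzR => by
    conv_rhs => rw [← emb_cf_add_res (u := u) z, hS z hz hzR, add_zero, dist_eq_norm, ← map_sub,
      norm_emb hu, ← dist_eq_norm]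
  refine propext ⟨fun hz2 => ?_, fun hz2 => ?_⟩
  · have hzR : ‖z‖ < R := by simpa using hz2.2
    have := hz2.1
    rw [mem_preimage, mem_closedBall, key hzR] at this
    exact this
  · have hz3 : dist z (emb u v) ≤ t := hz2
    have hzR : ‖z‖ < R := by
      have h1 := norm_sub_norm_le z (emb u v)
      rw [norm_emb hu] at h1
      rw [dist_eq_norm] at hz3
      linarith
    refine ⟨?_, by simpa using hzR⟩
    rw [mem_preimage, mem_closedBall, key hzR]; exact hz3

/-- The support of an `n`-uniform measure is not a linear subspace of dimension above `n`. -/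
theorem Unif.msupport_ne_submodule (h : Unif c n ν) {W : Submodule ℝ (Euc d)}
    (hW : n < Module.finrank ℝ W) : msupport ν ≠ W := by
  intro hS
  have h0 : (0 : Euc d) ∈ msupport ν := by rw [hS]; exact W.zero_mem
  have := h.isLocallyFinite h0
  set m := Module.finrank ℝ W with hm
  let b := stdOrthonormalBasis ℝ W
  let u : Fin m → Euc d := fun i => (b i : Euc d)
  have hu : Orthonormal ℝ u := b.orthonormal.comp_linearIsometry W.subtypeₗᵢ
  have hspan : Submodule.span ℝ (range u) = W := by
    have h1 : range u = W.subtype '' range b := by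
      rw [← range_comp]; rfl
    rw [h1, Submodule.span_image, ← OrthonormalBasis.coe_toBasis, b.toBasis.span_eq,
      Submodule.map_top, Submodule.range_subtype]
  have hres : ∀ y ∈ msupport ν, ‖y‖ < 2 → res u y = 0 := fun y hy _ => by
    rw [res_eq_zero_iff hu, hspan]; rw [hS] at hy; exact hy
  have hmem : ∀ v, emb u v ∈ msupport ν := fun v => by
    rw [hS, ← hspan]; exact emb_mem_span v
  set ν' := (ν.restrict (ball 0 2)).map (cf u) with hν'
  have hfinm : IsFiniteMeasure (ν.restrict (ball 0 2)) :=
    ⟨by rw [Measure.restrict_apply_univ]; exact measure_ball_lt_top⟩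
  have hfin' : IsFiniteMeasure ν' := by rw [hν']; infer_instance
  have hB := Besicovitch.ae_tendsto_rnDeriv ν' (volume : Measure (Euc m))
  have hfin : ∀ᵐ x ∂(volume : Measure (Euc m)), ν'.rnDeriv volume x < ⊤ :=
    Measure.rnDeriv_lt_top ν' volume
  have hball : (volume : Measure (Euc m)) (ball 0 1) ≠ 0 := (measure_ball_pos _ _ one_pos).ne'
  obtain ⟨v, hv, hv1, hv2⟩ : ∃ v ∈ ball (0 : Euc m) 1,
      Tendsto (fun r => ν' (closedBall v r) / volume (closedBall v r)) (𝓝[>] 0)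
        (𝓝 (ν'.rnDeriv volume v)) ∧ ν'.rnDeriv volume v < ⊤ := by
    by_contra hcon
    push Not at hcon
    refine hball (measure_mono_null ?_ (hB.and hfin))
    intro v hv hv'
    exact absurd hv'.2 (not_lt.2 (hcon v hv hv'.1))
  refine not_tendsto_ratio h.pos (volBall_pos m) hW hv2.ne (hv1.congr' ?_)
  filter_upwards [Ioo_mem_nhdsGT one_pos] with t ht
  rw [volume_closedBall_eq v ht.1.le, hν', map_cf_closedBall h hu hres (hmem v) ht.1]
  have : ‖v‖ < 1 := by simpa using hv
  linarith [ht.2]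

/-- An `n`-uniform measure which is locally contained in an `n`-plane locally charges all of it. -/
theorem Unif.full (h : Unif c n ν) (h0 : 0 ∈ msupport ν) {u : Fin n → Euc d}
    (hu : Orthonormal ℝ u) {R : ℝ} (hS : ∀ y ∈ msupport ν, ‖y‖ < R → res u y = 0)
    {v : Euc n} (hv : ‖v‖ < R) : emb u v ∈ msupport ν := by
  have := h.isLocallyFinite h0
  have hc := h.pos
  have hω := volBall_pos n
  have hR : 0 < R := (norm_nonneg v).trans_lt hv
  by_contra hvS
  have hopen : IsOpen ((emb u) ⁻¹' (msupport ν)ᶜ) :=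
    (isClosed_msupport ν).isOpen_compl.preimage continuous_emb
  obtain ⟨s, hs, hsub⟩ := Metric.isOpen_iff.1 hopen v hvS
  set s' := min s ((R - ‖v‖) / 2) with hs'
  have hs'0 : 0 < s' := lt_min hs (by linarith)
  set r := (R + ‖v‖) / 2 with hr
  have hr0 : 0 < r := by have := norm_nonneg v; positivity
  have hrR : r < R := by rw [hr]; linarith
  have hbr : ball v s' ⊆ closedBall 0 r := by
    intro w hw
    have h1 : dist w v < s' := hw
    have h2 : s' ≤ (R - ‖v‖) / 2 := min_le_right _ _
    rw [mem_closedBall, dist_zero_right]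
    rw [dist_eq_norm] at h1
    linarith [norm_sub_norm_le w v]
  set ν' := (ν.restrict (ball 0 R)).map (cf u) with hν'
  have hfinm : IsFiniteMeasure (ν.restrict (ball 0 R)) :=
    ⟨by rw [Measure.restrict_apply_univ]; exact measure_ball_lt_top⟩
  have hfin' : IsFiniteMeasure ν' := by rw [hν']; infer_instance
  have hconc : ∀ᵐ w ∂ν', ‖w‖ < R ∧ emb u w ∈ msupport ν := by
    rw [hν', ae_map_iff continuous_cf.aemeasurable]
    · rw [ae_restrict_iff' measurableSet_ball]
      filter_upwards [ae_mem_msupport ν] with z hz hzR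
      have hzR : ‖z‖ < R := by simpa using hzR
      refine ⟨(norm_cf_le hu z).trans_lt hzR, ?_⟩
      have := emb_cf_add_res (u := u) z
      rw [hS z hz hzR, add_zero] at this
      rwa [this]
    · exact ((isOpen_lt continuous_norm continuous_const).measurableSet).inter
        ((isClosed_msupport ν).measurableSet.preimage continuous_emb.measurable)
  have hden : (volume : Measure (Euc n)).rnDeriv ν' =ᵐ[ν'] fun _ => ENNReal.ofReal (volBall n / c) := by
    filter_upwards [hconc, Besicovitch.ae_tendsto_rnDeriv (volume : Measure (Euc n)) ν']
      with w hw hw2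
    refine tendsto_nhds_unique hw2 (tendsto_const_nhds.congr' ?_)
    filter_upwards [Ioo_mem_nhdsGT (sub_pos.2 hw.1)] with t ht
    have ht0 := ht.1
    rw [volume_closedBall_eq w ht.1.le, hν',
      map_cf_closedBall h hu hS hw.2 ht.1 (by linarith [ht.2]),
      ← ENNReal.ofReal_div_of_pos (by positivity)]
    congr 1
    field_simp
  have hle : ENNReal.ofReal (volBall n / c) • ν' ≤ volume := by
    rw [← withDensity_const, ← withDensity_congr_ae hden]
    exact Measure.withDensity_rnDeriv_le volume ν'
  have hnull : ν' (ball v s') = 0 := by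
    refine measure_mono_null ?_ hconc
    intro w hw hw2
    exact hsub (ball_subset_ball (min_le_left _ _) hw) hw2.2
  have h1 := hle (closedBall 0 r \ ball v s')
  rw [Measure.smul_apply, measure_sdiff_null hnull, hν',
    map_cf_closedBall h hu hS (by rwa [map_zero]) hr0 (by rwa [norm_zero, zero_add]),
    measure_sdiff hbr measurableSet_ball.nullMeasurableSet measure_ball_lt_top.ne,
    volume_closedBall_eq 0 hr0.le, smul_eq_mul, ← ENNReal.ofReal_mul (by positivity)] at h1
  have e : volBall n / c * (c * r ^ n) = volBall n * r ^ n := by field_simp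
  rw [e] at h1
  have h2 : ENNReal.ofReal (volBall n * r ^ n) - volume (ball v s') <
      ENNReal.ofReal (volBall n * r ^ n) :=
    ENNReal.sub_lt_self ENNReal.ofReal_ne_top (ENNReal.ofReal_pos.2 (by positivity)).ne'
      (measure_ball_pos _ _ hs'0).ne'
  exact absurd h1 (not_le.2 h2)

end

section

variable {d n : ℕ} {ν : Measure (Euc d)} {c : ℝ}

theorem tendsto_natCast_add_one_ul : Tendsto (fun j : ℕ => (j : ℝ) + 1) ul atTop :=
  (tendsto_atTop_add_const_right _ _ tendsto_natCast_atTop_atTop).mono_left ul_le_atTop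

theorem mQ_le (h : Unif c n ν) (h0 : 0 ∈ msupport ν) (y : Euc d) : mQ ν y ≤ 6 * ‖y‖ ^ 2 * c := by
  have := h.isLocallyFinite h0
  have h1 := abs_mQ_sub_le (ν := ν) y 0
  have h2 : mQ ν 0 = 0 := by simpa using mQ_smul (ν := ν) 0 0
  rw [h2, sub_zero, sub_zero, norm_zero, add_zero, h.measureReal h0 one_pos, one_pow, mul_one] at h1
  calc mQ ν y ≤ |mQ ν y| := le_abs_self _
    _ ≤ _ := h1
    _ = _ := by ring

/-- The scaled first moments are bounded against points of the support. -/
theorem Unif.abs_inner_mB_le (h : Unif c n ν) (h0 : 0 ∈ msupport ν) {T : ℝ} (hT : 0 < T) {y : Euc d}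
    (hy : y ∈ msupport ν) (hyT : ‖y‖ ≤ T) :
    |T * ⟪mB (resc n 0 T ν), y⟫| ≤ (mG ν + 12 * c + 140 * (c * 2 ^ n)) * ‖y‖ ^ 2 := by
  have h1 := h.moment h0 hT hy hyT
  have h' : Unif c n (resc n 0 T ν) := h.resc_unif hT
  have h2 := mQ_le h' ((zero_mem_msupport_resc hT).2 h0) y
  have h3 := mQ_nonneg (ν := resc n 0 T ν) y
  have hG := h.mG_pos h0
  have hc := h.pos
  have h4 : ‖y‖ ^ 3 / T ≤ ‖y‖ ^ 2 := by
    rw [div_le_iff₀ hT, pow_succ]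
    exact mul_le_mul_of_nonneg_left hyT (by positivity)
  have h5 : 140 * (c * 2 ^ n) * (‖y‖ ^ 3 / T) ≤ 140 * (c * 2 ^ n) * ‖y‖ ^ 2 :=
    mul_le_mul_of_nonneg_left h4 (by positivity)
  have h6 : 0 ≤ ‖y‖ ^ 2 * mG ν := by positivity
  have h7 : 0 ≤ c * ‖y‖ ^ 2 := by positivity
  have h8 : 0 ≤ 140 * (c * 2 ^ n) * ‖y‖ ^ 2 := by positivity
  rw [abs_le] at h1 ⊢
  constructor <;> nlinarith

theorem mB_eq_zero_of_forall_inner [IsLocallyFiniteMeasure ν]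
    (h : ∀ y ∈ msupport ν, ⟪mB ν, y⟫ = 0) : mB ν = 0 := by
  rw [← inner_self_eq_zero (𝕜 := ℝ), inner_mB]
  refine integral_eq_zero_of_ae ?_
  filter_upwards [ae_mem_msupport ν] with z hz
  rw [real_inner_comm, h z hz, mul_zero]; rfl

/-- Points of a rescaling limit are limits of rescaled points of the support. -/
theorem LimitOf.exists_points {x : ℕ → Euc d} {r : ℕ → ℝ} (hr : ∀ j, 0 < r j) {ρ : Measure (Euc d)}
    (hl : LimitOf (fun j => resc n (x j) (r j) ν) ρ) {y : Euc d} (hy : y ∈ msupport ρ) :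
    ∃ ys : ℕ → Euc d, (∀ᶠ j in ul, x j + r j • ys j ∈ msupport ν) ∧ Tendsto ys ul (𝓝 y) := by
  obtain ⟨ys, h1, h2⟩ := hl.approx y hy
  exact ⟨ys, h1.mono fun j hj => (mem_msupport_resc (hr j)).1 hj, h2⟩

/-- The first moment of an asymptotic measure vanishes. -/
theorem Unif.mB_blowdown (h : Unif c n ν) (h0 : 0 ∈ msupport ν) {r : ℕ → ℝ} (hr : ∀ j, 0 < r j)
    (hr' : Tendsto r ul atTop) {ρ : Measure (Euc d)} (hρ : Unif c n ρ) (hρ0 : 0 ∈ msupport ρ)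
    (hl : LimitOf (fun j => resc n 0 (r j) ν) ρ) : mB ρ = 0 := by
  have hf : IsLocallyFiniteMeasure ρ := hρ.isLocallyFinite hρ0
  have hfs : ∀ j, IsLocallyFiniteMeasure (resc n 0 (r j) ν) := fun j =>
    (h.resc_unif (x := 0) (hr j)).isLocallyFinite ((zero_mem_msupport_resc (hr j)).2 h0)
  have h1 : ∀ y ∈ msupport ν, ⟪mB ρ, y⟫ = 0 := by
    intro y hy
    refine tendsto_nhds_unique (hl.inner_mB_tendsto hfs hf y) ?_
    have h2 : Tendsto (fun j => (mG ν + 12 * c + 140 * (c * 2 ^ n)) * ‖y‖ ^ 2 / r j) ul (𝓝 0) :=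
      hr'.const_div_atTop _
    refine squeeze_zero_norm' ?_ h2
    filter_upwards [hr'.eventually_ge_atTop ‖y‖] with j hj
    have h3 := h.abs_inner_mB_le h0 (hr j) hy hj
    rw [le_div_iff₀ (hr j), Real.norm_eq_abs]
    rw [abs_mul, abs_of_pos (hr j)] at h3
    linarith
  refine mB_eq_zero_of_forall_inner fun y hy => ?_
  obtain ⟨ys, h2, h3⟩ := hl.exists_points hr hy
  refine tendsto_nhds_unique ((tendsto_const_nhds (x := mB ρ)).inner h3)
    (tendsto_const_nhds.congr' ?_)
  filter_upwards [h2] with j hj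
  have := h1 _ hj
  rw [zero_add, inner_smul_right] at this
  exact ((mul_eq_zero.1 this).resolve_left (hr j).ne').symm

/-- An asymptotic measure of a measure in a half-space lies in the boundary hyperplane,
near the origin. -/
theorem Unif.inner_eq_zero_of_halfspace (h : Unif c n ν) (h0 : 0 ∈ msupport ν) {e : Euc d}
    (he : ∀ y ∈ msupport ν, ⟪y, e⟫ ≤ 0) (hB : mB ν = 0) {y : Euc d} (hy : y ∈ msupport ν)
    (hy1 : ‖y‖ < 1) : ⟪y, e⟫ = 0 := by
  have := h.isLocallyFinite h0
  by_contra hne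
  have hi : Integrable (fun z : Euc d => -(prof1 (‖z‖ ^ 2) * ⟪z, e⟫)) ν :=
    Continuous.integrable_of_eq_zero (by have := continuous_prof1; fun_prop) 1
      fun z hz => by rw [prof1_eq_zero (one_le_sq_of_lt hz), zero_mul, neg_zero]
  have hint : ∫ z, -(prof1 (‖z‖ ^ 2) * ⟪z, e⟫) ∂ν = 0 := by
    rw [integral_neg, ← inner_mB, hB, inner_zero_left, neg_zero]
  rw [integral_eq_zero_iff_of_nonneg_ae _ hi] at hint
  · have hopen : IsOpen {z : Euc d | -(prof1 (‖z‖ ^ 2) * ⟪z, e⟫) ≠ 0} :=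
      isOpen_ne_fun (by have := continuous_prof1; fun_prop) continuous_const
    have hmem : y ∈ {z : Euc d | -(prof1 (‖z‖ ^ 2) * ⟪z, e⟫) ≠ 0} := by
      refine neg_ne_zero.2 (mul_ne_zero ?_ hne)
      have h1 : 0 < 1 - ‖y‖ ^ 2 := by nlinarith [norm_nonneg y]
      unfold prof1
      rw [max_eq_left h1.le]
      positivity
    obtain ⟨t, ht, hsub⟩ := Metric.nhds_basis_closedBall.mem_iff.1 (hopen.mem_nhds hmem)
    have h2 : ν {z : Euc d | -(prof1 (‖z‖ ^ 2) * ⟪z, e⟫) ≠ 0} = 0 := hint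
    exact ((hy t ht).trans_le (measure_mono hsub)).ne' h2
  · filter_upwards [ae_mem_msupport ν] with z hz
    have h3 := prof1_nonneg (‖z‖ ^ 2)
    have h4 := he z hz
    simp only [Pi.zero_apply]
    nlinarith

theorem Unif.blowdown_halfspace (h : Unif c n ν) (h0 : 0 ∈ msupport ν) {e : Euc d}
    (he : ∀ y ∈ msupport ν, ⟪y, e⟫ ≤ 0) {ρ : Measure (Euc d)}
    (hl : LimitOf (fun j : ℕ => resc n 0 ((j : ℝ) + 1) ν) ρ) {y : Euc d} (hy : y ∈ msupport ρ) :
    ⟪y, e⟫ = 0 := by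
  have hr : ∀ j : ℕ, (0 : ℝ) < (j : ℝ) + 1 := fun j => by positivity
  set T := ‖y‖ + 1 with hT
  have hT0 : 0 < T := by positivity
  have hrT : ∀ j : ℕ, 0 < T * ((j : ℝ) + 1) := fun j => mul_pos hT0 (hr j)
  obtain ⟨ρ', hρ', hρ'0, hl'⟩ := h.exists_resc_limit (x := fun _ => 0) (fun _ => h0) hrT
  have hB := h.mB_blowdown h0 hrT (tendsto_natCast_add_one_ul.const_mul_atTop hT0) hρ' hρ'0 hl'
  have he' : ∀ z ∈ msupport ρ', ⟪z, e⟫ ≤ 0 := by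
    intro z hz
    obtain ⟨zs, h1, h2⟩ := hl'.exists_points hrT hz
    refine le_of_tendsto (h2.inner tendsto_const_nhds) ?_
    filter_upwards [h1] with j hj
    have := he _ hj
    rw [zero_add, real_inner_smul_left] at this
    by_contra hcon
    push Not at hcon
    linarith [mul_pos (hrT j) hcon]
  have hyT : T⁻¹ • y ∈ msupport ρ' := by
    obtain ⟨ys, h1, h2⟩ := hl.exists_points hr hy
    refine hl'.mem (fun j => T⁻¹ • ys j) _ ?_ (h2.const_smul _)
    filter_upwards [h1] with j hj
    rw [mem_msupport_resc (hrT j), smul_smul]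
    have : T * ((j : ℝ) + 1) * T⁻¹ = (j : ℝ) + 1 := by field_simp
    rwa [this]
  have := hρ'.inner_eq_zero_of_halfspace hρ'0 he' hB hyT (by
    rw [norm_smul, norm_inv, Real.norm_of_nonneg hT0.le, inv_mul_lt_iff₀ hT0]
    linarith)
  rw [real_inner_smul_left] at this
  exact (mul_eq_zero.1 this).resolve_left (inv_pos.2 hT0).ne'

theorem exists_frame_of_finrank_le {W : Submodule ℝ (Euc d)} (hW : Module.finrank ℝ W ≤ n)
    (hn : n ≤ d) :
    ∃ u : Fin n → Euc d, Orthonormal ℝ u ∧ W ≤ Submodule.span ℝ (range u) := by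
  let b := stdOrthonormalBasis ℝ W
  set m := Module.finrank ℝ W with hm
  let v : Fin d → Euc d := fun i => if hi : (i : ℕ) < m then (b ⟨i, hi⟩ : Euc d) else 0
  let s : Set (Fin d) := {i | (i : ℕ) < m}
  have hv : Orthonormal ℝ (s.domRestrict v) := by
    have h1 : s.domRestrict v = fun i : s => ((b ⟨i.1, i.2⟩ : W) : Euc d) := by
      funext i
      have : ((i : Fin d) : ℕ) < m := i.2
      change (if hi : ((i : Fin d) : ℕ) < m then ((b ⟨i, hi⟩ : W) : Euc d) else 0) = _
      rw [dif_pos this]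
    rw [h1]
    have h2 : Orthonormal ℝ (fun i : Fin m => ((b i : W) : Euc d)) :=
      b.orthonormal.comp_linearIsometry W.subtypeₗᵢ
    refine h2.comp (fun i : s => (⟨i.1, i.2⟩ : Fin m)) fun i j hij => ?_
    ext
    simpa using hij
  obtain ⟨B, hB⟩ := hv.exists_orthonormalBasis_extension_of_card_eq (by simp)
  refine ⟨fun k => B (Fin.castLE hn k), B.orthonormal.comp _ (Fin.castLE_injective hn), ?_⟩
  have h3 : Submodule.span ℝ (range fun i : Fin m => ((b i : W) : Euc d)) = W := by
    have h1 : (range fun i : Fin m => ((b i : W) : Euc d)) = W.subtype '' range b := by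
      rw [← range_comp]; rfl
    rw [h1, Submodule.span_image, ← OrthonormalBasis.coe_toBasis, b.toBasis.span_eq,
      Submodule.map_top, Submodule.range_subtype]
  conv_lhs => rw [← h3]
  refine Submodule.span_mono ?_
  rintro _ ⟨i, rfl⟩
  refine ⟨⟨i, i.2.trans_le hW⟩, ?_⟩
  have h4 := hB ⟨i, i.2.trans_le (hW.trans hn)⟩ (show (i : ℕ) < m from i.2)
  have h5 : Fin.castLE hn ⟨i, i.2.trans_le hW⟩ = ⟨i, i.2.trans_le (hW.trans hn)⟩ := rfl
  simp only [h5, h4, v]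
  simp

/-- Existence of a flat ball passes from a rescaling limit to the measure. -/
theorem exists_flat_of_limit {x : ℕ → Euc d} {r : ℕ → ℝ} (hr : ∀ j, 0 < r j) {ρ : Measure (Euc d)}
    (hl : LimitOf (fun j => resc n (x j) (r j) ν) ρ) {δ : ℝ} (hδ : 0 < δ)
    (hρ : ∃ x0 ∈ msupport ρ, ∃ R, 0 < R ∧ FlatA n (msupport ρ) x0 R (δ / 4 * R)) :
    ∃ x0 ∈ msupport ν, ∃ R, 0 < R ∧ FlatA n (msupport ν) x0 R (δ * R) := by
  obtain ⟨x0, hx0, R, hR, hF⟩ := hρ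
  obtain ⟨ys, h1, h2⟩ := hl.approx x0 hx0
  have h3 := hl.flatA_of_limit h2 (tendsto_const_nhds (x := R / 2)) (by linarith)
    (a' := δ / 2 * R) (by nlinarith) hF
  obtain ⟨j, hj1, hj2⟩ := (h1.and h3).exists
  refine ⟨x j + r j • ys j, (mem_msupport_resc (hr j)).1 hj1, r j * (R / 2),
    mul_pos (hr j) (by linarith), ?_⟩
  have h4 := (flatA_resc_iff (hr j)).1 hj2
  refine h4.mono le_rfl (le_of_eq (by ring))

theorem mem_of_blowup {x : Euc d} {W : Submodule ℝ (Euc d)} (hx : x ∈ msupport ν)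
    (hS : msupport ν ⊆ W) {r : ℕ → ℝ} (hr : ∀ j, 0 < r j) {ρ : Measure (Euc d)}
    (hl : LimitOf (fun j => resc n x (r j) ν) ρ) : msupport ρ ⊆ W := by
  intro y hy
  obtain ⟨ys, h1, h2⟩ := hl.exists_points (x := fun _ => x) hr hy
  have hcl : IsClosed (W : Set (Euc d)) := W.closed_of_finiteDimensional
  refine hcl.mem_of_tendsto h2 ?_
  filter_upwards [h1] with j hj
  have h3 : r j • ys j ∈ W := by
    have := W.sub_mem (hS hj) (hS hx)
    simpa using this
  have := W.smul_mem (r j)⁻¹ h3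
  rwa [inv_smul_smul₀ (hr j).ne'] at this

/-- Every uniform measure has arbitrarily flat balls. -/
theorem Unif.exists_flat_aux (k : ℕ) : ∀ (ν : Measure (Euc d)), Unif c n ν → 0 ∈ msupport ν →
    ∀ W : Submodule ℝ (Euc d), Module.finrank ℝ W = k → msupport ν ⊆ W → ∀ δ : ℝ, 0 < δ →
    ∃ x0 ∈ msupport ν, ∃ R, 0 < R ∧ FlatA n (msupport ν) x0 R (δ * R) := by
  induction k using Nat.strong_induction_on with
  | _ k ih =>
  intro ν h h0 W hk hS δ hδ
  rcases le_or_gt k n with hkn | hkn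
  · obtain ⟨u, hu, hWu⟩ := exists_frame_of_finrank_le (hk.le.trans hkn) (h.dim_le h0)
    refine ⟨0, h0, 1, one_pos, u, hu, fun y hy _ => ?_⟩
    rw [sub_zero, (res_eq_zero_iff hu).2 (hWu (hS hy)), norm_zero]
    positivity
  · have hne := h.msupport_ne_submodule (W := W) (by omega)
    obtain ⟨p, hpW, hpS⟩ : ∃ p ∈ W, p ∉ msupport ν := by
      by_contra hcon
      push Not at hcon
      exact hne (Subset.antisymm hS hcon)
    obtain ⟨x, hx, hxd⟩ := (isClosed_msupport ν).exists_infDist_eq_dist ⟨0, h0⟩ p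
    set e := p - x with he
    have he0 : e ≠ 0 := by
      rw [he, sub_ne_zero]; rintro rfl; exact hpS hx
    have heW : e ∈ W := W.sub_mem hpW (hS hx)
    have hr : ∀ j : ℕ, (0 : ℝ) < ((j : ℝ) + 1)⁻¹ := fun j => by positivity
    have hr0 : Tendsto (fun j : ℕ => ((j : ℝ) + 1)⁻¹) ul (𝓝 0) :=
      tendsto_natCast_add_one_ul.inv_tendsto_atTop
    have hR : ∀ j : ℕ, (0 : ℝ) < (j : ℝ) + 1 := fun j => by positivity
    obtain ⟨ν1, h1, h10, hl1⟩ := h.exists_resc_limit (x := fun _ => x) (fun _ => hx) hr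
    obtain ⟨ν2, h2, h20, hl2⟩ := h1.exists_resc_limit (x := fun _ => 0) (fun _ => h10) hR
    have hS1 : msupport ν1 ⊆ W := mem_of_blowup hx hS hr hl1
    have hS2 : msupport ν2 ⊆ W := mem_of_blowup h10 hS1 hR hl2
    have hhalf : ∀ y ∈ msupport ν1, ⟪y, e⟫ ≤ 0 := by
      intro y hy
      obtain ⟨ys, h3, h4⟩ := hl1.exists_points (x := fun _ => x) hr hy
      have h5 : Tendsto (fun j : ℕ => ((j : ℝ) + 1)⁻¹ * (‖ys j‖ ^ 2 / 2)) ul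
          (𝓝 (0 * (‖y‖ ^ 2 / 2))) := hr0.mul ((h4.norm.pow 2).div_const 2)
      rw [zero_mul] at h5
      refine le_of_tendsto_of_tendsto (h4.inner tendsto_const_nhds) h5 ?_
      filter_upwards [h3] with j hj
      have h6 := infDist_le_dist_of_mem (x := p) hj
      rw [hxd, dist_eq_norm, dist_eq_norm] at h6
      have h7 : p - (x + ((j : ℝ) + 1)⁻¹ • ys j) = e - ((j : ℝ) + 1)⁻¹ • ys j := by rw [he]; abel
      rw [h7, ← he] at h6
      have h8 := pow_le_pow_left₀ (norm_nonneg _) h6 2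
      have h8' : ‖e - ((j : ℝ) + 1)⁻¹ • ys j‖ ^ 2 = ‖e‖ ^ 2 - 2 * (((j : ℝ) + 1)⁻¹ * ⟪ys j, e⟫) +
          (((j : ℝ) + 1)⁻¹) ^ 2 * ‖ys j‖ ^ 2 := by
        rw [norm_sub_sq_real e (((j : ℝ) + 1)⁻¹ • ys j), norm_smul, inner_smul_right,
          Real.norm_of_nonneg (hr j).le, real_inner_comm]
        ring
      rw [h8'] at h8
      set s := ((j : ℝ) + 1)⁻¹
      have hs : 0 < s := hr j
      by_contra hcon
      push Not at hcon
      have := mul_lt_mul_of_pos_left hcon hs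
      nlinarith
    have hperp : ∀ y ∈ msupport ν2, ⟪y, e⟫ = 0 := fun y hy => h1.blowdown_halfspace h10 hhalf hl2 hy
    set W' := W ⊓ (Submodule.span ℝ {e})ᗮ with hW'
    have hlt : W' < W := by
      refine lt_of_le_of_ne inf_le_left fun heq => he0 ?_
      have : e ∈ W' := by rw [heq]; exact heW
      have h9 := (Submodule.mem_inf.1 this).2
      rw [Submodule.mem_orthogonal_singleton_iff_inner_left] at h9
      exact inner_self_eq_zero.1 h9
    have hS2' : msupport ν2 ⊆ W' := fun y hy => Submodule.mem_inf.2 ⟨hS2 hy, by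
      rw [Submodule.mem_orthogonal_singleton_iff_inner_left]; exact hperp y hy⟩
    have hfl := ih _ (hk ▸ Submodule.finrank_lt_finrank_of_lt hlt) ν2 h2 h20 W' rfl hS2'
      (δ / 4 / 4) (by positivity)
    exact exists_flat_of_limit hr hl1 hδ (exists_flat_of_limit hR hl2 (by positivity) hfl)

theorem Unif.exists_flat (h : Unif c n ν) (h0 : 0 ∈ msupport ν) {δ : ℝ} (hδ : 0 < δ) :
    ∃ x0 ∈ msupport ν, ∃ R, 0 < R ∧ FlatA n (msupport ν) x0 R (δ * R) :=
  Unif.exists_flat_aux _ ν h h0 ⊤ rfl (fun _ _ => trivial) δ hδ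

end

section

variable {d n : ℕ} {ν μ : Measure (Euc d)} {c : ℝ} {f : ℝ → ℝ}

theorem tendsto_inv_natCast_add_one_ul : Tendsto (fun j : ℕ => ((j : ℝ) + 1)⁻¹) ul (𝓝 0) :=
  tendsto_natCast_add_one_ul.inv_tendsto_atTop

/-- Blow-ups of a uniformly distributed measure at vanishing scales are uniform. -/
theorem UD.exists_blowup (h : UD μ f) (hc : 0 < c)
    (hf : Tendsto (fun r => f r / r ^ n) (𝓝[>] 0) (𝓝 c)) {x : ℕ → Euc d} {r : ℕ → ℝ}
    (hx : ∀ j, x j ∈ msupport μ) (hr : ∀ j, 0 < r j) (hr0 : Tendsto r ul (𝓝 0)) :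
    ∃ ρ : Measure (Euc d), Unif c n ρ ∧ 0 ∈ msupport ρ ∧
      LimitOf (fun j => _root_.resc n (x j) (r j) μ) ρ := by
  refine exists_limit hc (fun j => h.resc (n := n) (hr j))
    (fun j => (zero_mem_msupport_resc (hr j)).2 (hx j)) fun t ht => ?_
  have h1 : Tendsto (fun j => r j * t) ul (𝓝[>] 0) := by
    refine tendsto_nhdsWithin_iff.2 ⟨?_, Eventually.of_forall fun j => mul_pos (hr j) ht⟩
    simpa using hr0.mul_const t
  refine ((hf.comp h1).mul_const (t ^ n)).congr fun j => ?_
  have := (hr j).ne'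
  simp only [Function.comp, mul_pow]
  field_simp

/-- Uniform measures converging to a uniform measure lying near planes are nearly full there. -/
theorem LimitOf.eventually_dense {νs : ℕ → Measure (Euc d)} (hl : LimitOf νs ν) (h : Unif c n ν)
    (h0 : 0 ∈ msupport ν) {us : ℕ → Fin n → Euc d} (hus : ∀ j, Orthonormal ℝ (us j))
    {θ : ℕ → ℝ} (hθ : Tendsto θ ul (𝓝 0))
    (hS : ∀ j, ∀ y ∈ msupport (νs j), ‖y‖ < 2 → ‖res (us j) y‖ ≤ θ j)
    {vs : ℕ → Euc n} (hvs : ∀ j, ‖vs j‖ ≤ 1) {τ : ℝ} (hτ : 0 < τ) :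
    ∀ᶠ j in ul, ∃ y ∈ msupport (νs j), ‖y - emb (us j) (vs j)‖ ≤ τ := by
  obtain ⟨u, hu, hul⟩ := exists_frame_lim (Eventually.of_forall hus)
  obtain ⟨v, hvl⟩ := exists_ul_lim (x := vs) (x0 := 0) (C := 1)
    (Eventually.of_forall fun j => by rw [dist_zero_right]; exact hvs j)
  have hv : ‖v‖ ≤ 1 := le_of_tendsto hvl.norm (Eventually.of_forall hvs)
  have h1 : ∀ y ∈ msupport ν, ‖y‖ < 2 → res u y = 0 := by
    intro y hy hy2
    obtain ⟨ys, h2, h3⟩ := hl.approx y hy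
    rw [← norm_le_zero_iff]
    refine le_of_tendsto_of_tendsto (tendsto_res hul h3).norm hθ ?_
    filter_upwards [h2, h3.norm.eventually_lt_const hy2] with j hj1 hj2
    exact hS j _ hj1 hj2
  have h4 := h.full h0 hu h1 (v := v) (by linarith)
  obtain ⟨ys, h2, h3⟩ := hl.approx _ h4
  have h5 : Tendsto (fun j => emb (us j) (vs j)) ul (𝓝 (emb u v)) := by
    have hc : Continuous fun p : (Fin n → Euc d) × Euc n => ∑ k, p.2 k • p.1 k := by
      fun_prop
    exact (hc.tendsto (u, v)).comp (hul.prodMk_nhds hvl)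
  have h6 : Tendsto (fun j => ‖ys j - emb (us j) (vs j)‖) ul (𝓝 0) := by
    simpa using (h3.sub h5).norm
  filter_upwards [h2, h6.eventually_le_const hτ] with j hj1 hj2
  exact ⟨_, hj1, hj2⟩

/-- A uniform measure which is flat enough in a ball is nearly full there. -/
theorem exists_dense_of_flat_unif (d n : ℕ) (c : ℝ) {τ : ℝ} (hτ : 0 < τ) :
    ∃ θ > 0, ∀ ν : Measure (Euc d), Unif c n ν → 0 ∈ msupport ν → ∀ u : Fin n → Euc d,
      Orthonormal ℝ u → (∀ y ∈ msupport ν, ‖y‖ < 2 → ‖res u y‖ ≤ θ) →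
      ∀ v : Euc n, ‖v‖ ≤ 1 → ∃ y ∈ msupport ν, ‖y - emb u v‖ ≤ τ := by
  by_contra hcon
  push Not at hcon
  choose νs h h0 us hus hS vs hvs hne using fun j : ℕ =>
    hcon ((j : ℝ) + 1)⁻¹ (by positivity)
  obtain ⟨ρ, hρ, hρ0, hl⟩ := exists_limit (h 0).pos (f := fun _ t => c * t ^ n) h h0
    fun _ _ => tendsto_const_nhds
  obtain ⟨j, y, hy, hj⟩ :=
    (hl.eventually_dense hρ hρ0 hus tendsto_inv_natCast_add_one_ul hS hvs hτ).exists
  exact (hne j y hy).not_ge hj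

/-- A uniformly distributed measure which is flat enough in a small ball is nearly full there. -/
theorem UD.exists_dense_of_flat (h : UD μ f) (hc : 0 < c)
    (hf : Tendsto (fun r => f r / r ^ n) (𝓝[>] 0) (𝓝 c)) {τ : ℝ} (hτ : 0 < τ) :
    ∃ θ > 0, ∃ ε > 0, ∀ x ∈ msupport μ, ∀ r, 0 < r → r ≤ ε → ∀ u : Fin n → Euc d,
      Orthonormal ℝ u → (∀ y ∈ msupport μ, dist y x < 2 * r → ‖res u (y - x)‖ ≤ θ * r) →
      ∀ v : Euc n, ‖v‖ ≤ r → ∃ y ∈ msupport μ, ‖y - (x + emb u v)‖ ≤ τ * r := by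
  by_contra hcon
  push Not at hcon
  choose x hx r hr hr1 us hus hS vs hvs hne using fun j : ℕ =>
    hcon ((j : ℝ) + 1)⁻¹ (by positivity) ((j : ℝ) + 1)⁻¹ (by positivity)
  have hr0 : Tendsto r ul (𝓝 0) := squeeze_zero (fun j => (hr j).le) hr1
    tendsto_inv_natCast_add_one_ul
  obtain ⟨ρ, hρ, hρ0, hl⟩ := h.exists_blowup hc hf hx hr hr0
  have key := hl.eventually_dense hρ hρ0 hus tendsto_inv_natCast_add_one_ul ?_
    (vs := fun j => (r j)⁻¹ • vs j) ?_ hτ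
  · obtain ⟨j, y, hy, hj⟩ := key.exists
    refine (hne j (x j + r j • y) ((mem_msupport_resc (hr j)).1 hy)).not_ge ?_
    have e : x j + r j • y - (x j + emb (us j) (vs j)) =
        r j • (y - emb (us j) ((r j)⁻¹ • vs j)) := by
      rw [map_smul, smul_sub, smul_inv_smul₀ (hr j).ne']; abel
    rw [e, norm_smul, Real.norm_of_nonneg (hr j).le, mul_comm]
    exact mul_le_mul_of_nonneg_right hj (hr j).le
  · intro j y hy hy2
    have h1 := hS j (x j + r j • y) ((mem_msupport_resc (hr j)).1 hy) (by
      rw [dist_eq_norm, add_sub_cancel_left, norm_smul, Real.norm_of_nonneg (hr j).le, mul_comm]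
      exact mul_lt_mul_of_pos_right hy2 (hr j))
    rw [add_sub_cancel_left, map_smul, norm_smul, Real.norm_of_nonneg (hr j).le, mul_comm] at h1
    exact le_of_mul_le_mul_right h1 (hr j)
  · intro j
    rw [norm_smul, norm_inv, Real.norm_of_nonneg (hr j).le, inv_mul_le_iff₀ (hr j), mul_one]
    exact hvs j

/-- Small balls contain flat balls of comparable radius. -/
theorem UD.exists_flat_ball (h : UD μ f) (hc : 0 < c)
    (hf : Tendsto (fun r => f r / r ^ n) (𝓝[>] 0) (𝓝 c)) {δ : ℝ} (hδ : 0 < δ) :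
    ∃ c0 > 0, ∃ ε > 0, ∀ x ∈ msupport μ, ∀ r, 0 < r → r ≤ ε → ∃ x0 ∈ msupport μ,
      dist x0 x ≤ r / 2 ∧ ∃ R, c0 * r ≤ R ∧ R ≤ r / 4 ∧ FlatA n (msupport μ) x0 R (δ * R) := by
  by_contra hcon
  push Not at hcon
  choose x hx r hr hr1 hne using fun j : ℕ =>
    hcon ((j : ℝ) + 1)⁻¹ (by positivity) ((j : ℝ) + 1)⁻¹ (by positivity)
  have hr0 : Tendsto r ul (𝓝 0) := squeeze_zero (fun j => (hr j).le) hr1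
    tendsto_inv_natCast_add_one_ul
  set s : ℕ → ℝ := fun j => √((j : ℝ) + 1) with hs
  have hs1 : ∀ j, 1 ≤ s j := fun j => by
    rw [hs]; exact Real.one_le_sqrt.2 (by linarith [Nat.cast_nonneg (α := ℝ) j])
  have hss : ∀ j : ℕ, s j * s j = (j : ℝ) + 1 := fun j => Real.mul_self_sqrt (by positivity)
  have hs0 : ∀ j, 0 < s j := fun j => zero_lt_one.trans_le (hs1 j)
  have hst : Tendsto s ul atTop := Real.tendsto_sqrt_atTop.comp tendsto_natCast_add_one_ul
  set q : ℕ → ℝ := fun j => r j / s j with hq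
  have hq0 : ∀ j, 0 < q j := fun j => div_pos (hr j) (hs0 j)
  have hqs : ∀ j, q j * s j = r j := fun j => div_mul_cancel₀ _ (hs0 j).ne'
  have hql : Tendsto q ul (𝓝 0) := squeeze_zero (fun j => (hq0 j).le)
    (fun j => div_le_self (hr j).le (hs1 j)) hr0
  obtain ⟨ρ, hρ, hρ0, hl⟩ := h.exists_blowup hc hf hx hq0 hql
  obtain ⟨y, hy, R, hR, hF⟩ := hρ.exists_flat hρ0 (δ := δ / 4) (by positivity)
  obtain ⟨ys, h1, h2⟩ := hl.approx y hy
  have h3 := hl.flatA_of_limit h2 (tendsto_const_nhds (x := R / 2)) (by linarith)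
    (a' := δ / 2 * R) (by nlinarith) hF
  obtain ⟨j, hj1, hj2, hj3, hj4, hj5⟩ := (h1.and (h3.and
    ((h2.norm.eventually_le_const (lt_add_one ‖y‖)).and
      ((hst.eventually_ge_atTop (2 * (‖y‖ + 1))).and
      (hst.eventually_ge_atTop (2 * R + 2 / R)))))).exists
  have hR' : 0 < 2 / R := by positivity
  refine hne j (x j + q j • ys j) ((mem_msupport_resc (hq0 j)).1 hj1) ?_ (q j * (R / 2)) ?_ ?_ ?_
  · rw [dist_eq_norm, add_sub_cancel_left, norm_smul, Real.norm_of_nonneg (hq0 j).le, ← hqs j]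
    nlinarith [hq0 j]
  · rw [← hqs j, inv_mul_le_iff₀ (by positivity), ← hss j]
    have h4 : 1 ≤ s j * (R / 2) := by
      calc (1 : ℝ) = 2 / R * (R / 2) := by field_simp
        _ ≤ _ := mul_le_mul_of_nonneg_right (by linarith) (by positivity)
    nlinarith [mul_pos (hq0 j) (hs0 j)]
  · rw [← hqs j]
    nlinarith [hq0 j]
  · refine ((flatA_resc_iff (hq0 j)).1 hj2).mono le_rfl (le_of_eq (by ring))

end

section

variable {d n : ℕ} {ν : Measure (Euc d)} {c : ℝ}

theorem abs_weightedSum_le {b : OrthonormalBasis (Fin d) ℝ (Euc d)} {w : Fin d → ℝ} {q s : ℝ} (hq : 0 ≤ q)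
    (hw : ∀ i, |w i| ≤ q) (hs : 0 < s) (hs1 : s ≤ 1) {x y : Euc d} (hx : ‖x‖ ≤ 1)
    (hxy : ‖y - x‖ ≤ s) (hy : ∑ i, w i * ⟪b i, y⟫ ^ 2 = 0) :
    |∑ i, w i * ⟪b i, x⟫ ^ 2| ≤ 5 * q * s := by
  have h1 : ∑ i, w i * ⟪b i, x⟫ ^ 2 = -∑ i, w i * (⟪b i, y - x⟫ * ⟪b i, y + x⟫) := by
    rw [← sub_eq_zero, sub_neg_eq_add, ← Finset.sum_add_distrib, ← hy]
    refine Finset.sum_congr rfl fun i _ => ?_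
    rw [inner_sub_right, inner_add_right]; ring
  rw [h1, abs_neg]
  have h2 : ∀ i, |w i * (⟪b i, y - x⟫ * ⟪b i, y + x⟫)| ≤
      q * (1 / (2 * s) * ⟪b i, y - x⟫ ^ 2 + s / 2 * ⟪b i, y + x⟫ ^ 2) := by
    intro i
    rw [abs_mul]
    refine mul_le_mul (hw i) ?_ (abs_nonneg _) ((abs_nonneg _).trans (hw i))
    generalize ⟪b i, y - x⟫ = A
    generalize ⟪b i, y + x⟫ = B
    have h3 : 1 / (2 * s) * A ^ 2 + s / 2 * B ^ 2 - |A * B| = s / 2 * (|A| / s - |B|) ^ 2 := by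
      rw [abs_mul, ← sq_abs A, ← sq_abs B]; field_simp; ring
    have h4 : 0 ≤ s / 2 * (|A| / s - |B|) ^ 2 := by positivity
    linarith
  refine (Finset.abs_sum_le_sum_abs _ _).trans ((Finset.sum_le_sum fun i _ => h2 i).trans ?_)
  rw [← Finset.mul_sum, Finset.sum_add_distrib, ← Finset.mul_sum, ← Finset.mul_sum,
    b.sum_sq_inner_right, b.sum_sq_inner_right]
  have h5 : ‖y + x‖ ≤ 3 := by
    have : y + x = (y - x) + (x + x) := by abel
    rw [this]
    refine (norm_add_le _ _).trans ?_
    linarith [norm_add_le x x]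
  have hn1 := norm_nonneg (y - x)
  have hn2 := norm_nonneg (y + x)
  have h6 : ‖y - x‖ ^ 2 ≤ s ^ 2 := pow_le_pow_left₀ hn1 hxy 2
  have h7 : ‖y + x‖ ^ 2 ≤ 3 ^ 2 := pow_le_pow_left₀ hn2 h5 2
  have h8 : 1 / (2 * s) * ‖y - x‖ ^ 2 ≤ s / 2 := by
    calc 1 / (2 * s) * ‖y - x‖ ^ 2 ≤ 1 / (2 * s) * s ^ 2 := by gcongr
      _ = s / 2 := by field_simp
  have h9 : s / 2 * ‖y + x‖ ^ 2 ≤ s / 2 * 3 ^ 2 := by gcongr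
  calc _ ≤ q * (s / 2 + s / 2 * 3 ^ 2) := by gcongr
    _ = 5 * q * s := by ring

/-- The closeness required in the rigidity of weighted quadratic forms. -/
def rigidTol (n : ℕ) : ℝ := (1 / (32 * ((n : ℝ) + 1) ^ 2)) ^ 2 / (40 * ((n : ℝ) + 1) ^ 2)

theorem rigidTol_pos (n : ℕ) : 0 < rigidTol n := by unfold rigidTol; positivity

theorem exists_frame_of_card {b : OrthonormalBasis (Fin d) ℝ (Euc d)} {w : Fin d → ℝ}
    {I : Finset (Fin d)} (hI : I.card = n) (hw : ∀ i ∈ I, w i = 1) (hw' : ∀ i ∉ I, w i = 0) :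
    ∃ u : Fin n → Euc d, Orthonormal ℝ u ∧ ∀ y, ∑ i, w i * ⟪b i, y⟫ ^ 2 = ‖cf u y‖ ^ 2 := by
  let e := I.equivFinOfCardEq hI
  refine ⟨fun k => b (e.symm k : Fin d), b.orthonormal.comp _
    (Subtype.val_injective.comp e.symm.injective), fun y => ?_⟩
  rw [EuclideanSpace.real_norm_sq_eq]
  simp only [cf_apply]
  rw [e.symm.sum_comp (fun i : I => ⟪b (i : Fin d), y⟫ ^ 2),
    Finset.sum_coe_sort I (fun i => ⟪b i, y⟫ ^ 2),
    ← Finset.sum_subset (Finset.subset_univ I) fun i _ hi => by rw [hw' i hi, zero_mul]]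
  exact Finset.sum_congr rfl fun i hi => by rw [hw i hi, one_mul]

set_option maxHeartbeats 1600000 in
/-- Rigidity: a weighted quadratic form of trace `n` which agrees with the norm on a set nearly
filling an `n`-plane is the square of an orthogonal projection. -/
theorem exists_frame_of_weights {b : OrthonormalBasis (Fin d) ℝ (Euc d)} {w : Fin d → ℝ}
    (hw : ∀ i, 0 ≤ w i) (hsum : ∑ i, w i = n) {S : Set (Euc d)}
    (hS : ∀ y ∈ S, ∑ i, w i * ⟪b i, y⟫ ^ 2 = ‖y‖ ^ 2) {u0 : Fin n → Euc d}
    (hu0 : Orthonormal ℝ u0)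
    (hd : ∀ v : Euc n, ‖v‖ ≤ 1 → ∃ y ∈ S, ‖y - emb u0 v‖ ≤ rigidTol n) :
    ∃ u : Fin n → Euc d, Orthonormal ℝ u ∧ ∀ y, ∑ i, w i * ⟪b i, y⟫ ^ 2 = ‖cf u y‖ ^ 2 := by
  set q : ℝ := (n : ℝ) + 1 with hq
  have hq1 : 1 ≤ q := by rw [hq]; linarith [Nat.cast_nonneg (α := ℝ) n]
  have hq0 : 0 < q := by linarith
  set t : ℝ := 1 / (32 * q ^ 2) with ht
  have htq : t * q ^ 2 = 1 / 32 := by rw [ht]; field_simp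
  have ht0 : 0 < t := by rw [ht]; positivity
  have htq1 : t * q ≤ 1 / 32 := by nlinarith
  have ht1 : t ≤ 1 / 32 := by nlinarith
  have hτ : rigidTol n = t ^ 2 / (40 * q ^ 2) := rfl
  set τ := rigidTol n
  have hτ0 : 0 < τ := rigidTol_pos n
  have hτq : q ^ 2 * τ = t ^ 2 / 40 := by rw [hτ]; field_simp
  have hτt : τ ≤ t / 2 := by
    have : τ ≤ q ^ 2 * τ := le_mul_of_one_le_left hτ0.le (one_le_pow₀ hq1)
    nlinarith
  have hwn : ∀ i, w i ≤ n := fun i => by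
    rw [← hsum]; exact Finset.single_le_sum (fun j _ => hw j) (Finset.mem_univ i)
  have hwq : ∀ i, |w i - 1| ≤ q := fun i => by
    rw [abs_le]; constructor <;> linarith [hwn i, hw i]
  have hF : ∀ y ∈ S, ∑ i, (w i - 1) * ⟪b i, y⟫ ^ 2 = 0 := by
    intro y hy
    simp only [sub_mul, one_mul]
    rw [Finset.sum_sub_distrib, hS y hy, b.sum_sq_inner_right, sub_self]
  have hlip : ∀ x y : Euc d, ‖x‖ ≤ 1 → y ∈ S → ∀ s, 0 < s → s ≤ 1 → ‖y - x‖ ≤ s →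
      |∑ i, (w i - 1) * ⟪b i, x⟫ ^ 2| ≤ 5 * q * s := fun x y hx hy s hs hs1 hxy =>
    abs_weightedSum_le hq0.le hwq hs hs1 hx hxy (hF y hy)
  set m : Fin d → ℝ := fun i => ‖cf u0 (b i)‖ ^ 2 with hm
  have hm0 : ∀ i, 0 ≤ m i := fun i => sq_nonneg _
  have hm1 : ∀ i, 1 - m i = ‖res u0 (b i)‖ ^ 2 := fun i => by
    have := norm_sq_eq_cf_res hu0 (b i)
    rw [b.orthonormal.1 i, one_pow] at this
    simp only [hm]; linarith
  have hm1' : ∀ i, m i ≤ 1 := fun i => by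
    have := hm1 i; nlinarith [sq_nonneg ‖res u0 (b i)‖]
  have hmk : ∀ i, m i = ∑ k, ⟪b i, u0 k⟫ ^ 2 := fun i => by
    simp only [hm]
    rw [EuclideanSpace.real_norm_sq_eq]
    exact Finset.sum_congr rfl fun k _ => by rw [cf_apply, real_inner_comm]
  have hmsum : ∑ i, m i = n := by
    simp only [hmk]
    rw [Finset.sum_comm]
    simp only [b.sum_sq_inner_right, hu0.1, one_pow]
    simp
  have hu0k : ∀ k, |∑ i, (w i - 1) * ⟪b i, u0 k⟫ ^ 2| ≤ 5 * q * τ := by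
    intro k
    obtain ⟨y, hy, hyk⟩ := hd (EuclideanSpace.single k 1) (by simp)
    have he : emb u0 (EuclideanSpace.single k 1) = u0 k := by
      rw [emb_apply, Finset.sum_eq_single k] <;> simp +contextual
    rw [he] at hyk
    exact hlip _ y (hu0.1 k).le hy τ hτ0 (by linarith) hyk
  have hwm : |∑ i, (w i - 1) * m i| ≤ t ^ 2 / 8 := by
    have h1 : ∑ i, (w i - 1) * m i = ∑ k, ∑ i, (w i - 1) * ⟪b i, u0 k⟫ ^ 2 := by
      rw [Finset.sum_comm]
      exact Finset.sum_congr rfl fun i _ => by rw [hmk, Finset.mul_sum]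
    rw [h1]
    refine (Finset.abs_sum_le_sum_abs _ _).trans ((Finset.sum_le_sum fun k _ => hu0k k).trans ?_)
    rw [Finset.sum_const, Finset.card_univ, Fintype.card_fin, nsmul_eq_mul]
    have : (n : ℝ) ≤ q := by rw [hq]; linarith
    calc (n : ℝ) * (5 * q * τ) ≤ q * (5 * q * τ) := by gcongr
      _ = 5 * (q ^ 2 * τ) := by ring
      _ = t ^ 2 / 8 := by rw [hτq]; ring
  have hwm1 : ∑ i, w i * (1 - m i) ≤ t ^ 2 / 8 := by
    have h1 : ∑ i, w i * (1 - m i) = -∑ i, (w i - 1) * m i := by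
      have h2 : ∑ i, w i * (1 - m i) + ∑ i, (w i - 1) * m i = ∑ i, w i - ∑ i, m i := by
        rw [← Finset.sum_add_distrib, ← Finset.sum_sub_distrib]
        exact Finset.sum_congr rfl fun i _ => by ring
      rw [hsum, hmsum, sub_self] at h2
      linarith
    rw [h1]
    exact (neg_le_abs _).trans hwm
  have hwmi : ∀ i, w i * (1 - m i) ≤ t ^ 2 / 8 := fun i =>
    (Finset.single_le_sum (f := fun j => w j * (1 - m j))
      (fun j _ => mul_nonneg (hw j) (by linarith [hm1' j]))
      (Finset.mem_univ i)).trans hwm1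
  classical
  set I : Finset (Fin d) := Finset.univ.filter fun i => 1 / 2 < w i with hI
  have hIw : ∀ i ∈ I, 1 / 2 < w i := fun i hi => (Finset.mem_filter.1 hi).2
  have hIw' : ∀ i ∉ I, w i ≤ 1 / 2 := fun i hi => by
    by_contra hcon
    exact hi (Finset.mem_filter.2 ⟨Finset.mem_univ i, not_le.1 hcon⟩)
  have hIm : ∀ i ∈ I, 1 - m i ≤ (t / 2) ^ 2 := fun i hi => by
    have h1 := hwmi i
    have h2 := hIw i hi
    have h3 := hm1' i
    nlinarith
  have hIS : ∀ i ∈ I, ∃ y ∈ S, ‖y - b i‖ ≤ t := by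
    intro i hi
    obtain ⟨y, hy, hyi⟩ := hd (cf u0 (b i)) ((norm_cf_le hu0 _).trans (b.orthonormal.1 i).le)
    refine ⟨y, hy, ?_⟩
    have h1 : ‖res u0 (b i)‖ ≤ t / 2 := by
      refine le_of_sq_le_sq ?_ (by positivity)
      rw [← hm1]; exact hIm i hi
    have h2 : y - b i = (y - emb u0 (cf u0 (b i))) - res u0 (b i) := by
      conv_lhs => rw [← emb_cf_add_res (u := u0) (b i)]
      abel
    rw [h2]
    refine (norm_sub_le _ _).trans ?_
    linarith
  have hIw1 : ∀ i ∈ I, |w i - 1| ≤ 5 * q * t := by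
    intro i hi
    obtain ⟨y, hy, hyi⟩ := hIS i hi
    have h1 := hlip (b i) y (b.orthonormal.1 i).le hy t ht0 (by linarith) hyi
    rwa [Finset.sum_eq_single i, real_inner_self_eq_norm_sq, b.orthonormal.1 i, one_pow, one_pow,
      mul_one] at h1
    · intro j _ hj
      rw [b.orthonormal.2 hj]; ring
    · simp
  have hMle : ∑ i ∈ I, m i ≤ I.card := by
    calc ∑ i ∈ I, m i ≤ ∑ i ∈ I, (1 : ℝ) := Finset.sum_le_sum fun i _ => hm1' i
      _ = I.card := by simp
  have hMsplit : ∑ i ∈ I, m i + ∑ i ∈ Iᶜ, m i = n := by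
    rw [Finset.sum_add_sum_compl, hmsum]
  have hMc : 0 ≤ ∑ i ∈ Iᶜ, m i := Finset.sum_nonneg fun i _ => hm0 i
  have hcard_le : I.card ≤ n := by
    have h1 : (I.card : ℝ) * (1 - (t / 2) ^ 2) ≤ ∑ i ∈ I, m i := by
      rw [← nsmul_eq_mul]
      exact Finset.card_nsmul_le_sum _ _ _ fun i hi => by linarith [hIm i hi]
    by_contra hcon
    push Not at hcon
    have h2 : (n : ℝ) + 1 ≤ I.card := by exact_mod_cast hcon
    have h3 : (0 : ℝ) ≤ 1 - (t / 2) ^ 2 := by nlinarith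
    have h4 : q * (1 - (t / 2) ^ 2) ≤ n :=
      (mul_le_mul_of_nonneg_right h2 h3).trans (h1.trans (by linarith))
    nlinarith
  have hcard_ge : n ≤ I.card := by
    have h1 : ∑ i ∈ I, (w i - 1) * m i ≤ 5 * q * t * ∑ i ∈ I, m i := by
      rw [Finset.mul_sum]
      exact Finset.sum_le_sum fun i hi =>
        mul_le_mul_of_nonneg_right ((le_abs_self _).trans (hIw1 i hi)) (hm0 i)
    have h2 : ∑ i ∈ Iᶜ, (w i - 1) * m i ≤ -(1 / 2) * ∑ i ∈ Iᶜ, m i := by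
      rw [Finset.mul_sum]
      exact Finset.sum_le_sum fun i hi =>
        mul_le_mul_of_nonneg_right (by linarith [hIw' i (Finset.mem_compl.1 hi)]) (hm0 i)
    have h3 := neg_le_of_abs_le hwm
    rw [← Finset.sum_add_sum_compl I] at h3
    have h4 : 5 * q * t * ∑ i ∈ I, m i ≤ 5 * q * t * q := by
      refine mul_le_mul_of_nonneg_left ?_ (by positivity)
      linarith
    have h5 : (n : ℝ) - 1 < I.card := by nlinarith
    have h6 : (n : ℝ) < (I.card + 1 : ℕ) := by push_cast; linarith
    have h7 : n < I.card + 1 := by exact_mod_cast h6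
    omega
  have hcard : I.card = n := le_antisymm hcard_le hcard_ge
  have hsumI : ∑ i ∈ I, w i + ∑ i ∈ Iᶜ, w i = n := by rw [Finset.sum_add_sum_compl, hsum]
  have hsumIc : 0 ≤ ∑ i ∈ Iᶜ, w i := Finset.sum_nonneg fun i _ => hw i
  have hsumI1 : ∑ i ∈ I, (w i - 1) + ∑ i ∈ Iᶜ, w i = 0 := by
    rw [Finset.sum_sub_distrib]; simp [hcard]; linarith
  have hge : ∀ i ∈ I, 1 ≤ w i := by
    by_contra! hcon
    obtain ⟨j, hj, hj1⟩ := hcon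
    obtain ⟨i0, hi0, hmin⟩ := Finset.exists_min_image I w ⟨j, hj⟩
    set ε := 1 - w i0 with hε
    have hε0 : 0 < ε := by linarith [hmin j hj]
    have hub : ∀ i ∈ I, w i - 1 ≤ q * ε := by
      intro i hi
      have h1 : (w i - 1) + ∑ k ∈ I.erase i, (w k - 1) = ∑ k ∈ I, (w k - 1) :=
        Finset.add_sum_erase I (fun k => w k - 1) hi
      have h2 : ((I.erase i).card : ℝ) * (-ε) ≤ ∑ k ∈ I.erase i, (w k - 1) := by
        rw [← nsmul_eq_mul]
        exact Finset.card_nsmul_le_sum _ _ _ fun k hk => by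
          linarith [hmin k (Finset.mem_of_mem_erase hk)]
      have h3 : ((I.erase i).card : ℝ) ≤ q := by
        have : (I.erase i).card ≤ n := (Finset.card_erase_le).trans hcard_le
        have : ((I.erase i).card : ℝ) ≤ n := by exact_mod_cast this
        linarith
      have h4 : ((I.erase i).card : ℝ) * ε ≤ q * ε := mul_le_mul_of_nonneg_right h3 hε0.le
      linarith
    obtain ⟨y, hy, hyi⟩ := hIS i0 hi0
    have h1 := hF y hy
    rw [← Finset.add_sum_erase _ _ (Finset.mem_univ i0)] at h1
    have h2 : ∑ i ∈ Finset.univ.erase i0, (w i - 1) * ⟪b i, y⟫ ^ 2 ≤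
        q * ε * ∑ i ∈ Finset.univ.erase i0, ⟪b i, y⟫ ^ 2 := by
      rw [Finset.mul_sum]
      refine Finset.sum_le_sum fun i _ => mul_le_mul_of_nonneg_right ?_ (sq_nonneg _)
      by_cases hi : i ∈ I
      · exact hub i hi
      · have := hIw' i hi
        have : 0 ≤ q * ε := by positivity
        linarith
    have h3 : ∑ i ∈ Finset.univ.erase i0, ⟪b i, y⟫ ^ 2 ≤ t ^ 2 := by
      calc ∑ i ∈ Finset.univ.erase i0, ⟪b i, y⟫ ^ 2
          = ∑ i ∈ Finset.univ.erase i0, ⟪b i, y - b i0⟫ ^ 2 := by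
            refine Finset.sum_congr rfl fun i hi => ?_
            rw [inner_sub_right, b.orthonormal.2 (Finset.ne_of_mem_erase hi), sub_zero]
        _ ≤ ∑ i, ⟪b i, y - b i0⟫ ^ 2 :=
            Finset.sum_le_sum_of_subset_of_nonneg (Finset.erase_subset _ _)
              fun i _ _ => sq_nonneg _
        _ = ‖y - b i0‖ ^ 2 := b.sum_sq_inner_right _
        _ ≤ t ^ 2 := pow_le_pow_left₀ (norm_nonneg _) hyi 2
    have h4 : 1 - t ≤ ⟪b i0, y⟫ := by
      have h5 : ⟪b i0, y⟫ = 1 + ⟪b i0, y - b i0⟫ := by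
        rw [inner_sub_right, real_inner_self_eq_norm_sq, b.orthonormal.1 i0]; ring
      have h6 := abs_real_inner_le_norm (b i0) (y - b i0)
      rw [b.orthonormal.1 i0, one_mul] at h6
      linarith [neg_le_of_abs_le h6]
    have h5 : (1 / 2) ^ 2 ≤ ⟪b i0, y⟫ ^ 2 := pow_le_pow_left₀ (by norm_num) (by linarith) 2
    have h6 : q * ε * ∑ i ∈ Finset.univ.erase i0, ⟪b i, y⟫ ^ 2 ≤ q * ε * t ^ 2 :=
      mul_le_mul_of_nonneg_left h3 (by positivity)
    have h7 : w i0 - 1 = -ε := by rw [hε]; ring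
    rw [h7] at h1
    have h8 : q * t ^ 2 ≤ 1 / 32 := by nlinarith
    nlinarith
  have hsumI0 : 0 ≤ ∑ i ∈ I, (w i - 1) := Finset.sum_nonneg fun i hi => by linarith [hge i hi]
  have hz1 : ∑ i ∈ I, (w i - 1) = 0 := by linarith
  have hz2 : ∑ i ∈ Iᶜ, w i = 0 := by linarith
  rw [Finset.sum_eq_zero_iff_of_nonneg fun i hi => by linarith [hge i hi]] at hz1
  rw [Finset.sum_eq_zero_iff_of_nonneg fun i _ => hw i] at hz2
  exact exists_frame_of_card hcard (fun i hi => by linarith [hz1 i hi])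
    fun i hi => hz2 i (Finset.mem_compl.2 hi)

end

section

variable {d n : ℕ} {ν : Measure (Euc d)} {c : ℝ}

theorem integrable_prof2_smul [IsLocallyFiniteMeasure ν] (y : Euc d) :
    Integrable (fun z : Euc d => (prof2 (‖z‖ ^ 2) * ⟪z, y⟫) • z) ν :=
  Continuous.integrable_of_eq_zero (by have := continuous_prof2; fun_prop) 1
    fun z hz => by rw [prof2_eq_zero (one_le_sq_of_lt hz), zero_mul, zero_smul]

/-- The second moment operator. -/
def mOp (ν : Measure (Euc d)) [IsLocallyFiniteMeasure ν] : Euc d →ₗ[ℝ] Euc d where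
  toFun y := ∫ z, (prof2 (‖z‖ ^ 2) * ⟪z, y⟫) • z ∂ν
  map_add' x y := by
    rw [← integral_add (integrable_prof2_smul x) (integrable_prof2_smul y)]
    refine integral_congr_ae (Eventually.of_forall fun z => ?_)
    simp only [inner_add_right, mul_add, add_smul]
  map_smul' a y := by
    rw [RingHom.id_apply, ← integral_smul]
    refine integral_congr_ae (Eventually.of_forall fun z => ?_)
    simp only [inner_smul_right, smul_smul]
    ring_nf

theorem inner_mOp [IsLocallyFiniteMeasure ν] (x y : Euc d) :
    ⟪mOp ν x, y⟫ = ∫ z, prof2 (‖z‖ ^ 2) * (⟪z, x⟫ * ⟪z, y⟫) ∂ν := by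
  rw [real_inner_comm]
  change ⟪y, ∫ z, (prof2 (‖z‖ ^ 2) * ⟪z, x⟫) • z ∂ν⟫ = _
  rw [← integral_inner (integrable_prof2_smul x)]
  refine integral_congr_ae (Eventually.of_forall fun z => ?_)
  simp only [inner_smul_right]
  rw [real_inner_comm y z]
  ring

theorem isSymmetric_mOp [IsLocallyFiniteMeasure ν] : (mOp ν).IsSymmetric := by
  intro x y
  rw [real_inner_comm _ x, inner_mOp, inner_mOp]
  exact integral_congr_ae (Eventually.of_forall fun z => by simp only [mul_comm ⟪z, x⟫])

/-- The second moment form of a uniform measure is diagonalizable with trace `n`. -/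
theorem Unif.exists_eigenbasis (h : Unif c n ν) (h0 : 0 ∈ msupport ν) :
    ∃ (b : OrthonormalBasis (Fin d) ℝ (Euc d)) (w : Fin d → ℝ), (∀ i, 0 ≤ w i) ∧
      ∑ i, w i = n ∧ ∀ y, 2 * mQ ν y = mG ν * ∑ i, w i * ⟪b i, y⟫ ^ 2 := by
  have := h.isLocallyFinite h0
  have hG := h.mG_pos h0
  have hd : Module.finrank ℝ (Euc d) = d := by simp
  set b := (isSymmetric_mOp (ν := ν)).eigenvectorBasis hd with hb
  set w := (isSymmetric_mOp (ν := ν)).eigenvalues hd with hw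
  have hAb : ∀ i, mOp ν (b i) = w i • b i := fun i =>
    (isSymmetric_mOp (ν := ν)).apply_eigenvectorBasis hd i
  have hQ : ∀ y, mQ ν y = ∑ i, w i * ⟪b i, y⟫ ^ 2 := by
    intro y
    have h1 : mQ ν y = ⟪mOp ν y, y⟫ := by rw [inner_mOp]; simp only [mQ, sq]
    rw [h1, ← b.sum_inner_mul_inner]
    refine Finset.sum_congr rfl fun i _ => ?_
    rw [isSymmetric_mOp, hAb, inner_smul_right, real_inner_comm]; ring
  have hQb : ∀ i, mQ ν (b i) = w i := by
    intro i
    rw [hQ, Finset.sum_eq_single i]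
    · rw [real_inner_self_eq_norm_sq, b.orthonormal.1 i]; ring
    · intro j _ hj
      rw [b.orthonormal.2 hj]; ring
    · simp
  refine ⟨b, fun i => 2 / mG ν * w i, fun i => ?_, ?_, fun y => ?_⟩
  · simp only [← hQb]
    have := mQ_nonneg (ν := ν) (b i)
    positivity
  · rw [← Finset.mul_sum]
    have h1 := h.trace h0 b
    simp only [hQb] at h1
    rw [h1]; field_simp
  · rw [hQ]
    simp only [mul_assoc]
    rw [← Finset.mul_sum, ← mul_assoc, mul_div_cancel₀ _ hG.ne']

/-- Vectors whose inner products with a set converge have a weak limit on that set. -/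
theorem exists_inner_lim {bs : ℕ → Euc d} {S : Set (Euc d)}
    (hS : ∀ y ∈ S, ∃ l, Tendsto (fun j => ⟪bs j, y⟫) ul (𝓝 l)) :
    ∃ β : Euc d, ∀ y ∈ S, Tendsto (fun j => ⟪bs j, y⟫) ul (𝓝 ⟪β, y⟫) := by
  let V : Submodule ℝ (Euc d) :=
    { carrier := {y | ∃ l, Tendsto (fun j => ⟪bs j, y⟫) ul (𝓝 l)}
      add_mem' := by
        rintro x y ⟨l, hl⟩ ⟨m, hm⟩
        exact ⟨l + m, by simpa only [inner_add_right] using hl.add hm⟩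
      zero_mem' := ⟨0, by simp only [inner_zero_right]; exact tendsto_const_nhds⟩
      smul_mem' := by
        rintro a y ⟨l, hl⟩
        exact ⟨a * l, by simpa only [inner_smul_right] using hl.const_mul a⟩ }
  let b := stdOrthonormalBasis ℝ V
  have hb : ∀ i, ∃ l, Tendsto (fun j => ⟪bs j, (b i : Euc d)⟫) ul (𝓝 l) := fun i => (b i).2
  choose l hl using hb
  refine ⟨∑ i, l i • (b i : Euc d), fun y hy => ?_⟩
  have hyV : y ∈ V := hS y hy
  have h1 : y = ∑ i, ⟪b i, (⟨y, hyV⟩ : V)⟫ • (b i : Euc d) := by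
    have := congrArg (fun z : V => (z : Euc d)) (b.sum_repr' ⟨y, hyV⟩)
    simpa using this.symm
  have h2 : ∀ v : Euc d, ⟪v, y⟫ = ∑ i, ⟪b i, (⟨y, hyV⟩ : V)⟫ * ⟪v, (b i : Euc d)⟫ := by
    intro v
    conv_lhs => rw [h1]
    rw [inner_sum]
    exact Finset.sum_congr rfl fun i _ => inner_smul_right _ _ _
  simp only [h2]
  refine tendsto_finsetSum _ fun i _ => ?_
  have h3 : ⟪∑ k, l k • (b k : Euc d), (b i : Euc d)⟫ = l i := by
    have ho : Orthonormal ℝ fun k => (b k : Euc d) := b.orthonormal.comp_linearIsometry V.subtypeₗᵢ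
    have := ho.inner_left_fintype l i
    simpa using this
  rw [h3]
  exact (hl i).const_mul _

/-- The support of a uniform measure lies on a quadric determined by an asymptotic measure. -/
theorem Unif.exists_quadric (h : Unif c n ν) (h0 : 0 ∈ msupport ν) {ρ : Measure (Euc d)}
    (hl : LimitOf (fun j : ℕ => resc n 0 ((j : ℝ) + 1) ν) ρ) :
    ∃ β : Euc d, ∀ y ∈ msupport ν, mG ν * ‖y‖ ^ 2 - 2 * mQ ρ y = ⟪β, y⟫ := by
  have hT : ∀ j : ℕ, (0 : ℝ) < (j : ℝ) + 1 := fun j => by positivity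
  have hus : ∀ j : ℕ, Unif c n (resc n 0 ((j : ℝ) + 1) ν) := fun j => h.resc_unif (hT j)
  have h0s : ∀ j : ℕ, (0 : Euc d) ∈ msupport (resc n 0 ((j : ℝ) + 1) ν) := fun j =>
    (zero_mem_msupport_resc (hT j)).2 h0
  have key : ∀ y ∈ msupport ν,
      Tendsto (fun j : ℕ => ⟪(2 * ((j : ℝ) + 1)) • mB (resc n 0 ((j : ℝ) + 1) ν), y⟫) ul
        (𝓝 (mG ν * ‖y‖ ^ 2 - 2 * mQ ρ y)) := by
    intro y hy
    have h1 : Tendsto (fun j : ℕ => mG ν * ‖y‖ ^ 2 - 2 * mQ (resc n 0 ((j : ℝ) + 1) ν) y) ul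
        (𝓝 (mG ν * ‖y‖ ^ 2 - 2 * mQ ρ y)) :=
      ((hl.mQ_tendsto hus h0s tendsto_const_nhds).const_mul 2).const_sub _
    have h2 : Tendsto (fun j : ℕ => (mG ν * ‖y‖ ^ 2 - 2 * mQ (resc n 0 ((j : ℝ) + 1) ν) y) -
        ⟪(2 * ((j : ℝ) + 1)) • mB (resc n 0 ((j : ℝ) + 1) ν), y⟫) ul (𝓝 0) := by
      have h3 : Tendsto (fun j : ℕ => 140 * (c * 2 ^ n) * (‖y‖ ^ 3 / ((j : ℝ) + 1))) ul
          (𝓝 (140 * (c * 2 ^ n) * 0)) :=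
        (tendsto_natCast_add_one_ul.const_div_atTop _).const_mul _
      rw [mul_zero] at h3
      refine squeeze_zero_norm' ?_ h3
      filter_upwards [tendsto_natCast_add_one_ul.eventually_ge_atTop ‖y‖] with j hj
      have h4 := h.moment h0 (hT j) hy hj
      rw [Real.norm_eq_abs, real_inner_smul_left]
      convert h4 using 2
      ring
    simpa using h1.sub h2
  obtain ⟨β, hβ⟩ := exists_inner_lim fun y hy => ⟨_, key y hy⟩
  exact ⟨β, fun y hy => tendsto_nhds_unique (key y hy) (hβ y hy)⟩

theorem LimitOf.quadric {ρ : Measure (Euc d)}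
    (hl : LimitOf (fun j : ℕ => resc n 0 ((j : ℝ) + 1) ν) ρ) {g : ℝ} {β : Euc d}
    {Q : Euc d → ℝ} (hQ : ∀ a y, Q (a • y) = a ^ 2 * Q y)
    (h : ∀ y ∈ msupport ν, g * ‖y‖ ^ 2 - 2 * Q y = ⟪β, y⟫) :
    ∀ y ∈ msupport ρ, ∃ ys : ℕ → Euc d, Tendsto ys ul (𝓝 y) ∧
      ∀ᶠ j : ℕ in ul, ((j : ℝ) + 1) * (g * ‖ys j‖ ^ 2 - 2 * Q (ys j)) = ⟪β, ys j⟫ := by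
  intro y hy
  have hT : ∀ j : ℕ, (0 : ℝ) < (j : ℝ) + 1 := fun j => by positivity
  obtain ⟨ys, h1, h2⟩ := hl.exists_points hT hy
  refine ⟨ys, h2, h1.mono fun j hj => ?_⟩
  have h3 := h _ hj
  rw [zero_add, norm_smul, hQ, inner_smul_right, Real.norm_of_nonneg (hT j).le] at h3
  refine mul_left_cancel₀ (hT j).ne' ?_
  linarith

/-- A uniform measure which is one-sided flat at all large scales stays near an `n`-plane. -/
theorem exists_frame_of_flat (d n : ℕ) (c : ℝ) : ∃ η > 0, ∀ ν : Measure (Euc d), Unif c n ν →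
    0 ∈ msupport ν → (∀ t, 1 ≤ t → FlatA n (msupport ν) 0 t (2 * η * t)) →
    ∃ u : Fin n → Euc d, Orthonormal ℝ u ∧ ∃ C, 0 ≤ C ∧ ∀ y ∈ msupport ν, ‖res u y‖ ≤ C := by
  obtain ⟨θ, hθ, H⟩ := exists_dense_of_flat_unif d n c (rigidTol_pos n)
  refine ⟨θ / 4, by positivity, fun ν h h0 hF => ?_⟩
  have hT : ∀ j : ℕ, (0 : ℝ) < (j : ℝ) + 1 := fun j => by positivity
  obtain ⟨ρ, hρ, hρ0, hl⟩ := h.exists_resc_limit (x := fun _ => 0) (fun _ => h0) hT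
  have hG := h.mG_pos h0
  obtain ⟨β, hβ⟩ := h.exists_quadric h0 hl
  obtain ⟨b, w, hw, hwn, hwQ⟩ := hρ.exists_eigenbasis hρ0
  rw [hρ.mG_eq hρ0 h h0] at hwQ
  have hflat : FlatA n (msupport ρ) 0 2 θ := by
    refine hl.flatA (xs := fun _ => 0) tendsto_const_nhds (as := fun _ => θ) tendsto_const_nhds
      (Eventually.of_forall fun j => ?_)
    rw [flatA_resc_iff (hT j)]
    have := hF (((j : ℝ) + 1) * 2) (by linarith [Nat.cast_nonneg (α := ℝ) j])
    rw [smul_zero, add_zero]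
    exact this.mono le_rfl (le_of_eq (by ring))
  obtain ⟨u0, hu0, hu0S⟩ := hflat
  have hdense := H ρ hρ hρ0 u0 hu0 fun y hy hy2 => by
    simpa using hu0S y hy (by simpa using hy2)
  have hpts := hl.quadric (g := mG ν) (β := β) (Q := fun y => mG ν / 2 * ∑ i, w i * ⟪b i, y⟫ ^ 2)
    (fun a y => by
      simp only [inner_smul_right, mul_pow, Finset.mul_sum]
      exact Finset.sum_congr rfl fun i _ => by ring)
    (fun y hy => by rw [← hβ y hy, hwQ]; ring)
  have hN : ∀ y ∈ msupport ρ, ∑ i, w i * ⟪b i, y⟫ ^ 2 = ‖y‖ ^ 2 := by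
    intro y hy
    obtain ⟨ys, h1, h2⟩ := hpts y hy
    have h3 : Tendsto (fun j => ⟪β, ys j⟫ / ((j : ℝ) + 1)) ul (𝓝 0) :=
      (tendsto_const_nhds.inner h1).div_atTop tendsto_natCast_add_one_ul
    have h4 : Tendsto (fun j => mG ν * ‖ys j‖ ^ 2 -
        2 * (mG ν / 2 * ∑ i, w i * ⟪b i, ys j⟫ ^ 2)) ul
        (𝓝 (mG ν * ‖y‖ ^ 2 - 2 * (mG ν / 2 * ∑ i, w i * ⟪b i, y⟫ ^ 2))) := by
      have hc : Continuous fun y : Euc d => mG ν * ‖y‖ ^ 2 -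
        2 * (mG ν / 2 * ∑ i, w i * ⟪b i, y⟫ ^ 2) := by fun_prop
      exact (hc.tendsto y).comp h1
    have h5 := tendsto_nhds_unique h4 (h3.congr' (h2.mono fun j hj => by
      rw [← hj]; exact mul_div_cancel_left₀ _ (hT j).ne'))
    have h6 : mG ν * (‖y‖ ^ 2 - ∑ i, w i * ⟪b i, y⟫ ^ 2) = 0 := by linarith
    linarith [(mul_eq_zero.1 h6).resolve_left hG.ne']
  obtain ⟨u, hu, huN⟩ := exists_frame_of_weights hw hwn hN hu0 hdense
  have hres : ∀ y, mG ν * ‖y‖ ^ 2 - 2 * (mG ν / 2 * ∑ i, w i * ⟪b i, y⟫ ^ 2) =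
      mG ν * ‖res u y‖ ^ 2 := fun y => by
    rw [huN, norm_sq_eq_cf_res hu y]; ring
  have hspan : ∀ y ∈ msupport ρ, ‖y‖ < 2 → res u y = 0 := by
    intro y hy _
    have h1 := hN y hy
    rw [huN, norm_sq_eq_cf_res hu y] at h1
    have : ‖res u y‖ ^ 2 = 0 := by linarith
    simpa using this
  have hpos : ∀ v : Euc n, ‖v‖ < 2 → 0 ≤ ⟪β, emb u v⟫ := by
    intro v hv
    obtain ⟨ys, h1, h2⟩ := hpts _ (hρ.full hρ0 hu hspan hv)
    refine ge_of_tendsto (tendsto_const_nhds.inner h1) (h2.mono fun j hj => ?_)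
    rw [← hj, hres]
    have := hT j
    positivity
  have hzero : ∀ v : Euc n, ⟪β, emb u v⟫ = 0 := by
    intro v
    have h1 : ∀ v : Euc n, ‖v‖ < 2 → ⟪β, emb u v⟫ = 0 := fun v hv => by
      have h2 := hpos v hv
      have h3 := hpos (-v) (by rwa [norm_neg])
      rw [map_neg, inner_neg_right] at h3
      linarith
    have hs : (0 : ℝ) < ‖v‖ + 1 := by positivity
    have h4 := h1 ((‖v‖ + 1)⁻¹ • v) (by
      rw [norm_smul, norm_inv, Real.norm_of_nonneg hs.le, inv_mul_lt_iff₀ hs]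
      linarith [norm_nonneg v])
    rw [map_smul, inner_smul_right] at h4
    exact (mul_eq_zero.1 h4).resolve_left (inv_pos.2 hs).ne'
  refine ⟨u, hu, ‖β‖ / mG ν, by positivity, fun y hy => ?_⟩
  have h1 := hβ y hy
  rw [hwQ, show mG ν * ‖y‖ ^ 2 - mG ν * ∑ i, w i * ⟪b i, y⟫ ^ 2 = mG ν * ‖res u y‖ ^ 2 by
    rw [← hres]; ring] at h1
  have h2 : ⟪β, y⟫ = ⟪β, res u y⟫ := by
    conv_lhs => rw [← emb_cf_add_res (u := u) y]
    rw [inner_add_right, hzero, zero_add]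
  have h3 := real_inner_le_norm β (res u y)
  rw [← h2, ← h1] at h3
  rw [le_div_iff₀ hG]
  rcases (norm_nonneg (res u y)).eq_or_lt with h4 | h4
  · rw [← h4, zero_mul]; exact norm_nonneg _
  · refine le_of_mul_le_mul_right ?_ h4
    linarith

end

section

variable {d n : ℕ} {ν : Measure (Euc d)} {c C : ℝ} {u : Fin n → Euc d}

/-- `ν` is an `n`-uniform measure through the origin whose support stays within bounded distance
of the plane spanned by the frame `u`. -/
structure Strip (c C : ℝ) (ν : Measure (Euc d)) (u : Fin n → Euc d) : Prop where
  unif : Unif c n ν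
  zero : 0 ∈ msupport ν
  frame : Orthonormal ℝ u
  nonneg : 0 ≤ C
  bound : ∀ y ∈ msupport ν, ‖res u y‖ ≤ C

theorem Strip.norm_res_le_of_resc (h : Strip c C ν u) {x : Euc d} (hx : x ∈ msupport ν) {T : ℝ}
    (hT : 0 < T) {z : Euc d} (hz : z ∈ msupport (resc n x T ν)) : ‖res u z‖ ≤ 2 * C / T := by
  have h1 := h.bound _ ((mem_msupport_resc hT).1 hz)
  have h2 := h.bound _ hx
  have h3 : T • res u z = res u (x + T • z) - res u x := by
    rw [map_add, map_smul]; abel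
  have h4 : ‖T • res u z‖ ≤ 2 * C := by
    rw [h3]
    exact (norm_sub_le _ _).trans (by linarith)
  rw [norm_smul, Real.norm_of_nonneg hT.le] at h4
  rw [le_div_iff₀ hT]; linarith

theorem Strip.limit_submodule (h : Strip c C ν u) {x : ℕ → Euc d} (hx : ∀ j, x j ∈ msupport ν)
    {T : ℕ → ℝ} (hT : ∀ j, 0 < T j) (hT' : Tendsto T ul atTop) {ρ : Measure (Euc d)}
    (hρ : Unif c n ρ) (hρ0 : 0 ∈ msupport ρ) (hl : LimitOf (fun j => resc n (x j) (T j) ν) ρ) :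
    msupport ρ = Submodule.span ℝ (range u) := by
  have h1 : ∀ y ∈ msupport ρ, res u y = 0 := by
    intro y hy
    obtain ⟨ys, hys, hlim⟩ := hl.approx y hy
    have h2 : Tendsto (fun j => 2 * C / T j) ul (𝓝 0) := hT'.const_div_atTop _
    have h3 : Tendsto (fun j => ‖res u (ys j)‖) ul (𝓝 ‖res u y‖) :=
      ((continuous_res.tendsto y).comp hlim).norm
    have h4 := le_of_tendsto_of_tendsto h3 h2
      (hys.mono fun j hj => h.norm_res_le_of_resc (hx j) (hT j) hj)
    exact norm_le_zero_iff.1 h4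
  ext y
  constructor
  · exact fun hy => (res_eq_zero_iff h.frame).1 (h1 y hy)
  · intro hy
    have h2 := hρ.full hρ0 h.frame (R := ‖cf u y‖ + 1) (fun y hy _ => h1 y hy)
      (v := cf u y) (by linarith)
    have h3 := (res_eq_zero_iff h.frame).2 hy
    rwa [← emb_cf_add_res (u := u) y, h3, add_zero]

theorem Strip.exists_near (h : Strip c C ν u) :
    ∃ R : ℝ, 0 < R ∧ ∀ v : Euc n, ∃ x ∈ msupport ν, ‖cf u x - v‖ ≤ R := by
  by_contra hcon
  push Not at hcon
  choose v hv using fun j : ℕ => hcon ((j : ℝ) + 1) (by positivity)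
  set A := cf u '' msupport ν with hA
  have hne : A.Nonempty := ⟨_, 0, h.zero, rfl⟩
  set ρ : ℕ → ℝ := fun j => infDist (v j) A with hρ
  have hρj : ∀ j : ℕ, (j : ℝ) + 1 ≤ ρ j := fun j => by
    refine (le_infDist hne).2 ?_
    rintro _ ⟨x, hx, rfl⟩
    rw [dist_comm, dist_eq_norm]
    exact (hv j x hx).le
  have hρ0 : ∀ j, 0 < ρ j := fun j => lt_of_lt_of_le (by positivity) (hρj j)
  have hρt : Tendsto ρ ul atTop :=
    tendsto_atTop_mono hρj tendsto_natCast_add_one_ul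
  have hex : ∀ j, ∃ x ∈ msupport ν, dist (v j) (cf u x) < 2 * ρ j := fun j => by
    obtain ⟨_, ⟨x, hx, rfl⟩, h2⟩ := (infDist_lt_iff hne).1
      (show infDist (v j) A < 2 * ρ j by have := hρ0 j; simp only [hρ] at this ⊢; linarith)
    exact ⟨x, hx, h2⟩
  choose x hx hxv using hex
  obtain ⟨μ', hμ', hμ0, hl⟩ := h.unif.exists_resc_limit hx hρ0
  have hS := h.limit_submodule hx hρ0 hρt hμ' hμ0 hl
  obtain ⟨w, hw⟩ := exists_ul_lim (x := fun j => (ρ j)⁻¹ • (v j - cf u (x j))) (x0 := 0) (C := 2)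
    (Eventually.of_forall fun j => by
      rw [dist_zero_right, norm_smul, Real.norm_of_nonneg (inv_pos.2 (hρ0 j)).le, ← dist_eq_norm,
        inv_mul_le_iff₀ (hρ0 j), mul_comm]
      exact (hxv j).le)
  have hmem : emb u w ∈ msupport μ' := by rw [hS]; exact emb_mem_span w
  obtain ⟨ys, hys, hlim⟩ := hl.exists_points hρ0 hmem
  have h5 : Tendsto (fun j => ‖(ρ j)⁻¹ • (v j - cf u (x j)) - cf u (ys j)‖) ul (𝓝 0) := by
    have := (hw.sub ((continuous_cf (u := u)).tendsto (emb u w) |>.comp hlim)).norm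
    rwa [cf_emb h.frame, sub_self, norm_zero] at this
  obtain ⟨j, hj, hj2⟩ := (hys.and (h5.eventually_lt_const one_pos)).exists
  have h6 : ρ j ≤ dist (v j) (cf u (x j + ρ j • ys j)) := infDist_le_dist_of_mem ⟨_, hj, rfl⟩
  have h7 : v j - cf u (x j + ρ j • ys j) =
      ρ j • ((ρ j)⁻¹ • (v j - cf u (x j)) - cf u (ys j)) := by
    rw [smul_sub, smul_inv_smul₀ (hρ0 j).ne', map_add, map_smul]; abel
  rw [dist_eq_norm, h7, norm_smul, Real.norm_of_nonneg (hρ0 j).le] at h6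
  nlinarith [hρ0 j]

theorem Unif.moment_at (h : Unif c n ν) {x x' : Euc d} (hx : x ∈ msupport ν)
    (hx' : x' ∈ msupport ν) (h0 : 0 ∈ msupport ν) {T : ℝ} (hT : 0 < T) (hT' : ‖x' - x‖ ≤ T) :
    |‖x' - x‖ ^ 2 * mG ν - 2 * (T * ⟪mB (resc n x T ν), x' - x⟫)
        - 2 * mQ (resc n x T ν) (x' - x)| ≤ 140 * (c * 2 ^ n) * (‖x' - x‖ ^ 3 / T) := by
  have h1 : Unif c n (resc n x 1 ν) := h.resc_unif one_pos
  have h10 : (0 : Euc d) ∈ msupport (resc n x 1 ν) := (zero_mem_msupport_resc one_pos).2 hx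
  have hy : x' - x ∈ msupport (resc n x 1 ν) := by
    rw [mem_msupport_resc one_pos]; simpa using hx'
  have := h1.moment h10 hT hy hT'
  rwa [resc_resc one_pos hT, smul_zero, add_zero, one_mul, h1.mG_eq h10 h h0] at this

theorem Strip.norm_res_mB_le (h : Strip c C ν u) {x : Euc d} (hx : x ∈ msupport ν) {T : ℝ}
    (hT : 0 < T) : T * ‖res u (mB (resc n x T ν))‖ ≤ 6 * C * c := by
  have h1 : Unif c n (resc n x T ν) := h.unif.resc_unif hT
  have h10 : (0 : Euc d) ∈ msupport (resc n x T ν) := (zero_mem_msupport_resc hT).2 hx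
  have := h1.isLocallyFinite h10
  set σ := resc n x T ν
  have hc := h.unif.pos
  have hC := h.nonneg
  have key : |⟪mB σ, res u (mB σ)⟫| ≤ 3 * (2 * C / T * ‖res u (mB σ)‖) * (c * 1 ^ n) := by
    rw [inner_mB, ← h1.measureReal h10 one_pos, ← Real.norm_eq_abs]
    have e : ∫ z, prof1 (‖z‖ ^ 2) * ⟪z, res u (mB σ)⟫ ∂σ =
        ∫ z, prof1 (‖z‖ ^ 2) * ⟪res u z, res u (mB σ)⟫ ∂σ := by
      refine integral_congr_ae (Eventually.of_forall fun z => ?_)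
      simp only
      conv_lhs => rw [← emb_cf_add_res (u := u) z, inner_add_left, inner_emb_res h.frame, zero_add]
      rw [emb_cf_add_res]
    rw [e, ← setIntegral_eq_integral_of_forall_compl_eq_zero (s := closedBall 0 1)]
    · refine (norm_setIntegral_le_of_norm_le_const_ae
        (isCompact_closedBall (0 : Euc d) 1).measure_lt_top
        (C := 3 * (2 * C / T * ‖res u (mB σ)‖)) ?_)
      refine ae_restrict_of_ae ?_
      filter_upwards [ae_mem_msupport σ] with z hz
      rw [norm_mul, Real.norm_of_nonneg (prof1_nonneg _)]
      refine mul_le_mul (prof1_le (sq_nonneg _)) ((norm_inner_le_norm _ _).trans ?_)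
        (norm_nonneg _) (by norm_num)
      exact mul_le_mul_of_nonneg_right (h.norm_res_le_of_resc hx hT hz) (norm_nonneg _)
    · intro z hz
      rw [prof1_eq_zero (one_le_sq_of_lt (by simpa using hz)), zero_mul]
  have e2 : ⟪mB σ, res u (mB σ)⟫ = ‖res u (mB σ)‖ ^ 2 := by
    conv_lhs => rw [← emb_cf_add_res (u := u) (mB σ), inner_add_left]
    rw [emb_cf_add_res, inner_emb_res h.frame, zero_add, real_inner_self_eq_norm_sq]
  rw [e2, abs_of_nonneg (sq_nonneg _), one_pow, mul_one] at key
  rcases (norm_nonneg (res u (mB σ))).eq_or_lt with h0 | h0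
  · rw [← h0, mul_zero]; positivity
  · have e3 : 3 * (2 * C / T * ‖res u (mB σ)‖) * c = (6 * C * c / T) * ‖res u (mB σ)‖ := by ring
    rw [e3, sq] at key
    have := le_of_mul_le_mul_right key h0
    rwa [le_div_iff₀ hT, mul_comm] at this

theorem mQ_eq_norm_cf (hν : Unif c n ν) (hu : Orthonormal ℝ u)
    (hS : msupport ν = Submodule.span ℝ (range u)) (y : Euc d) :
    mQ ν y = mG ν / 2 * ‖cf u y‖ ^ 2 := by
  rw [← norm_emb hu, ← mQ_eq_of_submodule hν hS (emb_mem_span (cf u y))]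
  refine integral_congr_ae ?_
  filter_upwards [ae_mem_msupport ν] with z hz
  rw [hS] at hz
  have h1 := (res_eq_zero_iff hu).2 hz
  have h2 : z = emb u (cf u z) := by
    conv_lhs => rw [← emb_cf_add_res (u := u) z, h1, add_zero]
  have h3 : ⟪z, y⟫ = ⟪z, emb u (cf u y)⟫ := by
    rw [h2, inner_emb, inner_emb_emb hu]
  rw [h3]

theorem Strip.tendsto_mB (h : Strip c C ν u) {x : ℕ → Euc d} (hx : ∀ j, x j ∈ msupport ν)
    {T : ℕ → ℝ} (hT : ∀ j, 0 < T j) (hT' : Tendsto T ul atTop) {ρ : Measure (Euc d)}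
    (hρ : Unif c n ρ) (hρ0 : 0 ∈ msupport ρ) (hl : LimitOf (fun j => resc n (x j) (T j) ν) ρ) :
    Tendsto (fun j => T j • cf u (mB (resc n (x j) (T j) ν))) ul (𝓝 0) := by
  obtain ⟨R, hR, hnear⟩ := h.exists_near
  have hS := h.limit_submodule hx hT hT' hρ hρ0 hl
  have hc := h.unif.pos
  have hC := h.nonneg
  set b : ℕ → Euc n := fun j => T j • cf u (mB (resc n (x j) (T j) ν)) with hb
  have key : ∀ L : ℝ, R < L → ∀ᶠ j in ul, 2 * (L - R) * ‖b j‖ ≤ 24 * C ^ 2 * c + 2 := by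
    intro L hL
    have hex : ∀ j, ∃ x' ∈ msupport ν, ‖cf u (x' - x j) + L • (‖b j‖⁻¹ • b j)‖ ≤ R := fun j => by
      obtain ⟨x', hx', hn⟩ := hnear (cf u (x j) - L • (‖b j‖⁻¹ • b j))
      refine ⟨x', hx', ?_⟩
      rw [map_sub]
      convert hn using 2
      abel
    choose x' hx' hxx using hex
    set Y : ℕ → Euc d := fun j => x' j - x j with hY
    have hunit : ∀ j, ‖L • (‖b j‖⁻¹ • b j)‖ ≤ L := fun j => by
      rw [norm_smul, norm_smul, norm_inv, norm_norm, Real.norm_of_nonneg (hR.trans hL).le]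
      have : ‖b j‖⁻¹ * ‖b j‖ ≤ 1 := inv_mul_le_one
      nlinarith
    have hYres : ∀ j, ‖res u (Y j)‖ ≤ 2 * C := fun j => by
      rw [hY]; simp only [map_sub]
      exact (norm_sub_le _ _).trans (by linarith [h.bound _ (hx' j), h.bound _ (hx j)])
    have hYn : ∀ j, ‖Y j‖ ≤ L + R + 2 * C := fun j => by
      refine (norm_le_cf_add_res h.frame _).trans (add_le_add ?_ (hYres j))
      have := norm_sub_le (cf u (Y j) + L • (‖b j‖⁻¹ • b j)) (L • (‖b j‖⁻¹ • b j))
      rw [add_sub_cancel_right] at this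
      linarith [hxx j, hunit j]
    obtain ⟨Y0, hY0⟩ := exists_ul_lim (x := Y) (x0 := 0) (C := L + R + 2 * C)
      (Eventually.of_forall fun j => by rw [dist_zero_right]; exact hYn j)
    have hQ := hl.mQ_tendsto (fun j => h.unif.resc_unif (hT j))
      (fun j => (zero_mem_msupport_resc (hT j)).2 (hx j)) hY0
    rw [mQ_eq_norm_cf hρ h.frame hS, hρ.mG_eq hρ0 h.unif h.zero] at hQ
    have hG := h.unif.mG_pos h.zero
    have hlim := ((hQ.const_mul 2).sub ((hY0.norm.pow 2).mul_const (mG ν)))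
    have hneg : 2 * (mG ν / 2 * ‖cf u Y0‖ ^ 2) - ‖Y0‖ ^ 2 * mG ν < 1 := by
      have := norm_sq_eq_cf_res h.frame Y0
      nlinarith [sq_nonneg ‖res u Y0‖]
    have herr : Tendsto (fun j => 140 * (c * 2 ^ n) * ((L + R + 2 * C) ^ 3 / T j)) ul (𝓝 0) := by
      simpa using (hT'.const_div_atTop ((L + R + 2 * C) ^ 3)).const_mul (140 * (c * 2 ^ n))
    filter_upwards [hlim.eventually_lt_const hneg, herr.eventually_lt_const one_pos,
      hT'.eventually_ge_atTop (L + R + 2 * C)] with j h1 h2 h3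
    have h4 := (abs_le.1 (h.unif.moment_at (hx j) (hx' j) h.zero (hT j)
      ((hYn j).trans h3))).2
    have h5 : 140 * (c * 2 ^ n) * (‖x' j - x j‖ ^ 3 / T j) ≤
        140 * (c * 2 ^ n) * ((L + R + 2 * C) ^ 3 / T j) := by
      refine mul_le_mul_of_nonneg_left (div_le_div_of_nonneg_right ?_ (hT j).le) (by positivity)
      exact pow_le_pow_left₀ (norm_nonneg _) (hYn j) 3
    have h6 : T j * ⟪mB (resc n (x j) (T j) ν), x' j - x j⟫ =
        ⟪b j, cf u (Y j)⟫ + T j * ⟪res u (mB (resc n (x j) (T j) ν)), res u (Y j)⟫ := by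
      set B := mB (resc n (x j) (T j) ν)
      change T j * ⟪B, Y j⟫ = ⟪T j • cf u B, cf u (Y j)⟫ + _
      rw [real_inner_smul_left, ← mul_add, ← inner_emb_emb h.frame]
      congr 1
      conv_lhs => rw [← emb_cf_add_res (u := u) B, ← emb_cf_add_res (u := u) (Y j)]
      have e0 : ⟪res u B, emb u (cf u (Y j))⟫ = 0 := by
        rw [real_inner_comm, inner_emb_res h.frame]
      rw [inner_add_left, inner_add_right, inner_add_right, inner_emb_res h.frame, e0]
      ring
    have h7 : T j * ⟪res u (mB (resc n (x j) (T j) ν)), res u (Y j)⟫ ≤ 6 * C * c * (2 * C) := by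
      refine (mul_le_mul_of_nonneg_left (real_inner_le_norm _ _) (hT j).le).trans ?_
      rw [← mul_assoc]
      exact mul_le_mul (h.norm_res_mB_le (hx j) (hT j)) (hYres j) (norm_nonneg _) (by positivity)
    have h8 : ⟪b j, cf u (Y j)⟫ ≤ R * ‖b j‖ - L * ‖b j‖ := by
      have e : cf u (Y j) = (cf u (Y j) + L • (‖b j‖⁻¹ • b j)) - L • (‖b j‖⁻¹ • b j) := by abel
      rw [e, inner_sub_right, real_inner_smul_right, real_inner_smul_right,
        real_inner_self_eq_norm_sq]
      have e2 : ‖b j‖⁻¹ * ‖b j‖ ^ 2 = ‖b j‖ := by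
        rcases eq_or_ne ‖b j‖ 0 with h0 | h0
        · rw [h0]; simp
        · field_simp
      rw [e2]
      have e3 := real_inner_le_norm (b j) (cf u (Y j) + L • (‖b j‖⁻¹ • b j))
      nlinarith [hxx j, norm_nonneg (b j)]
    have h9 := (abs_le.1 (h.unif.moment_at (hx j) (hx' j) h.zero (hT j)
      ((hYn j).trans h3))).1
    simp only [hY] at h1
    simp only [hY] at h6 h7 h8
    nlinarith
  rw [tendsto_zero_iff_norm_tendsto_zero, Metric.tendsto_nhds]
  intro ε hε
  have hM : 0 < 24 * C ^ 2 * c + 2 := by positivity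
  filter_upwards [key (R + (24 * C ^ 2 * c + 2) / ε) (by have := div_pos hM hε; linarith)]
    with j hj
  rw [dist_zero_right, norm_norm]
  have e : 2 * (R + (24 * C ^ 2 * c + 2) / ε - R) * ‖b j‖ =
      (24 * C ^ 2 * c + 2) * (2 * ‖b j‖ / ε) := by field_simp; ring
  rw [e] at hj
  have h1 : 2 * ‖b j‖ / ε ≤ 1 := by
    by_contra hcon
    push Not at hcon
    nlinarith
  rw [div_le_one hε] at h1
  linarith [norm_nonneg (b j)]

/-- The smoothed mass is stationary to second order at bounded distance of the support. -/
theorem Strip.tendsto_expansion (h : Strip c C ν u) {x : ℕ → Euc d} (hx : ∀ j, x j ∈ msupport ν)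
    {T : ℕ → ℝ} (hT : ∀ j, 0 < T j) (hT' : Tendsto T ul atTop) {R : ℝ} {w : ℕ → Euc n}
    (hw : ∀ j, ‖w j‖ ≤ R) :
    Tendsto (fun j => T j ^ 2 * (∫ z, prof (‖z + emb u ((T j)⁻¹ • w j)‖ ^ 2)
      ∂(resc n (x j) (T j) ν) - ∫ z, prof (‖z‖ ^ 2) ∂ν)) ul (𝓝 0) := by
  obtain ⟨ρ, hρ, hρ0, hl⟩ := h.unif.exists_resc_limit hx hT
  have hS := h.limit_submodule hx hT hT' hρ hρ0 hl
  have hb := h.tendsto_mB hx hT hT' hρ hρ0 hl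
  have hc := h.unif.pos
  have hu1 : ∀ j, Unif c n (resc n (x j) (T j) ν) := fun j => h.unif.resc_unif (hT j)
  have hz1 : ∀ j, (0 : Euc d) ∈ msupport (resc n (x j) (T j) ν) :=
    fun j => (zero_mem_msupport_resc (hT j)).2 (hx j)
  obtain ⟨w0, hw0⟩ := exists_ul_lim (x := w) (x0 := 0) (C := R)
    (Eventually.of_forall fun j => by rw [dist_zero_right]; exact hw j)
  have hR : 0 ≤ R := (norm_nonneg _).trans (hw 0)
  have hQ := hl.mQ_tendsto hu1 hz1 ((continuous_emb (u := u)).tendsto w0 |>.comp hw0)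
  rw [mQ_eq_norm_cf hρ h.frame hS, hρ.mG_eq hρ0 h.unif h.zero, cf_emb h.frame] at hQ
  simp only [Function.comp_def] at hQ
  have hin : Tendsto (fun j => ⟪T j • cf u (mB (resc n (x j) (T j) ν)), w j⟫) ul (𝓝 0) := by
    simpa using hb.inner hw0
  have hmain : Tendsto (fun j => 2 * mQ (resc n (x j) (T j) ν) (emb u (w j)) -
      (‖w j‖ ^ 2 * mG ν + 2 * ⟪T j • cf u (mB (resc n (x j) (T j) ν)), w j⟫)) ul (𝓝 0) := by
    have := (hQ.const_mul 2).sub (((hw0.norm.pow 2).mul_const (mG ν)).add (hin.const_mul 2))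
    convert this using 2
    ring
  have herr : Tendsto (fun j => 140 * R ^ 3 * (c * 2 ^ n) / T j) ul (𝓝 0) :=
    hT'.const_div_atTop _
  have hdiff : Tendsto (fun j => T j ^ 2 * (∫ z, prof (‖z + emb u ((T j)⁻¹ • w j)‖ ^ 2)
      ∂(resc n (x j) (T j) ν) - ∫ z, prof (‖z‖ ^ 2) ∂ν) -
      (2 * mQ (resc n (x j) (T j) ν) (emb u (w j)) -
      (‖w j‖ ^ 2 * mG ν + 2 * ⟪T j • cf u (mB (resc n (x j) (T j) ν)), w j⟫))) ul (𝓝 0) := by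
    refine squeeze_zero_norm' ?_ herr
    filter_upwards [hT'.eventually_ge_atTop R] with j hj
    have hTj := hT j
    have := (hu1 j).isLocallyFinite (hz1 j)
    set σ := resc n (x j) (T j) ν
    have hn1 : ‖(T j)⁻¹ • emb u (w j)‖ = ‖w j‖ / T j := by
      rw [norm_smul, norm_emb h.frame, norm_inv, Real.norm_of_nonneg hTj.le]; ring
    have h1 := moment_expansion (ν := σ) (y := -((T j)⁻¹ • emb u (w j))) (by
      rw [norm_neg, hn1, div_le_one hTj]; exact (hw j).trans hj)
    simp only [sub_neg_eq_add, norm_neg, inner_neg_right] at h1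
    rw [hn1, (hu1 j).measureReal (hz1 j) two_pos, (hu1 j).mG_eq (hz1 j) h.unif h.zero,
      (hu1 j).radial (hz1 j) h.unif h.zero (g := fun s => prof (s ^ 2))
        (by have := continuous_prof; fun_prop)] at h1
    have hq : mQ σ (-((T j)⁻¹ • emb u (w j))) = ((T j)⁻¹) ^ 2 * mQ σ (emb u (w j)) := by
      rw [← mQ_smul, ← neg_one_smul ℝ, mQ_smul]; ring
    have hi : ⟪mB σ, (T j)⁻¹ • emb u (w j)⟫ = (T j)⁻¹ ^ 2 * ⟪T j • cf u (mB σ), w j⟫ := by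
      rw [real_inner_smul_right, real_inner_comm, inner_emb, real_inner_smul_left,
        real_inner_comm]
      field_simp
    rw [hq, hi] at h1
    rw [Real.norm_eq_abs]
    rw [map_smul]
    have e : ∀ J I Q B G : ℝ, T j ^ 2 * (J - I) - (2 * Q - (‖w j‖ ^ 2 * G + 2 * B)) =
        T j ^ 2 * (J - I + ((‖w j‖ / T j) ^ 2 * G - 2 * -((T j)⁻¹ ^ 2 * B)) -
          2 * ((T j)⁻¹ ^ 2 * Q)) := by
      intro J I Q B G; field_simp; ring
    rw [e, abs_mul, abs_of_nonneg (sq_nonneg _)]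
    refine (mul_le_mul_of_nonneg_left h1 (sq_nonneg _)).trans ?_
    have e2 : T j ^ 2 * (140 * (‖w j‖ / T j) ^ 3 * (c * 2 ^ n)) =
        140 * ‖w j‖ ^ 3 * (c * 2 ^ n) / T j := by field_simp
    rw [e2]
    gcongr
    exact hw j
  simpa using hdiff.add hmain

end

section

variable {d n : ℕ} {ν : Measure (Euc d)} {c C : ℝ} {u : Fin n → Euc d}

/-- If near every point of the support there is another one at a definite height, then the points
of definite height carry a definite proportion of the mass. -/
theorem Unif.mass_of_height_le (h : Unif c n ν) (h0 : 0 ∈ msupport ν) (hu : Orthonormal ℝ u)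
    {ρ e : ℝ} (he : 0 < e) (hρ : 0 < ρ) (hρe : ρ + e / 4 ≤ 1 / 8)
    (hS : ∀ w ∈ msupport ν, ∃ z ∈ msupport ν, dist z w < ρ ∧ e < ‖res u (z - w)‖) :
    c * (e / 4) ^ n * (1 / 8) ^ n ≤
      (ρ + e / 4) ^ n * ν.real {z | z ∈ closedBall 0 (1 / 4) ∧ e / 4 ≤ ‖res u z‖} := by
  have := h.isLocallyFinite h0
  have hc := h.pos
  set r := ρ + e / 4 with hr
  have hr0 : 0 < r := by positivity
  set E := {z : Euc d | z ∈ closedBall 0 (1 / 4) ∧ e / 4 ≤ ‖res u z‖} with hE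
  set A := closedBall (0 : Euc d) (1 / 8) with hA
  have hEm : MeasurableSet E := (isClosed_closedBall.inter
    (isClosed_le continuous_const continuous_res.norm)).measurableSet
  have hAm : MeasurableSet A := isClosed_closedBall.measurableSet
  set D := {p : Euc d × Euc d | dist p.2 p.1 ≤ r} with hD
  have hDm : MeasurableSet D :=
    (isClosed_le (by fun_prop : Continuous fun p : Euc d × Euc d => dist p.2 p.1)
      continuous_const).measurableSet
  have hEfin : ν E ≠ ⊤ :=
    ((measure_mono fun z hz => hz.1).trans_lt
      (isCompact_closedBall (0 : Euc d) (1 / 4)).measure_lt_top).ne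
  have hlow : ENNReal.ofReal (c * (e / 4) ^ n) * ν A ≤ ((ν.restrict A).prod (ν.restrict E)) D := by
    rw [Measure.prod_apply hDm, ← setLIntegral_const]
    refine setLIntegral_mono_ae' hAm ?_
    filter_upwards [ae_mem_msupport ν] with w hw hwA
    have hz : ∃ z ∈ msupport ν, dist z w < ρ ∧ e / 2 ≤ ‖res u z‖ := by
      by_cases hw2 : e / 2 ≤ ‖res u w‖
      · exact ⟨w, hw, by simpa using hρ, hw2⟩
      · obtain ⟨z, hz, hz1, hz2⟩ := hS w hw
        refine ⟨z, hz, hz1, ?_⟩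
        rw [map_sub] at hz2
        have := norm_sub_le (res u z) (res u w)
        push Not at hw2
        linarith
    obtain ⟨z, hz, hz1, hz2⟩ := hz
    rw [← h.2 z hz (e / 4) (by positivity), Measure.restrict_apply (measurable_prodMk_left hDm)]
    refine measure_mono fun y hy => ?_
    rw [mem_closedBall] at hy
    have hyw : dist y w ≤ r := (dist_triangle y z w).trans (by linarith)
    refine ⟨hyw, ?_, ?_⟩
    · rw [hA, mem_closedBall] at hwA
      rw [mem_closedBall]
      exact (dist_triangle y w 0).trans (by linarith)
    · have h1 : ‖res u (z - y)‖ ≤ e / 4 :=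
        (norm_res_le hu _).trans (by rwa [← dist_eq_norm, dist_comm])
      rw [map_sub] at h1
      have := norm_sub_norm_le (res u z) (res u y)
      linarith
  have hup : ((ν.restrict A).prod (ν.restrict E)) D ≤ ENNReal.ofReal (c * r ^ n) * ν E := by
    rw [Measure.prod_apply_symm hDm, ← setLIntegral_const]
    refine setLIntegral_mono_ae' hEm ?_
    filter_upwards [ae_mem_msupport ν] with y hy _
    rw [← h.2 y hy r hr0]
    refine (Measure.restrict_apply_le _ _).trans (measure_mono fun w hw => ?_)
    rw [mem_closedBall, dist_comm]
    exact hw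
  have hfin := hlow.trans hup
  rw [h.2 0 h0 (1 / 8) (by norm_num), ← ofReal_measureReal hEfin,
    ← ENNReal.ofReal_mul (by positivity), ← ENNReal.ofReal_mul (by positivity),
    ENNReal.ofReal_le_ofReal_iff (by positivity)] at hfin
  refine le_of_mul_le_mul_left ?_ hc
  linarith

theorem Strip.excess (h : Strip c C ν u) {ε R : ℝ} (hε : 0 < ε) (hR : 0 < R)
    (hS : ∀ x ∈ msupport ν, ∃ z ∈ msupport ν, dist z x < R ∧ ε < ‖res u (z - x)‖) :
    ∃ δ : ℝ, 0 < δ ∧ ∃ T₁ : ℝ, ∀ x ∈ msupport ν, ∀ T : ℝ, 0 < T → T₁ ≤ T →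
      δ ≤ T ^ 2 * ∫ z in closedBall 0 (1 / 4), ‖res u z‖ ^ 2 ∂(resc n x T ν) := by
  have hc := h.unif.pos
  refine ⟨(ε / 4) ^ 2 * (c * (ε / 4) ^ n * (1 / 8) ^ n / (R + ε / 4) ^ n), by positivity,
    8 * (R + ε / 4), fun x hx T hT hT1 => ?_⟩
  have h1 : Unif c n (resc n x T ν) := h.unif.resc_unif hT
  have h10 : (0 : Euc d) ∈ msupport (resc n x T ν) := (zero_mem_msupport_resc hT).2 hx
  have := h1.isLocallyFinite h10
  have hmass := h1.mass_of_height_le h10 h.frame (ρ := R / T) (e := ε / T) (by positivity)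
    (by positivity) (by
      rw [div_div, mul_comm T 4, ← div_div, ← add_div, div_le_iff₀ hT]; linarith) (by
      intro w hw
      obtain ⟨z, hz, hz1, hz2⟩ := hS _ ((mem_msupport_resc hT).1 hw)
      refine ⟨T⁻¹ • (z - x), (sub_mem_msupport_resc hT).2 hz, ?_, ?_⟩
      all_goals
        have e : T⁻¹ • (z - x) - w = T⁻¹ • (z - (x + T • w)) := by
          rw [← sub_sub, smul_sub T⁻¹ (z - x), inv_smul_smul₀ hT.ne']
      · rw [dist_eq_norm, e, norm_smul, norm_inv, Real.norm_of_nonneg hT.le, ← dist_eq_norm,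
          inv_mul_lt_iff₀ hT, mul_div_cancel₀ _ hT.ne']
        exact hz1
      · rw [e, map_smul, norm_smul, norm_inv, Real.norm_of_nonneg hT.le, ← div_eq_inv_mul]
        gcongr)
  set σ := resc n x T ν
  set E := {z : Euc d | z ∈ closedBall 0 (1 / 4) ∧ ε / T / 4 ≤ ‖res u z‖} with hE
  have hEm : MeasurableSet E := (isClosed_closedBall.inter
    (isClosed_le continuous_const continuous_res.norm)).measurableSet
  have hint : IntegrableOn (fun z : Euc d => ‖res u z‖ ^ 2) (closedBall 0 (1 / 4)) σ :=
    (continuous_res.norm.pow 2).continuousOn.integrableOn_compact (isCompact_closedBall _ _)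
  have h2 : (ε / T / 4) ^ 2 * σ.real E ≤ ∫ z in closedBall 0 (1 / 4), ‖res u z‖ ^ 2 ∂σ := by
    refine le_trans ?_ (setIntegral_mono_set hint (Eventually.of_forall fun z => sq_nonneg _)
      (Eventually.of_forall fun z (hz : z ∈ E) => hz.1))
    rw [mul_comm, ← smul_eq_mul, ← setIntegral_const]
    refine setIntegral_mono_on (integrableOn_const ?_) (hint.mono_set fun z hz => hz.1) hEm
      fun z hz => pow_le_pow_left₀ (by positivity) hz.2 2
    exact ((measure_mono fun z (hz : z ∈ E) => hz.1).trans_lt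
      (isCompact_closedBall (0 : Euc d) (1 / 4)).measure_lt_top).ne
  have h3 : c * (ε / 4) ^ n * (1 / 8) ^ n / (R + ε / 4) ^ n ≤ σ.real E := by
    rw [div_le_iff₀ (by positivity), mul_comm (σ.real E)]
    have e1 : ε / T / 4 = ε / 4 / T := by ring
    have e2 : R / T + ε / T / 4 = (R + ε / 4) / T := by ring
    rw [e2, e1, div_pow, div_pow (R + ε / 4)] at hmass
    have hTn : 0 < T ^ n := by positivity
    have e3 : c * ((ε / 4) ^ n / T ^ n) * (1 / 8) ^ n = c * (ε / 4) ^ n * (1 / 8) ^ n / T ^ n := by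
      ring
    rw [e3, div_mul_eq_mul_div, div_le_div_iff_of_pos_right hTn] at hmass
    exact hmass
  calc (ε / 4) ^ 2 * (c * (ε / 4) ^ n * (1 / 8) ^ n / (R + ε / 4) ^ n)
      ≤ (ε / 4) ^ 2 * σ.real E := by gcongr
    _ = T ^ 2 * ((ε / T / 4) ^ 2 * σ.real E) := by field_simp
    _ ≤ _ := by gcongr

theorem Strip.mass_gain (h : Strip c C ν u) {δ : ℝ} (hδ : 0 < δ) (R T₁ : ℝ)
    (hex : ∀ x ∈ msupport ν, ∀ T : ℝ, 0 < T → T₁ ≤ T →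
      δ ≤ T ^ 2 * ∫ z in closedBall 0 (1 / 4), ‖res u z‖ ^ 2 ∂(resc n x T ν)) :
    ∃ T : ℝ, 0 < T ∧ ∀ x ∈ msupport ν, ∀ w : Euc n, ‖w‖ ≤ R →
      ENNReal.ofReal (∫ z, prof (‖z‖ ^ 2) ∂ν + δ / (2 * T ^ 2)) ≤
        ∫⁻ z, ENNReal.ofReal (prof (‖cf u z + T⁻¹ • w‖ ^ 2)) ∂(resc n x T ν) := by
  by_contra hcon
  push Not at hcon
  have hT : ∀ j : ℕ, (0 : ℝ) < (j : ℝ) + 1 := fun j => by positivity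
  choose x hx w hw hlt using fun j : ℕ => hcon ((j : ℝ) + 1) (hT j)
  have hlim := h.tendsto_expansion hx hT tendsto_natCast_add_one_ul hw
  obtain ⟨j, h1, h2, h3⟩ := ((hlim.eventually_const_lt (show -(δ / 2) < 0 by linarith)).and
    ((tendsto_natCast_add_one_ul.eventually_ge_atTop T₁).and
      (tendsto_natCast_add_one_ul.eventually_ge_atTop (4 * R)))).exists
  refine (hlt j).not_ge ?_
  have hex' := hex (x j) (hx j) _ (hT j) h2
  have hTj := hT j
  set T : ℝ := (j : ℝ) + 1
  have hu1 : Unif c n (resc n (x j) T ν) := h.unif.resc_unif hTj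
  have := hu1.isLocallyFinite ((zero_mem_msupport_resc hTj).2 (hx j))
  set σ := resc n (x j) T ν
  set a : Euc n := T⁻¹ • w j with ha
  have han : ‖a‖ ≤ 1 / 4 := by
    rw [ha, norm_smul, norm_inv, Real.norm_of_nonneg hTj.le, inv_mul_le_iff₀ hTj]
    linarith [hw j]
  have hzero : ∀ z : Euc d, 2 < ‖z‖ → 1 ≤ ‖z + emb u a‖ ^ 2 := fun z hz => one_le_sq_of_lt (by
    have := norm_sub_le (z + emb u a) (emb u a)
    rw [add_sub_cancel_right, norm_emb h.frame] at this
    linarith)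
  have hc0 := continuous_prof
  have hc1 := continuous_prof1
  have hcr := continuous_res (u := u)
  have hi0 : Integrable (fun z => prof (‖z + emb u a‖ ^ 2)) σ :=
    Continuous.integrable_of_eq_zero (by fun_prop) 2 fun z hz => prof_eq_zero (hzero z hz)
  have hi1 : Integrable (fun z => prof1 (‖z + emb u a‖ ^ 2) * ‖res u z‖ ^ 2) σ :=
    Continuous.integrable_of_eq_zero (by fun_prop) 2 fun z hz => by
      rw [prof1_eq_zero (hzero z hz), zero_mul]
  have hge : ∫ z in closedBall 0 (1 / 4), ‖res u z‖ ^ 2 ∂σ ≤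
      ∫ z, prof1 (‖z + emb u a‖ ^ 2) * ‖res u z‖ ^ 2 ∂σ := by
    refine le_trans ?_ (setIntegral_le_integral (s := closedBall 0 (1 / 4)) hi1
      (Eventually.of_forall fun z => mul_nonneg (prof1_nonneg _) (sq_nonneg _)))
    refine setIntegral_mono_on ((hcr.norm.pow 2).continuousOn.integrableOn_compact
      (isCompact_closedBall _ _)) hi1.integrableOn isClosed_closedBall.measurableSet fun z hz => ?_
    have h4 : ‖z + emb u a‖ ≤ 1 / 2 := by
      refine (norm_add_le _ _).trans ?_
      rw [norm_emb h.frame]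
      rw [mem_closedBall, dist_zero_right] at hz
      linarith
    have h5 : 1 ≤ prof1 (‖z + emb u a‖ ^ 2) := by
      have : 3 / 4 ≤ max (1 - ‖z + emb u a‖ ^ 2) 0 :=
        le_max_of_le_left (by nlinarith [norm_nonneg (z + emb u a)])
      unfold prof1; nlinarith
    nlinarith [sq_nonneg ‖res u z‖]
  have hsum : ∫ z, prof (‖z‖ ^ 2) ∂ν + δ / (2 * T ^ 2) ≤
      ∫ z, (prof (‖z + emb u a‖ ^ 2) + prof1 (‖z + emb u a‖ ^ 2) * ‖res u z‖ ^ 2) ∂σ := by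
    rw [integral_add hi0 hi1]
    have hT2 : 0 < T ^ 2 := by positivity
    have e1 : δ / T ^ 2 ≤ ∫ z in closedBall 0 (1 / 4), ‖res u z‖ ^ 2 ∂σ := by
      rw [div_le_iff₀ hT2]; linarith
    have e2 : -(δ / 2) / T ^ 2 < ∫ z, prof (‖z + emb u a‖ ^ 2) ∂σ - ∫ z, prof (‖z‖ ^ 2) ∂ν := by
      rw [div_lt_iff₀ hT2]; linarith
    have e3 : δ / (2 * T ^ 2) = -(δ / 2) / T ^ 2 + δ / T ^ 2 := by field_simp; ring
    linarith
  refine (ENNReal.ofReal_le_ofReal hsum).trans ?_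
  have hi2 : Integrable (fun z => prof (‖z + emb u a‖ ^ 2) +
      prof1 (‖z + emb u a‖ ^ 2) * ‖res u z‖ ^ 2) σ := hi0.add hi1
  rw [ofReal_integral_eq_lintegral_ofReal hi2 (Eventually.of_forall fun z =>
    add_nonneg (prof_nonneg _) (mul_nonneg (prof1_nonneg _) (sq_nonneg _)))]
  refine lintegral_mono fun z => ENNReal.ofReal_le_ofReal ?_
  have e : ‖cf u z + a‖ ^ 2 = ‖z + emb u a‖ ^ 2 - ‖res u z‖ ^ 2 := by
    rw [norm_sq_eq_cf_res h.frame (z + emb u a), map_add, map_add, cf_emb h.frame,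
      res_emb h.frame, add_zero]; ring
  rw [e]
  exact prof_convex _ _

theorem lintegral_prof_stdv (h : Unif c n ν) (h0 : 0 ∈ msupport ν) (p : Euc n) {T : ℝ}
    (hT : 0 < T) : ∫⁻ v, ENNReal.ofReal (prof (‖T⁻¹ • (p - v)‖ ^ 2)) ∂(stdv c n) =
      ENNReal.ofReal (T ^ n * ∫ z, prof (‖z‖ ^ 2) ∂ν) := by
  have hs := unif_stdv (n := n) h.pos
  have hp : p ∈ msupport (stdv c n) := by rw [msupport_stdv h.pos]; trivial
  have hs1 : Unif c n (resc n p T (stdv c n)) := hs.resc_unif hT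
  have h10 : (0 : Euc n) ∈ msupport (resc n p T (stdv c n)) := (zero_mem_msupport_resc hT).2 hp
  have := hs.isLocallyFinite hp
  have hc0 := continuous_prof
  have hr := h.radial h0 hs1 h10 (g := fun s => prof (s ^ 2)) (by fun_prop)
  rw [integral_resc hT, smul_eq_mul] at hr
  rw [hr, mul_inv_cancel_left₀ (by positivity), ofReal_integral_eq_lintegral_ofReal]
  · refine lintegral_congr fun v => ?_
    rw [← neg_sub, smul_neg, norm_neg]
  · refine Continuous.integrable_of_eq_zero (by fun_prop) (‖p‖ + T) fun z hz => prof_eq_zero ?_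
    refine one_le_sq_of_lt ?_
    rw [norm_smul, norm_inv, Real.norm_of_nonneg hT.le, lt_inv_mul_iff₀ hT, mul_one]
    linarith [norm_sub_norm_le z p]
  · exact Eventually.of_forall fun _ => prof_nonneg _

theorem Strip.no_mass_gain (h : Strip c C ν u) {T δ : ℝ} (hT : 0 < T) (hδ : 0 < δ)
    (hv : ∀ v : Euc n, ENNReal.ofReal (T ^ n * (∫ z, prof (‖z‖ ^ 2) ∂ν + δ)) ≤
      ∫⁻ z, ENNReal.ofReal (prof (‖T⁻¹ • (cf u z - v)‖ ^ 2)) ∂ν) : False := by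
  have hc := h.unif.pos
  have hC := h.nonneg
  have hs := unif_stdv (n := n) hc
  have hs0 : (0 : Euc n) ∈ msupport (stdv c n) := by rw [msupport_stdv hc]; trivial
  have := hs.isLocallyFinite hs0
  have := h.unif.isLocallyFinite h.zero
  have hc0 := continuous_prof
  have hccf := continuous_cf (u := u)
  set I := ∫ z, prof (‖z‖ ^ 2) ∂ν with hI
  have hI0 : 0 ≤ I := integral_nonneg fun _ => prof_nonneg _
  have key : ∀ L : ℝ, 0 < L → L ^ n * (I + δ) ≤ (L + T + C) ^ n * I := by
    intro L hL
    have hmeas : AEMeasurable (Function.uncurry fun (v : Euc n) (z : Euc d) =>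
        ENNReal.ofReal (prof (‖T⁻¹ • (cf u z - v)‖ ^ 2)))
        (((stdv c n).restrict (closedBall 0 L)).prod ν) := by
      refine (ENNReal.measurable_ofReal.comp (Continuous.measurable ?_)).aemeasurable
      fun_prop
    have h1 : ENNReal.ofReal (T ^ n * (I + δ)) * ENNReal.ofReal (c * L ^ n) ≤
        ∫⁻ v in closedBall 0 L, ∫⁻ z, ENNReal.ofReal (prof (‖T⁻¹ • (cf u z - v)‖ ^ 2)) ∂ν
          ∂(stdv c n) := by
      rw [← stdv_closedBall hc 0 hL.le, ← setLIntegral_const]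
      exact lintegral_mono fun v => hv v
    rw [lintegral_lintegral_swap hmeas] at h1
    have h2 : ∫⁻ z, ∫⁻ v in closedBall 0 L, ENNReal.ofReal (prof (‖T⁻¹ • (cf u z - v)‖ ^ 2))
        ∂(stdv c n) ∂ν ≤
        ∫⁻ z in closedBall (0 : Euc d) (L + T + C), ENNReal.ofReal (T ^ n * I) ∂ν := by
      rw [← lintegral_indicator isClosed_closedBall.measurableSet]
      refine lintegral_mono_ae ?_
      filter_upwards [ae_mem_msupport ν] with z hz
      by_cases hzL : z ∈ closedBall (0 : Euc d) (L + T + C)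
      · rw [indicator_of_mem hzL, ← lintegral_prof_stdv h.unif h.zero (cf u z) hT]
        exact setLIntegral_le_lintegral _ _
      · rw [indicator_of_notMem hzL]
        refine le_of_eq ?_
        rw [setLIntegral_congr_fun (g := fun _ => 0) isClosed_closedBall.measurableSet,
          lintegral_zero]
        intro v hvL
        simp only
        rw [prof_eq_zero, ENNReal.ofReal_zero]
        refine one_le_sq_of_lt ?_
        rw [norm_smul, norm_inv, Real.norm_of_nonneg hT.le, lt_inv_mul_iff₀ hT, mul_one]
        rw [mem_closedBall, dist_zero_right] at hvL hzL
        have h3 := norm_le_cf_add_res h.frame z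
        have h4 := h.bound z hz
        have h5 := norm_sub_norm_le (cf u z) v
        linarith
    rw [setLIntegral_const, h.unif.2 0 h.zero _ (by positivity)] at h2
    have h3 := h1.trans h2
    rw [← ENNReal.ofReal_mul (by positivity), ← ENNReal.ofReal_mul (by positivity),
      ENNReal.ofReal_le_ofReal_iff (by positivity)] at h3
    have hTn : 0 < T ^ n * c := by positivity
    refine le_of_mul_le_mul_left ?_ hTn
    linarith
  have hlim : Tendsto (fun L : ℝ => (1 + (T + C) / L) ^ n * I) atTop (𝓝 ((1 + 0) ^ n * I)) :=
    (((tendsto_id.const_div_atTop (T + C)).const_add 1).pow n).mul_const I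
  have hle := le_of_tendsto_of_tendsto (tendsto_const_nhds (x := I + δ)) hlim (by
    filter_upwards [eventually_gt_atTop 0] with L hL
    have h1 := key L hL
    have e : (1 + (T + C) / L) ^ n * I = (L + T + C) ^ n * I / L ^ n := by
      rw [show 1 + (T + C) / L = (L + T + C) / L by field_simp; ring, div_pow]; ring
    rw [e, le_div_iff₀ (by positivity)]
    linarith)
  rw [add_zero, one_pow, one_mul] at hle
  linarith

/-- Uniform measures close to a plane have arbitrarily flat large pieces. -/
theorem Strip.exists_thin (h : Strip c C ν u) {ε R : ℝ} (hε : 0 < ε) (hR : 0 < R) :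
    ∃ x ∈ msupport ν, ∀ z ∈ msupport ν, dist z x < R → ‖res u (z - x)‖ ≤ ε := by
  by_contra hcon
  push Not at hcon
  obtain ⟨δ, hδ, T₁, hex⟩ := h.excess hε hR hcon
  obtain ⟨R₀, hR₀, hnear⟩ := h.exists_near
  obtain ⟨T, hT, hgain⟩ := h.mass_gain hδ R₀ T₁ hex
  refine h.no_mass_gain hT (δ := δ / (2 * T ^ 2)) (by positivity) fun v => ?_
  obtain ⟨x, hx, hxv⟩ := hnear v
  have h1 := hgain x hx (cf u x - v) hxv
  rw [resc, lintegral_smul_measure, (measurableEmbedding_resc x hT).lintegral_map] at h1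
  rw [ENNReal.ofReal_mul (by positivity)]
  have hTn : 0 < T ^ n := by positivity
  refine (mul_le_mul_right h1 _).trans (le_of_eq ?_)
  rw [smul_eq_mul, ← mul_assoc, ← ENNReal.ofReal_mul hTn.le, mul_inv_cancel₀ hTn.ne',
    ENNReal.ofReal_one, one_mul]
  refine lintegral_congr fun z => ?_
  rw [map_smul, map_sub, ← smul_add, sub_add_sub_cancel]

end

section

variable {d n : ℕ} {ν : Measure (Euc d)} {c C : ℝ} {u : Fin n → Euc d}

theorem Strip.exists_flat_center (h : Strip c C ν u) {θ : ℝ} (hθ : 0 < θ) :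
    ∃ x ∈ msupport ν, ∀ t : ℝ, 1 / 2 ≤ t → FlatA n (msupport ν) x t (θ * t) := by
  have hC := h.nonneg
  obtain ⟨x, hx, hthin⟩ := h.exists_thin (ε := θ / 2) (R := 2 * C / θ + 1) (by positivity)
    (by positivity)
  refine ⟨x, hx, fun t ht => ⟨u, h.frame, fun y hy hyt => ?_⟩⟩
  by_cases hyR : dist y x < 2 * C / θ + 1
  · exact (hthin y hy hyR).trans (by nlinarith)
  · push Not at hyR
    have h1 : ‖res u (y - x)‖ ≤ 2 * C := by
      rw [map_sub]
      exact (norm_sub_le _ _).trans (by linarith [h.bound y hy, h.bound x hx])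
    have h2 : 2 * C / θ ≤ t := by linarith
    rw [div_le_iff₀ hθ] at h2
    linarith

variable {μ : Measure (Euc d)} {f : ℝ → ℝ}

/-- From flatness at an intermediate range of scales one gets, near a point nearby, better flatness
one scale below. -/
theorem UD.exists_flatter (h : UD μ f) (hc : 0 < c)
    (hf : Tendsto (fun r => f r / r ^ n) (𝓝[>] 0) (𝓝 c)) :
    ∃ η₀ > 0, ∀ η, 0 < η → η ≤ η₀ → ∀ G : ℕ → ℝ, ∃ Λ : ℝ, 1 ≤ Λ ∧ ∃ M : ℝ, 1 ≤ M ∧ ∃ ε > 0,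
      ∀ x ∈ msupport μ, ∀ r, 0 < r → Λ * r ≤ ε →
        (∀ t, r ≤ t → t ≤ Λ * r → FlatA n (msupport μ) x t (2 * η * t)) →
        ∃ D : ℕ, 1 ≤ D ∧ (D : ℝ) ≤ M ∧ ∃ x' ∈ msupport μ, dist x' x ≤ D * r ∧
          ∀ t, r / 2 ≤ t → t ≤ G D * r → FlatA n (msupport μ) x' t (η * t) := by
  obtain ⟨η₀, hη₀, HE⟩ := exists_frame_of_flat d n c
  refine ⟨η₀, hη₀, fun η hη hηη₀ G => ?_⟩
  by_contra hcon
  push Not at hcon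
  have hT : ∀ j : ℕ, (0 : ℝ) < (j : ℝ) + 1 := fun j => by positivity
  have hT1 : ∀ j : ℕ, (1 : ℝ) ≤ (j : ℝ) + 1 := fun j => by simp
  choose x hx r hr hrε hflat hno using fun j : ℕ =>
    hcon ((j : ℝ) + 1) (hT1 j) ((j : ℝ) + 1) (hT1 j) (((j : ℝ) + 1)⁻¹) (inv_pos.2 (hT j))
  have hr0 : Tendsto r ul (𝓝 0) := by
    refine squeeze_zero (fun j => (hr j).le) (fun j => ?_) tendsto_inv_natCast_add_one_ul
    have h1 := hr j
    have h2 := hT1 j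
    nlinarith [hrε j]
  obtain ⟨ρ, hρ, hρ0, hl⟩ := h.exists_blowup hc hf hx hr hr0
  have hρflat : ∀ t, 1 ≤ t → FlatA n (msupport ρ) 0 t (2 * η₀ * t) := by
    intro t ht
    refine (hl.flatA (n := n) (xs := fun _ => 0) (t := t) tendsto_const_nhds
      (as := fun _ => 2 * η * t) tendsto_const_nhds ?_).mono le_rfl (by gcongr)
    filter_upwards [tendsto_natCast_add_one_ul.eventually_ge_atTop t] with j hj
    rw [flatA_resc_iff (hr j), smul_zero, add_zero]
    have h1 := hr j
    have := hflat j (r j * t) (by nlinarith) (by nlinarith)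
    convert this using 1
    ring
  obtain ⟨u, hu, C, hC, hb⟩ := HE ρ hρ hρ0 hρflat
  have hstrip : Strip c C ρ u := ⟨hρ, hρ0, hu, hC, hb⟩
  obtain ⟨x', hx', hcen⟩ := hstrip.exists_flat_center (θ := η / 6) (by positivity)
  set D : ℕ := ⌈‖x'‖⌉₊ + 1 with hD
  have hDx : ‖x'‖ < D := by
    rw [hD]; push_cast
    linarith [Nat.le_ceil ‖x'‖]
  obtain ⟨ys, hys, hyl⟩ := hl.approx x' hx'
  have hev : ∀ᶠ j in ul, ∃ τ : ℝ, (1 / 2 ≤ τ ∧ τ ≤ G D) ∧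
      ¬ FlatA n (msupport (_root_.resc n (x j) (r j) μ)) (ys j) τ (η * τ) := by
    filter_upwards [hys, hyl.norm.eventually_lt_const hDx,
      tendsto_natCast_add_one_ul.eventually_ge_atTop (D : ℝ)] with j h1 h2 h3
    have hrj := hr j
    obtain ⟨t, ht1, ht2, ht3⟩ := hno j D (by omega) h3 _ ((mem_msupport_resc hrj).1 h1) (by
      rw [dist_eq_norm, add_sub_cancel_left, norm_smul, Real.norm_of_nonneg hrj.le, mul_comm]
      gcongr)
    refine ⟨t / r j, ⟨?_, ?_⟩, ?_⟩
    · rw [le_div_iff₀ hrj]; linarith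
    · rwa [div_le_iff₀ hrj]
    · rw [flatA_resc_iff hrj, mul_div_cancel₀ _ hrj.ne']
      convert ht3 using 2
      field_simp
  obtain ⟨τ, hτ⟩ := Filter.Eventually.choice hev
  obtain ⟨τ₀, hτ₀⟩ := exists_ul_lim (x := τ) (x0 := 0) (C := G D) (hτ.mono fun j hj => by
    rw [dist_zero_right, Real.norm_of_nonneg (by linarith [hj.1.1])]; exact hj.1.2)
  have hτ1 : 1 / 2 ≤ τ₀ := ge_of_tendsto hτ₀ (hτ.mono fun j hj => hj.1.1)
  have hfl := hl.flatA_of_limit hyl hτ₀ (t := 2 * τ₀) (a' := η * (τ₀ / 2)) (by linarith)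
    (by nlinarith) (hcen (2 * τ₀) (by linarith))
  obtain ⟨j, h1, h2, h3⟩ := (hfl.and (hτ.and
    (hτ₀.eventually_const_lt (show τ₀ / 2 < τ₀ by linarith)))).exists
  exact h2.2 (h1.mono le_rfl (by gcongr))

/-- Flatness at scale `r` and above, with an error term leaving room for improvement. -/
def Admissible (n : ℕ) (S : Set (Euc d)) (η R M : ℝ) (x : Euc d) (r : ℝ) : Prop :=
  x ∈ S ∧ ∀ t, r ≤ t → t ≤ R / 2 + 2 * M * r → FlatA n S x t (η * (2 * t - √(r * t)))

theorem Admissible.step {S : Set (Euc d)} {η R M Λ r : ℝ} {x : Euc d} (hη : 0 < η) (hη1 : η ≤ 1)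
    (hr : 0 < r) (hΛ : Λ * r ≤ R / 2) (hM : 1 ≤ M) (ha : Admissible n S η R M x r)
    (H : (∀ t, r ≤ t → t ≤ Λ * r → FlatA n S x t (2 * η * t)) →
        ∃ D : ℕ, 1 ≤ D ∧ (D : ℝ) ≤ M ∧ ∃ x' ∈ S, dist x' x ≤ D * r ∧
          ∀ t, r / 2 ≤ t → t ≤ (11 * D / η) ^ 2 * r → FlatA n S x' t (η * t)) :
    ∃ x', dist x x' ≤ M * r ∧ Admissible n S η R M x' (r / 2) := by
  obtain ⟨D, hD1, hDM, x', hx', hd, hfl⟩ := H fun t ht1 ht2 =>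
    (ha.2 t ht1 (by nlinarith)).mono le_rfl (by nlinarith [Real.sqrt_nonneg (r * t)])
  have hDr : (1 : ℝ) ≤ D := by exact_mod_cast hD1
  refine ⟨x', ?_, hx', fun t ht1 ht2 => ?_⟩
  · rw [dist_comm]; exact hd.trans (by gcongr)
  have ht0 : 0 < t := by linarith
  by_cases htG : t ≤ (11 * D / η) ^ 2 * r
  · refine (hfl t ht1 htG).mono le_rfl ?_
    have h1 : √(r / 2 * t) ≤ t := by
      rw [Real.sqrt_le_left ht0.le]; nlinarith
    nlinarith
  · push Not at htG
    have hDMr : D * r ≤ M * r := by gcongr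
    have h2 := (ha.2 (t + D * r) (by
      have : 1 * r ≤ D * r := by gcongr
      linarith) (by linarith)).recenter hd
    rw [add_sub_cancel_right] at h2
    refine h2.mono le_rfl ?_
    have h3 : √(r * t) ≤ √(r * (t + D * r)) := Real.sqrt_le_sqrt (by gcongr; nlinarith)
    have h4 : 11 * D / η * r ≤ √(r * t) := by
      refine Real.le_sqrt_of_sq_le ?_
      rw [mul_pow, sq r, ← mul_assoc, mul_comm r t]
      gcongr
    have h5 : √(r / 2 * t) ≤ (18 / 25) * √(r * t) := by
      rw [Real.sqrt_le_left (by positivity), mul_pow, Real.sq_sqrt (by positivity)]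
      nlinarith [mul_pos hr ht0]
    have h6 : 11 * (D * r) ≤ η * √(r * t) := by
      have := mul_le_mul_of_nonneg_left h4 hη.le
      rw [show η * (11 * D / η * r) = 11 * (D * r) by field_simp] at this
      exact this
    have h7 : η * √(r / 2 * t) ≤ η * ((18 / 25) * √(r * t)) := by gcongr
    have h8 : η * √(r * t) ≤ η * √(r * (t + D * r)) := by gcongr
    have h9 : η * (D * r) ≤ 1 * (D * r) := by gcongr
    have h10 : 0 ≤ D * r := by positivity
    nlinarith

/-- Iterating `Admissible.step` and passing to the limit. -/
theorem exists_flat_of_admissible {S : Set (Euc d)} (hS : IsClosed S) {η R M r : ℝ} {x : Euc d}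
    (hη : 0 < η) (hr : 0 < r) (hM : 1 ≤ M) (ha : Admissible n S η R M x r)
    (H : ∀ y s, 0 < s → s ≤ r → Admissible n S η R M y s →
      ∃ y', dist y y' ≤ M * s ∧ Admissible n S η R M y' (s / 2)) :
    ∃ x' ∈ S, dist x x' ≤ 2 * M * r ∧ ∀ t, 0 < t → t ≤ R / 2 → FlatA n S x' t (5 * η * t) := by
  have hpow : ∀ k : ℕ, 0 < r / 2 ^ k := fun k => by positivity
  have H' : ∀ (k : ℕ) (y : {y // Admissible n S η R M y (r / 2 ^ k)}),
      ∃ y' : {y // Admissible n S η R M y (r / 2 ^ (k + 1))}, dist y.1 y'.1 ≤ M * (r / 2 ^ k) := by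
    rintro k ⟨y, hy⟩
    obtain ⟨y', h1, h2⟩ := H y _ (hpow k) (div_le_self hr.le (one_le_pow₀ one_le_two)) hy
    refine ⟨⟨y', ?_⟩, h1⟩
    rwa [div_div, ← pow_succ] at h2
  choose g hg using H'
  let X : (k : ℕ) → {y // Admissible n S η R M y (r / 2 ^ k)} := fun k =>
    Nat.rec (motive := fun k => {y // Admissible n S η R M y (r / 2 ^ k)}) ⟨x, by simpa using ha⟩
      (fun k y => g k y) k
  have hX : ∀ k, dist (X k).1 (X (k + 1)).1 ≤ 2 * M * r / 2 / 2 ^ k := fun k => by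
    refine (hg k (X k)).trans (le_of_eq ?_)
    ring
  obtain ⟨y, hy⟩ := cauchySeq_tendsto_of_complete (cauchySeq_of_le_geometric_two hX)
  have hyS : y ∈ S := hS.mem_of_tendsto hy (Eventually.of_forall fun k => (X k).2.1)
  have hdist := dist_le_of_le_geometric_two_of_tendsto hX hy
  refine ⟨y, hyS, ?_, fun t ht htR => ?_⟩
  · have h0 := hdist 0
    change dist x y ≤ _ at h0
    rwa [pow_zero, div_one] at h0
  have hlim : Tendsto (fun k : ℕ => 8 * M * r * (1 / 2 : ℝ) ^ k) atTop (𝓝 (8 * M * r * 0)) :=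
    (tendsto_pow_atTop_nhds_zero_of_lt_one (by norm_num) (by norm_num)).const_mul _
  rw [mul_zero] at hlim
  obtain ⟨k, hk⟩ := (hlim.eventually_lt_const ht).exists
  have e1 : 8 * M * r * (1 / 2 : ℝ) ^ k = 8 * M * (r / 2 ^ k) := by
    rw [one_div, inv_pow]; ring
  have e2 : 2 * M * r / 2 ^ k = 2 * M * (r / 2 ^ k) := by ring
  rw [e1] at hk
  have hd := hdist k
  have ha' := (X k).2.2
  have hs := hpow k
  rw [e2] at hd
  generalize (X k).1 = w at hd ha'
  generalize r / 2 ^ k = s at hd ha' hs hk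
  have hsM : 1 * s ≤ M * s := by gcongr
  have h1 := (ha' (t + 2 * M * s) (by linarith) (by linarith)).recenter_mem hyS
    (D := 2 * M * s) (by rwa [dist_comm]) (by linarith)
  rw [add_sub_cancel_right] at h1
  refine h1.mono le_rfl ?_
  have := Real.sqrt_nonneg (s * (t + 2 * M * s))
  nlinarith [mul_nonneg hη.le this]

theorem UD.exists_flat_all (h : UD μ f) (hc : 0 < c)
    (hf : Tendsto (fun r => f r / r ^ n) (𝓝[>] 0) (𝓝 c)) {θ : ℝ} (hθ : 0 < θ) :
    ∃ c₀ > 0, ∃ ε > 0, ∀ x ∈ msupport μ, ∀ r, 0 < r → r ≤ ε →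
      ∃ x' ∈ msupport μ, dist x' x ≤ 3 / 4 * r ∧ ∃ R, c₀ * r ≤ R ∧ R ≤ r / 4 ∧
        ∀ t, 0 < t → t ≤ R → FlatA n (msupport μ) x' t (θ * t) := by
  obtain ⟨η₀, hη₀, Hη⟩ := h.exists_flatter hc hf
  set η := min (min η₀ 1) (θ / 5) with hηdef
  have hη : 0 < η := by positivity
  have hη1 : η ≤ 1 := (min_le_left _ _).trans (min_le_right _ _)
  have hηθ : 5 * η ≤ θ := by have := min_le_right (min η₀ 1) (θ / 5); linarith
  obtain ⟨Λ, hΛ, M, hM, ε₀, hε₀, Hst⟩ := Hη η hη ((min_le_left _ _).trans (min_le_left _ _))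
    fun D => (11 * D / η) ^ 2
  set N := max (2 * Λ) (4 * M) with hN
  have hN0 : 0 < N := lt_max_of_lt_left (by linarith)
  obtain ⟨c₀, hc₀, ε, hε, Hb⟩ := h.exists_flat_ball hc hf (δ := η / N) (by positivity)
  refine ⟨c₀ / 2, by positivity, min ε ε₀, by positivity, fun x hx r hr hrε => ?_⟩
  obtain ⟨x₀, hx₀, hd, R, hR1, hR2, hR3⟩ := Hb x hx r hr (hrε.trans (min_le_left _ _))
  have hR : 0 < R := lt_of_lt_of_le (by positivity) hR1
  have hΛN : Λ * (R / N) ≤ R / 2 := by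
    have := le_max_left (2 * Λ) (4 * M)
    rw [mul_div_assoc', div_le_div_iff₀ hN0 two_pos]
    nlinarith
  have hMN : 2 * M * (R / N) ≤ R / 2 := by
    have := le_max_right (2 * Λ) (4 * M)
    rw [mul_div_assoc', div_le_div_iff₀ hN0 two_pos]
    nlinarith
  have hr0 : 0 < R / N := by positivity
  have hadm : Admissible n (msupport μ) η R M x₀ (R / N) := by
    refine ⟨hx₀, fun t ht1 ht2 => hR3.mono (by linarith) ?_⟩
    have h1 : √(R / N * t) ≤ t := by
      rw [Real.sqrt_le_left (by linarith)]; nlinarith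
    have h2 : η / N * R = η * (R / N) := by ring
    rw [h2]
    gcongr
    linarith
  obtain ⟨x', hx', hd', hfl⟩ := exists_flat_of_admissible (isClosed_msupport μ) hη hr0 hM hadm
    fun y s hs hsr hy => hy.step (Λ := Λ) hη hη1 hs
      ((mul_le_mul_of_nonneg_left hsr (by linarith)).trans hΛN) hM
      fun hflat => Hst y hy.1 s hs (by
        have : Λ * s ≤ Λ * (R / N) := by gcongr
        have := hrε.trans (min_le_right ε ε₀)
        linarith) hflat
  refine ⟨x', hx', ?_, R / 2, by linarith, by linarith, fun t ht htR =>
    (hfl t ht htR).mono le_rfl (by gcongr)⟩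
  have := dist_triangle x' x₀ x
  rw [dist_comm x' x₀] at this
  linarith

end

section

variable {d n : ℕ} {μ : Measure (Euc d)} {f : ℝ → ℝ} {c : ℝ}

theorem bilateralBeta_le_of_mem {x : Euc d} {s b : ℝ} (hs : 0 < s) {L : AffineSubspace ℝ (Euc d)}
    (hL : L ∈ nPlanes d n) {a : ℝ} (ha : 0 ≤ a) (hb : 0 ≤ b)
    (h1 : ∀ y ∈ msupport μ, dist y x ≤ s → infDist y (L : Set (Euc d)) ≤ a * s)
    (h2 : ∀ p ∈ L, dist p x ≤ s → infDist p (msupport μ) ≤ b * s) :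
    bilateralBeta n μ x s ≤ a + b := by
  have hbdd : BddBelow (range fun L : nPlanes d n =>
      ((⨆ y : (msupport μ ∩ Metric.closedBall x s : Set (Euc d)),
        Metric.infDist y.1 (L.1 : Set (Euc d)) / s) +
      (⨆ p : ((L.1 : Set (Euc d)) ∩ Metric.closedBall x s : Set (Euc d)),
        Metric.infDist p.1 (msupport μ) / s))) := by
    refine ⟨0, ?_⟩
    rintro _ ⟨L, rfl⟩
    exact add_nonneg (Real.iSup_nonneg fun y => div_nonneg infDist_nonneg hs.le)
      (Real.iSup_nonneg fun y => div_nonneg infDist_nonneg hs.le)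
  refine (ciInf_le hbdd ⟨L, hL⟩).trans (add_le_add ?_ ?_)
  · exact Real.iSup_le (fun y => (div_le_iff₀ hs).2 (h1 y.1 y.2.1 y.2.2)) ha
  · exact Real.iSup_le (fun y => (div_le_iff₀ hs).2 (h2 y.1 y.2.1 y.2.2)) hb

theorem bilateralBeta_le_of_frame {u : Fin n → Euc d} (hu : Orthonormal ℝ u) {x : Euc d}
    {s a b : ℝ} (hs : 0 < s) (ha : 0 ≤ a) (hb : 0 ≤ b)
    (h1 : ∀ y ∈ msupport μ, dist y x ≤ s → ‖res u (y - x)‖ ≤ a * s)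
    (h2 : ∀ v : Euc n, ‖v‖ ≤ s → ∃ y ∈ msupport μ, ‖y - (x + emb u v)‖ ≤ b * s) :
    bilateralBeta n μ x s ≤ a + b := by
  have hL : AffineSubspace.mk' x (Submodule.span ℝ (range u)) ∈ nPlanes d n := by
    refine ⟨AffineSubspace.mk'_nonempty _ _, ?_⟩
    rw [AffineSubspace.direction_mk', finrank_span_eq_card hu.linearIndependent, Fintype.card_fin]
  refine bilateralBeta_le_of_mem hs hL ha hb (fun y hy hyx => ?_) fun p hp hpx => ?_
  · have hm : x + emb u (cf u (y - x)) ∈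
        (AffineSubspace.mk' x (Submodule.span ℝ (range u)) : Set (Euc d)) := by
      rw [SetLike.mem_coe, AffineSubspace.mem_mk', vsub_eq_sub, add_sub_cancel_left]
      exact emb_mem_span _
    refine (infDist_le_dist_of_mem hm).trans (le_of_eq_of_le ?_ (h1 y hy hyx))
    rw [dist_eq_norm, res_apply, sub_add_eq_sub_sub]
  · rw [AffineSubspace.mem_mk', vsub_eq_sub, ← res_eq_zero_iff hu] at hp
    have he : x + emb u (cf u (p - x)) = p := by
      have := emb_cf_add_res (u := u) (p - x)
      rw [hp, add_zero] at this
      rw [this]; abel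
    obtain ⟨y, hy, hyp⟩ := h2 (cf u (p - x))
      ((norm_cf_le hu _).trans (by rwa [← dist_eq_norm]))
    rw [he, ← dist_eq_norm, dist_comm] at hyp
    exact (infDist_le_dist_of_mem hy).trans hyp

theorem bilateralBeta_of_subsingleton [Subsingleton (Euc d)] {x : Euc d} (hx : x ∈ msupport μ)
    {s : ℝ} (hs : 0 < s) : bilateralBeta n μ x s ≤ 0 := by
  rcases isEmpty_or_nonempty (nPlanes d n) with he | ⟨L, hL⟩
  · rw [bilateralBeta, Real.iInf_of_isEmpty]
  · obtain ⟨z, hz⟩ := hL.1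
    refine (bilateralBeta_le_of_mem hs hL le_rfl le_rfl (fun y _ _ => ?_) fun p _ _ => ?_).trans_eq
      (add_zero 0)
    · rw [Subsingleton.elim y z, infDist_zero_of_mem hz, zero_mul]
    · rw [Subsingleton.elim p x, infDist_zero_of_mem hx, zero_mul]

theorem UD.exists_bilaterally_flat (h : UD μ f) (hc : 0 < c)
    (hf : Tendsto (fun r => f r / r ^ n) (𝓝[>] 0) (𝓝 c)) {η : ℝ} (hη : 0 < η) :
    ∃ c₀ > 0, ∃ ε > 0, ∀ x ∈ msupport μ, ∀ r, 0 < r → r ≤ ε →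
      ∃ x' ∈ msupport μ, ∃ r', c₀ * r ≤ r' ∧ closedBall x' r' ⊆ closedBall x r ∧
        ∀ s, 0 < s → s ≤ r' → bilateralBeta n μ x' s ≤ η := by
  obtain ⟨θ, hθ, ε₁, hε₁, Hd⟩ := h.exists_dense_of_flat hc hf (half_pos hη)
  obtain ⟨c₀, hc₀, ε, hε, Hf⟩ := h.exists_flat_all hc hf
    (θ := min (θ / 2) (η / 4)) (by positivity)
  refine ⟨c₀ / 2, by positivity, min ε ε₁, by positivity, fun x hx r hr hrε => ?_⟩
  obtain ⟨x', hx', hd, R, hR1, hR2, hflat⟩ := Hf x hx r hr (hrε.trans (min_le_left _ _))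
  have hrε₁ := hrε.trans (min_le_right _ _)
  refine ⟨x', hx', R / 2, by linarith, closedBall_subset_closedBall' (by linarith),
    fun s hs hsR => ?_⟩
  obtain ⟨u, hu, hfu⟩ := hflat (2 * s) (by linarith) (by linarith)
  rw [show η = η / 2 + η / 2 by ring]
  refine bilateralBeta_le_of_frame hu hs (by positivity) (by positivity) (fun y hy hyx => ?_)
    (Hd x' hx' s hs (by linarith) u hu fun y hy hyx => ?_)
  · refine (hfu y hy (by linarith)).trans ?_
    nlinarith [min_le_right (θ / 2) (η / 4)]
  · refine (hfu y hy hyx).trans ?_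
    nlinarith [min_le_left (θ / 2) (η / 4)]

/-- In a space containing a unit vector, balls contained in a bounded set have bounded radius. -/
theorem exists_radius_bound {E : Type*} [NormedAddCommGroup E] [NormedSpace ℝ E] [Nontrivial E]
    {K : Set E} (hK : Bornology.IsBounded K) :
    ∃ ρ > 0, ∀ (x : E) (r : ℝ), 0 < r → closedBall x r ⊆ K → r ≤ ρ := by
  obtain ⟨C, hC⟩ := hK.exists_norm_le
  obtain ⟨e, he⟩ := exists_norm_eq E zero_le_one
  refine ⟨max C 1, by positivity, fun x r hr hx => le_max_of_le_left ?_⟩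
  have h1 := hC (x + r • e) (hx (by
    rw [mem_closedBall, dist_self_add_left, norm_smul, he, mul_one, Real.norm_of_nonneg hr.le]))
  have h2 := hC (x - r • e) (hx (by
    rw [mem_closedBall, dist_eq_norm, sub_sub_cancel_left, norm_neg, norm_smul, he, mul_one,
      Real.norm_of_nonneg hr.le]))
  have h3 : (2 * r) • e = (x + r • e) - (x - r • e) := by module
  have h4 := norm_sub_le (x + r • e) (x - r • e)
  rw [← h3, norm_smul, he, mul_one, Real.norm_of_nonneg (by positivity)] at h4
  linarith

end

end

theorem stability_big_flat_balls {d n p : ℕ}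
    (μ : Measure (Euc d)) [IsLocallyFiniteMeasure μ]
    (φ : ℝ → ENNReal) (hφ : IsDistributionFunction μ φ)
    (hn : HasDim0 φ n) (hp : HasDimInfty φ p)
    (K : Set (Euc d)) (hK : IsCompact K) (η : ℝ) (hη : 0 < η) :
    ∃ c : ℝ, 0 < c ∧
      ∀ x ∈ msupport μ ∩ K, ∀ r : ℝ, 0 < r → Metric.closedBall x r ⊆ K →
        ∃ x' ∈ msupport μ, ∃ r' : ℝ, c * r ≤ r' ∧
          Metric.closedBall x' r' ⊆ Metric.closedBall x r ∧
          ∀ k : ℕ, bilateralBeta n μ x' ((2:ℝ) ^ (-(k:ℤ)) * r') ≤ η := by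
  have hk0 : ∀ k : ℕ, (0 : ℝ) < (2 : ℝ) ^ (-(k : ℤ)) := fun k => by positivity
  have hk1 : ∀ k : ℕ, (2 : ℝ) ^ (-(k : ℤ)) ≤ 1 := fun k =>
    zpow_le_one_of_nonpos₀ one_le_two (by simp)
  rcases subsingleton_or_nontrivial (Euc d) with hd | hd
  · exact ⟨1, one_pos, fun x hx r hr _ => ⟨x, hx.1, r, (one_mul r).le, Subset.rfl, fun k =>
      (bilateralBeta_of_subsingleton hx.1 (mul_pos (hk0 k) hr)).trans hη.le⟩⟩
  have hUD : UD μ fun r => (φ r).toReal :=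
    ⟨fun t ht => ENNReal.toReal_pos (hφ.2.1 t ht).1.ne' (hφ.2.1 t ht).2.ne, fun x hx t ht => by
      rw [hφ.2.2 x hx t ht, ENNReal.ofReal_toReal (hφ.2.1 t ht).2.ne]⟩
  obtain ⟨c, hc, hlim⟩ := hn
  obtain ⟨c₀, hc₀, ε, hε, H⟩ := hUD.exists_bilaterally_flat hc hlim hη
  obtain ⟨ρ, hρ, Hρ⟩ := exists_radius_bound hK.isBounded
  refine ⟨c₀ * min 1 (ε / ρ), by positivity, fun x hx r hr hrK => ?_⟩
  obtain ⟨x', hx', r', hr', hsub, hb⟩ := H x hx.1 (min r ε) (by positivity) (min_le_right _ _)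
  have hr'0 : 0 < r' := lt_of_lt_of_le (by positivity) hr'
  refine ⟨x', hx', r', le_trans ?_ hr', hsub.trans (closedBall_subset_closedBall (min_le_left _ _)),
    fun k => hb _ (mul_pos (hk0 k) hr'0) (mul_le_of_le_one_left hr'0.le (hk1 k))⟩
  rw [mul_assoc]
  gcongr
  refine le_min (mul_le_of_le_one_left hr.le (min_le_left _ _)) ?_
  calc min 1 (ε / ρ) * r ≤ ε / ρ * ρ := by
        gcongr
        · exact min_le_right _ _
        · exact Hρ x r hr hrK
    _ = ε := div_mul_cancel₀ _ hρ.ne'
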